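/- Let $0 < q < p$, $q < 1$, $r < p$, $r \le 1$, and let $u, v, w$ be weights on $(a,b)$ with $0 < \int_x^b w < \infty$ for all $x \in (a,b)$. Then $\big(\int_a^b \big(\int_a^t f^r v\big)^{q/r} u\,dt\big)^{1/q} \le C \big(\int_a^b \big(\int_a^t f\big)^{p} w\,dt\big)^{1/p}$ holds for all nonnegative measurable $f$ if and only if $C_1$, $C_5$, and $C_6$ are all finite, where $C_1 := \operatorname{ess\,sup}_{x\in(a,b)} (\int_x^b w)^{-1/p} \operatorname{ess\,sup}_{t\in(x,b)} (\int_t^b u)^{1/q} V_r(x,t)$, $C_5 := \big(\int_a^b w(x) \sup_{y\in(a,x)} (\int_y^b w)^{-p/(p-q)} \big(\int_y^x (\int_t^x u)^{q/(1-q)} u(t)\, V_r(y,t)^{q/(1-q)} dt\big)^{p(1-q)/(p-q)} dx\big)^{(p-q)/(pq)}$, and $C_6 := \big(\int_a^b w(x)\, \operatorname{ess\,sup}_{y\in(a,x)} (\int_y^b w)^{-1} \big(\int_y^x (\int_t^b u)^{q/(p-q)} u(t)\, \big(\int_a^y (\int_s^b w)^{-p/(p-r)} w(s)\, V_r(s,y)^{pr/(p-r)}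 ds\big)^{(p-r)q/((p-q)r)} dt\big)\, dx\big)^{(p-q)/(pq)}$; moreover the best constant satisfies $C \approx C_1 + C_5 + C_6$. -/

import Mathlib

open MeasureTheory Set ENNReal

noncomputable section

/-- `w` is a weight on `(a,b)`: measurable, positive and finite there. -/
def IsWeight (a b : ℝ) (w : ℝ → ℝ≥0∞) : Prop :=
  Measurable w ∧ ∀ x ∈ Set.Ioo a b, 0 < w x ∧ w x < ∞

/-- The quantity `V_r(x,t)`: `(∫_x^t v^{1/(1-r)})^{(1-r)/r}` for `0 < r < 1`,
and `ess sup_{(x,t)} v` for `r = 1`. -/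
def Vr (r : ℝ) (v : ℝ → ℝ≥0∞) (x t : ℝ) : ℝ≥0∞ :=
  if r = 1 then essSup v (volume.restrict (Set.Ioo x t))
  else (∫⁻ s in Set.Ioo x t, v s ^ (1 / (1 - r))) ^ ((1 - r) / r)

/-- The Cesàro–Cesàro inequality (2.2) with constant `C`:
`(∫_a^b (∫_a^t f^r v)^{q/r} u dt)^{1/q} ≤ C (∫_a^b (∫_a^t f)^p w dt)^{1/p}`
for all nonnegative measurable `f` on `(a,b)`. -/
def CesCesIneq (a b r p q : ℝ) (u v w : ℝ → ℝ≥0∞) (C : ℝ≥0∞) : Prop :=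
  ∀ f : ℝ → ℝ≥0∞, Measurable f →
    (∫⁻ t in Set.Ioo a b, (∫⁻ s in Set.Ioo a t, f s ^ r * v s) ^ (q / r) * u t) ^ (1 / q) ≤
      C * (∫⁻ t in Set.Ioo a b, (∫⁻ s in Set.Ioo a t, f s) ^ p * w t) ^ (1 / p)

/-- The best (least) constant in the Cesàro–Cesàro inequality. -/
def BestC (a b r p q : ℝ) (u v w : ℝ → ℝ≥0∞) : ℝ≥0∞ :=
  sInf {C | CesCesIneq a b r p q u v w C}

def C₁ (a b r p q : ℝ) (u v w : ℝ → ℝ≥0∞) : ℝ≥0∞ :=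
  essSup (fun x => (∫⁻ t in Set.Ioo x b, w t) ^ (-(1 / p)) *
      essSup (fun t => (∫⁻ s in Set.Ioo t b, u s) ^ (1 / q) * Vr r v x t)
        (volume.restrict (Set.Ioo x b)))
    (volume.restrict (Set.Ioo a b))

def C₂ (a b r p q : ℝ) (u v w : ℝ → ℝ≥0∞) : ℝ≥0∞ :=
  ⨆ x ∈ Set.Ioo a b, (∫⁻ t in Set.Ioo x b, w t) ^ (-(1 / p)) *
    (∫⁻ t in Set.Ioo x b,
        (∫⁻ s in Set.Ioo t b, u s) ^ (q / (1 - q)) * u t * Vr r v x t ^ (q / (1 - q))) ^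
      ((1 - q) / q)

def C₃ (a b r p q : ℝ) (u v w : ℝ → ℝ≥0∞) : ℝ≥0∞ :=
  ⨆ x ∈ Set.Ioo a b, (∫⁻ t in Set.Ioo x b, u t) ^ (1 / q) *
    (∫⁻ t in Set.Ioo a x,
        (∫⁻ s in Set.Ioo t b, w s) ^ (-(p / (p - r))) * w t * Vr r v t x ^ (p * r / (p - r))) ^
      ((p - r) / (p * r))

def C₄ (a b r p q : ℝ) (u v w : ℝ → ℝ≥0∞) : ℝ≥0∞ :=
  (∫⁻ x in Set.Ioo a b, (∫⁻ s in Set.Ioo x b, u s) ^ (q / (p - q)) * u x *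
      essSup (fun t => (∫⁻ s in Set.Ioo t b, w s) ^ (-(q / (p - q))) *
          Vr r v t x ^ (p * q / (p - q)))
        (volume.restrict (Set.Ioo a x))) ^ ((p - q) / (p * q))

def C₅ (a b r p q : ℝ) (u v w : ℝ → ℝ≥0∞) : ℝ≥0∞ :=
  (∫⁻ x in Set.Ioo a b, w x *
      ⨆ y ∈ Set.Ioo a x, (∫⁻ s in Set.Ioo y b, w s) ^ (-(p / (p - q))) *
        (∫⁻ t in Set.Ioo y x,
            (∫⁻ s in Set.Ioo t x, u s) ^ (q / (1 - q)) * u t * Vr r v y t ^ (q / (1 - q))) ^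
          (p * (1 - q) / (p - q))) ^ ((p - q) / (p * q))

def C₆ (a b r p q : ℝ) (u v w : ℝ → ℝ≥0∞) : ℝ≥0∞ :=
  (∫⁻ x in Set.Ioo a b, w x *
      essSup (fun y => (∫⁻ s in Set.Ioo y b, w s)⁻¹ *
          (∫⁻ t in Set.Ioo y x, (∫⁻ s in Set.Ioo t b, u s) ^ (q / (p - q)) * u t *
              (∫⁻ s in Set.Ioo a y, (∫⁻ σ in Set.Ioo s b, w σ) ^ (-(p / (p - r))) * w s *
                  Vr r v s y ^ (p * r / (p - r))) ^ ((p - r) * q / ((p - q) * r))))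
        (volume.restrict (Set.Ioo a x))) ^ ((p - q) / (p * q))

def C₇ (a b r p q : ℝ) (u v w : ℝ → ℝ≥0∞) : ℝ≥0∞ :=
  (∫⁻ x in Set.Ioo a b, w x *
      essSup (fun y => (∫⁻ s in Set.Ioo y b, w s) ^ (-(p / (p - q))) *
          essSup (fun t => (∫⁻ s in Set.Ioo t x, u s) ^ (p / (p - q)) *
              Vr r v y t ^ (p * q / (p - q)))
            (volume.restrict (Set.Ioo y x)))
        (volume.restrict (Set.Ioo a x))) ^ ((p - q) / (p * q))

/-- Reindexing a triangular double sum by the difference of the indices. -/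
theorem tsum_range_succ_sub (a : ℕ → ℕ → ℝ≥0∞) :
    ∑' k, ∑ j ∈ Finset.range (k + 1), a j (k - j) = ∑' j, ∑' n, a j n := by
  have h : ∀ k, ∑ j ∈ Finset.range (k + 1), a j (k - j) =
      ∑' x : Finset.HasAntidiagonal.antidiagonal k, a x.1.1 x.1.2 := by
    intro k
    rw [← Finset.Nat.sum_antidiagonal_eq_sum_range_succ_mk (f := fun x => a x.1 x.2),
      tsum_fintype, ← Finset.sum_coe_sort _ (fun x : ℕ × ℕ => a x.1 x.2)]
  simp_rw [h]
  rw [← ENNReal.tsum_prod (f := a),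
    ← Finset.HasAntidiagonal.sigmaAntidiagonalEquivProd.tsum_eq
      (fun x : ℕ × ℕ => a x.1 x.2), ENNReal.tsum_sigma']
  rfl

/-- Discrete Hardy inequality with geometric weights. -/
theorem exists_tsum_geometric_mul_rpow_sum_le {s : ℝ} (hs : 0 < s) {ρ : ℝ≥0∞} (h0 : ρ ≠ 0)
    (h1 : ρ < 1) :
    ∃ κ : ℝ≥0∞, κ < ∞ ∧ ∀ d : ℕ → ℝ≥0∞,
      ∑' i, ρ ^ i * (∑ j ∈ Finset.range (i + 1), d j) ^ s ≤ κ * ∑' i, ρ ^ i * d i ^ s := by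
  have hρt : ρ ≠ ∞ := (h1.trans one_lt_top).ne
  set σ : ℝ≥0∞ := ρ ^ (1 / 2 : ℝ) with hσ
  have hσ0 : σ ≠ 0 := by simp [hσ, h0, hρt]
  have hσt : σ ≠ ∞ := by simp [hσ, h0, hρt]
  have hσ1 : σ < 1 := ENNReal.rpow_lt_one h1 (by norm_num)
  have hσ2 : σ * σ = ρ := by
    rw [hσ, ← ENNReal.rpow_add _ _ h0 hρt]; norm_num
  set c : ℝ≥0∞ := σ ^ (1 / s) with hc
  have hc0 : c ≠ 0 := by simp [hc, hσ0, hσt]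
  have hct : c ≠ ∞ := ENNReal.rpow_ne_top_of_nonneg (by positivity) hσt
  have hc1 : c < 1 := ENNReal.rpow_lt_one hσ1 (by positivity)
  have hcs : c ^ s = σ := by
    rw [hc, ← ENNReal.rpow_mul, one_div_mul_cancel hs.ne', ENNReal.rpow_one]
  have hcK : (1 - c)⁻¹ ≠ ∞ := by simpa [tsub_eq_zero_iff_le] using hc1
  have hσK : (1 - σ)⁻¹ ≠ ∞ := by simpa [tsub_eq_zero_iff_le] using hσ1
  refine ⟨((1 - c)⁻¹) ^ s * (1 - σ)⁻¹, ENNReal.mul_lt_top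
    (ENNReal.rpow_lt_top_of_nonneg hs.le hcK) hσK.lt_top, fun d => ?_⟩
  have key : ∀ i, (∑ j ∈ Finset.range (i + 1), d j) ^ s ≤
      ((1 - c)⁻¹) ^ s * ∑ j ∈ Finset.range (i + 1), (σ ^ (i - j))⁻¹ * d j ^ s := by
    intro i
    set X := ∑ j ∈ Finset.range (i + 1), (σ ^ (i - j))⁻¹ * d j ^ s with hX
    have h2 : ∑ j ∈ Finset.range (i + 1), d j ≤ (1 - c)⁻¹ * X ^ (1 / s) := by
      calc ∑ j ∈ Finset.range (i + 1), d j
          ≤ ∑ j ∈ Finset.range (i + 1), c ^ (i - j) * X ^ (1 / s) := by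
            refine Finset.sum_le_sum fun j hj => ?_
            have h3 : (σ ^ (i - j))⁻¹ * d j ^ s ≤ X :=
              Finset.single_le_sum (f := fun j => (σ ^ (i - j))⁻¹ * d j ^ s)
                (fun _ _ => zero_le) hj
            have h4 : d j ^ s ≤ σ ^ (i - j) * X := by
              rwa [ENNReal.inv_mul_le_iff (pow_ne_zero _ hσ0) (ENNReal.pow_ne_top hσt)] at h3
            have h5 := ENNReal.rpow_le_rpow h4 (by positivity : 0 ≤ 1 / s)
            rw [← ENNReal.rpow_mul, mul_one_div_cancel hs.ne', ENNReal.rpow_one,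
              ENNReal.mul_rpow_of_nonneg _ _ (by positivity)] at h5
            refine h5.trans_eq ?_
            rw [← ENNReal.rpow_natCast, ← ENNReal.rpow_natCast, ← ENNReal.rpow_mul, hc,
              ← ENNReal.rpow_mul σ (1 / s), mul_comm (1 / s)]
        _ = (∑ j ∈ Finset.range (i + 1), c ^ (i - j)) * X ^ (1 / s) := by
            rw [Finset.sum_mul]
        _ ≤ (1 - c)⁻¹ * X ^ (1 / s) := by
            gcongr
            have := Finset.sum_range_reflect (fun n => c ^ n) (i + 1)
            simp only [Nat.add_sub_cancel] at this
            rw [this, ← ENNReal.tsum_geometric]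
            exact ENNReal.sum_le_tsum _
    calc _ ≤ ((1 - c)⁻¹ * X ^ (1 / s)) ^ s := ENNReal.rpow_le_rpow h2 hs.le
      _ = _ := by
        rw [ENNReal.mul_rpow_of_nonneg _ _ hs.le, ← ENNReal.rpow_mul, one_div_mul_cancel hs.ne',
          ENNReal.rpow_one]
  calc ∑' i, ρ ^ i * (∑ j ∈ Finset.range (i + 1), d j) ^ s
      ≤ ∑' i, ((1 - c)⁻¹) ^ s * ∑ j ∈ Finset.range (i + 1), (ρ ^ j * d j ^ s) * σ ^ (i - j) := by
        refine ENNReal.tsum_le_tsum fun i => ?_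
        calc _ ≤ ρ ^ i * (((1 - c)⁻¹) ^ s *
              ∑ j ∈ Finset.range (i + 1), (σ ^ (i - j))⁻¹ * d j ^ s) := by gcongr; exact key i
          _ = ((1 - c)⁻¹) ^ s * ∑ j ∈ Finset.range (i + 1), ρ ^ i *
                ((σ ^ (i - j))⁻¹ * d j ^ s) := by
              rw [← Finset.mul_sum]; ring
          _ = _ := by
              congr 1
              refine Finset.sum_congr rfl fun j hj => ?_
              have hji : j ≤ i := Nat.lt_succ_iff.1 (Finset.mem_range.1 hj)
              have e1 : ρ ^ i = ρ ^ j * (σ ^ (i - j) * σ ^ (i - j)) := by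
                rw [← mul_pow, hσ2, ← pow_add]; congr 1; omega
              have e2 : σ ^ (i - j) * (σ ^ (i - j))⁻¹ = 1 :=
                ENNReal.mul_inv_cancel (pow_ne_zero _ hσ0) (ENNReal.pow_ne_top hσt)
              rw [e1]
              calc _ = ρ ^ j * d j ^ s * σ ^ (i - j) * (σ ^ (i - j) * (σ ^ (i - j))⁻¹) := by ring
                _ = _ := by rw [e2, mul_one]
    _ = _ := by
        rw [ENNReal.tsum_mul_left,
          tsum_range_succ_sub (fun j n => (ρ ^ j * d j ^ s) * σ ^ n), mul_assoc]
        simp_rw [ENNReal.tsum_mul_left, ENNReal.tsum_geometric, ENNReal.tsum_mul_right]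
        ring

/-- A sum of suprema over independent indices is bounded by the sums over all choices. -/
theorem tsum_iSup_le_two_mul {ι : Type*} [Nonempty ι] (ψ : ℕ → ι → ℝ≥0∞) (K : ℝ≥0∞)
    (h : ∀ g : ℕ → ι, ∑' j, ψ j (g j) ≤ K) : ∑' j, ⨆ i, ψ j i ≤ 2 * K := by
  rcases eq_or_ne K ∞ with rfl | hK
  · simp
  have hfin : ∀ j, ⨆ i, ψ j i ≤ K := fun j => iSup_le fun i =>
    (ENNReal.le_tsum (f := fun j => ψ j i) j).trans (h fun _ => i)
  have hch : ∀ j, ∃ i, ⨆ i, ψ j i ≤ 2 * ψ j i := by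
    intro j
    by_cases h0 : ⨆ i, ψ j i = 0
    · exact ⟨Classical.arbitrary ι, by simp [h0]⟩
    · have hlt : (⨆ i, ψ j i) / 2 < ⨆ i, ψ j i :=
        ENNReal.half_lt_self h0 ((hfin j).trans_lt hK.lt_top).ne
      obtain ⟨i, hi⟩ := lt_iSup_iff.1 hlt
      refine ⟨i, ?_⟩
      rw [mul_comm]
      exact (ENNReal.div_le_iff (by norm_num) (by norm_num)).1 hi.le
  choose g hg using hch
  calc _ ≤ ∑' j, 2 * ψ j (g j) := ENNReal.tsum_le_tsum hg
    _ ≤ _ := by rw [ENNReal.tsum_mul_left]; gcongr; exact h g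

/-- Duality between weighted `ℓ^P` and power-type functionals with exponent `q < P`. -/
theorem tsum_rpow_le_of_forall_tsum_rpow_le_one {q P : ℝ} (hq : 0 < q) (hqP : q < P)
    (b : ℕ → ℝ≥0∞) (K : ℝ≥0∞)
    (h : ∀ c : ℕ → ℝ≥0∞, ∑' i, c i ^ P ≤ 1 → ∑' i, b i * c i ^ q ≤ K) :
    ∑' i, b i ^ (P / (P - q)) ≤ K ^ (P / (P - q)) := by
  have hP : 0 < P := hq.trans hqP
  have hPq : 0 < P - q := sub_pos.2 hqP
  rcases eq_or_ne K ∞ with rfl | hK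
  · simp [ENNReal.top_rpow_of_pos (div_pos hP hPq)]
  have hb : ∀ i, b i ≠ ∞ := by
    intro i
    have h1 := h (fun j => if j = i then 1 else 0) (by
      rw [tsum_eq_single i (by intro j hj; simp [hj, hP])]; simp)
    have h2 := (ENNReal.le_tsum i).trans h1
    simp only [if_true, ENNReal.one_rpow, mul_one] at h2
    exact (h2.trans_lt hK.lt_top).ne
  rw [ENNReal.tsum_eq_iSup_sum]
  refine iSup_le fun t => ?_
  set S := ∑ i ∈ t, b i ^ (P / (P - q)) with hS
  have hSt : S ≠ ∞ := by
    rw [hS]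
    exact ENNReal.sum_ne_top.2 fun i _ => ENNReal.rpow_ne_top_of_nonneg (by positivity) (hb i)
  rcases eq_or_ne S 0 with h0 | h0
  · rw [h0]; exact zero_le
  have hcP : ∑' i, (if i ∈ t then b i ^ (1 / (P - q)) * S ^ (-(1 / P)) else 0) ^ P ≤ 1 := by
    rw [tsum_eq_sum (s := t) (by intro j hj; simp [hj, hP])]
    calc _ = ∑ i ∈ t, b i ^ (P / (P - q)) * S ^ (-1 : ℝ) := by
          refine Finset.sum_congr rfl fun i hi => ?_
          rw [if_pos hi, ENNReal.mul_rpow_of_nonneg _ _ hP.le, ← ENNReal.rpow_mul,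
            ← ENNReal.rpow_mul]
          congr 2 <;> field_simp
      _ = 1 := by
          rw [← Finset.sum_mul, ← hS, ENNReal.rpow_neg_one, ENNReal.mul_inv_cancel h0 hSt]
      _ ≤ 1 := le_rfl
  have h1 := h _ hcP
  rw [tsum_eq_sum (s := t) (by intro j hj; simp [hj, hq])] at h1
  have h2 : ∑ i ∈ t, b i * (if i ∈ t then b i ^ (1 / (P - q)) * S ^ (-(1 / P)) else 0) ^ q =
      S ^ (1 - q / P) := by
    calc _ = ∑ i ∈ t, b i ^ (P / (P - q)) * S ^ (-(q / P)) := by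
          refine Finset.sum_congr rfl fun i hi => ?_
          rw [if_pos hi, ENNReal.mul_rpow_of_nonneg _ _ hq.le, ← ENNReal.rpow_mul,
            ← ENNReal.rpow_mul, ← mul_assoc]
          congr 1
          · nth_rewrite 1 [← ENNReal.rpow_one (b i)]
            rw [← ENNReal.rpow_add_of_nonneg _ _ (by norm_num) (by positivity)]
            congr 1; field_simp; ring
          · congr 1; field_simp
      _ = S ^ (1 : ℝ) * S ^ (-(q / P)) := by rw [← Finset.sum_mul, ENNReal.rpow_one]
      _ = _ := by rw [← ENNReal.rpow_add _ _ h0 hSt, ← sub_eq_add_neg]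
  rw [h2] at h1
  have h3 := ENNReal.rpow_le_rpow h1 (by positivity : 0 ≤ P / (P - q))
  rwa [← ENNReal.rpow_mul, show (1 - q / P) * (P / (P - q)) = 1 by field_simp,
    ENNReal.rpow_one] at h3

/-- Hölder's inequality for series, with conjugate exponents `1/x` and `1/y`. -/
theorem tsum_mul_le_rpow_mul_rpow {ι : Type*} {x y : ℝ} (hx : 0 < x) (hy : 0 < y)
    (hxy : x + y = 1) (f g : ι → ℝ≥0∞) :
    ∑' i, f i ^ x * g i ^ y ≤ (∑' i, f i) ^ x * (∑' i, g i) ^ y := by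
  rw [ENNReal.tsum_eq_iSup_sum]
  refine iSup_le fun t => ?_
  have hpq : (1 / x).HolderConjugate (1 / y) := by
    rw [Real.holderConjugate_iff]
    refine ⟨?_, by simpa using hxy⟩
    rw [lt_div_iff₀ hx]; linarith
  have := ENNReal.inner_le_Lp_mul_Lq t (fun i => f i ^ x) (fun i => g i ^ y) hpq
  simp only [← ENNReal.rpow_mul, mul_one_div_cancel hx.ne', mul_one_div_cancel hy.ne',
    ENNReal.rpow_one, one_div_one_div] at this
  refine this.trans ?_
  gcongr <;> exact ENNReal.sum_le_tsum _

/-- A finite-sum quasi-triangle inequality for powers. -/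
theorem exists_add_rpow_le {s : ℝ} (hs : 0 < s) :
    ∃ κ : ℝ≥0∞, κ < ∞ ∧ ∀ x y : ℝ≥0∞, (x + y) ^ s ≤ κ * (x ^ s + y ^ s) := by
  refine ⟨2 ^ s, ENNReal.rpow_lt_top_of_nonneg hs.le (by norm_num), fun x y => ?_⟩
  calc (x + y) ^ s ≤ (2 * max x y) ^ s := by
        gcongr
        rw [two_mul]
        exact add_le_add (le_max_left _ _) (le_max_right _ _)
    _ = 2 ^ s * (max x y) ^ s := ENNReal.mul_rpow_of_nonneg _ _ hs.le
    _ ≤ _ := by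
        gcongr
        rcases max_cases x y with h | h <;> rw [h.1] <;> simp

theorem lintegral_Ico_eq_Ioo (g : ℝ → ℝ≥0∞) (x y : ℝ) :
    ∫⁻ t in Ico x y, g t = ∫⁻ t in Ioo x y, g t :=
  (setLIntegral_congr Ioo_ae_eq_Ico).symm

theorem lintegral_Ioo_split (g : ℝ → ℝ≥0∞) {x y b : ℝ} (hxy : x ≤ y) (hyb : y ≤ b) :
    ∫⁻ t in Ioo x b, g t = (∫⁻ t in Ioo x y, g t) + ∫⁻ t in Ioo y b, g t := by
  simp_rw [← lintegral_Ico_eq_Ioo]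
  rw [← Ico_union_Ico_eq_Ico hxy hyb, lintegral_union measurableSet_Ico]
  rw [Set.disjoint_left]
  rintro t ⟨_, h1⟩ ⟨h2, _⟩
  exact absurd h1 h2.not_gt

theorem antitone_lintegral_Ioo_left (g : ℝ → ℝ≥0∞) (b : ℝ) :
    Antitone fun x => ∫⁻ t in Ioo x b, g t :=
  fun _ _ h => lintegral_mono_set (Ioo_subset_Ioo_left h)

theorem monotone_lintegral_Ioo_right (g : ℝ → ℝ≥0∞) (a : ℝ) :
    Monotone fun x => ∫⁻ t in Ioo a x, g t :=
  fun _ _ h => lintegral_mono_set (Ioo_subset_Ioo_right h)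

theorem lintegral_Ioo_pos {g : ℝ → ℝ≥0∞} (hg : Measurable g) {x y : ℝ} (hxy : x < y)
    (h : ∀ t ∈ Ioo x y, 0 < g t) : 0 < ∫⁻ t in Ioo x y, g t := by
  rw [setLIntegral_pos_iff hg]
  have : Function.support g ∩ Ioo x y = Ioo x y :=
    inter_eq_right.2 fun t ht => (h t ht).ne'
  rw [this, Real.volume_Ioo]
  simpa using hxy

/-- Continuity from inside at the left end point. -/
theorem lintegral_Ioo_le_of_forall_left {g : ℝ → ℝ≥0∞} {c d e : ℝ} (hcd : c < d) {E : ℝ≥0∞}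
    (h : ∀ y ∈ Ioo c d, ∫⁻ t in Ioo y e, g t ≤ E) : ∫⁻ t in Ioo c e, g t ≤ E := by
  obtain ⟨y, hy, hyc, hlim⟩ := exists_seq_strictAnti_tendsto' hcd
  have hU : Ioo c e = ⋃ n, Ioo (y n) e := by
    ext t
    simp only [mem_iUnion, mem_Ioo]
    constructor
    · rintro ⟨h1, h2⟩
      obtain ⟨n, hn⟩ := (hlim.eventually_lt_const h1).exists
      exact ⟨n, hn, h2⟩
    · rintro ⟨n, h1, h2⟩
      exact ⟨(hyc n).1.trans h1, h2⟩
  rw [hU, setLIntegral_iUnion_of_directed]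
  · exact iSup_le fun n => h _ (hyc n)
  · exact (monotone_nat_of_le_succ fun n =>
      Ioo_subset_Ioo_left (hy.antitone (Nat.le_succ n))).directed_le

/-- Continuity from inside at the right end point. -/
theorem lintegral_Ioo_le_of_forall_right {g : ℝ → ℝ≥0∞} {c d e : ℝ} (hcd : c < d) {E : ℝ≥0∞}
    (h : ∀ y ∈ Ioo c d, ∫⁻ t in Ioo e y, g t ≤ E) : ∫⁻ t in Ioo e d, g t ≤ E := by
  obtain ⟨y, hy, hyc, hlim⟩ := exists_seq_strictMono_tendsto' hcd
  have hU : Ioo e d = ⋃ n, Ioo e (y n) := by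
    ext t
    simp only [mem_iUnion, mem_Ioo]
    constructor
    · rintro ⟨h1, h2⟩
      obtain ⟨n, hn⟩ := (hlim.eventually_const_lt h2).exists
      exact ⟨n, h1, hn⟩
    · rintro ⟨n, h1, h2⟩
      exact ⟨h1, h2.trans (hyc n).2⟩
  rw [hU, setLIntegral_iUnion_of_directed]
  · exact iSup_le fun n => h _ (hyc n)
  · exact (monotone_nat_of_le_succ fun n =>
      Ioo_subset_Ioo_right (hy.monotone (Nat.le_succ n))).directed_le

theorem exists_mem_Ioo_of_ae {P : ℝ → Prop} {c d e : ℝ}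
    (h : ∀ᵐ y ∂(volume.restrict (Ioo c d)), P y) (hce : c < e) (hed : e ≤ d) :
    ∃ y ∈ Ioo c e, P y := by
  rw [ae_restrict_iff' measurableSet_Ioo] at h
  by_contra! hne
  have h1 : volume (Ioo c e) ≤ 0 := by
    rw [← (ae_iff.1 h)]
    refine measure_mono fun y hy => ?_
    exact fun hP => hne y hy (hP ⟨hy.1, hy.2.trans_le hed⟩)
  rw [Real.volume_Ioo] at h1
  simp at h1
  linarith

/-- The tail `x ↦ ∫_x^b φ` takes all intermediate values. -/
theorem exists_lintegral_Ioo_eq {φ : ℝ → ℝ≥0∞} (hφ : Measurable φ) {z b : ℝ} (hzb : z ≤ b)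
    (hfin : ∫⁻ s in Ioo z b, φ s ≠ ∞) {c : ℝ≥0∞} (hc : c ≤ ∫⁻ s in Ioo z b, φ s) :
    ∃ x ∈ Icc z b, ∫⁻ s in Ioo x b, φ s = c := by
  set M := ∫⁻ s in Ioo z b, φ s with hM
  have hIcc : ∀ x, ∫⁻ s in Icc z x, φ s = ∫⁻ s in Ioo z x, φ s := fun x =>
    (setLIntegral_congr Ioo_ae_eq_Icc).symm
  have hint : IntegrableOn (fun s => (φ s).toReal) (Icc z b) volume :=
    integrable_toReal_of_lintegral_ne_top hφ.aemeasurable (by rw [hIcc]; exact hfin)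
  have hF : ∀ x ∈ Icc z b, ∫ s in Icc z x, (φ s).toReal = (∫⁻ s in Ioo z x, φ s).toReal := by
    intro x hx
    rw [integral_toReal hφ.aemeasurable, hIcc]
    refine ae_lt_top hφ ?_
    rw [hIcc]
    exact ((monotone_lintegral_Ioo_right φ z hx.2).trans_lt hfin.lt_top).ne
  have hcont := intervalIntegral.continuousOn_primitive_Icc hint
  have hcM : c ≠ ∞ := (hc.trans_lt hfin.lt_top).ne
  have hmem : (M - c).toReal ∈ Icc (∫ s in Icc z z, (φ s).toReal)
      (∫ s in Icc z b, (φ s).toReal) := by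
    rw [hF z ⟨le_rfl, hzb⟩, hF b ⟨hzb, le_rfl⟩]
    refine ⟨by simp, ENNReal.toReal_mono hfin tsub_le_self⟩
  obtain ⟨x, hx, hxe⟩ := intermediate_value_Icc hzb hcont hmem
  refine ⟨x, hx, ?_⟩
  have hxe' : (∫ s in Icc z x, (φ s).toReal) = (M - c).toReal := hxe
  have hxfin : ∫⁻ s in Ioo z x, φ s ≠ ∞ :=
    ((monotone_lintegral_Ioo_right φ z hx.2).trans_lt hfin.lt_top).ne
  rw [hF x hx, ENNReal.toReal_eq_toReal_iff' hxfin (ENNReal.sub_ne_top hfin)] at hxe'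
  have hs := lintegral_Ioo_split φ hx.1 hx.2
  rw [hxe'] at hs
  have h2 : M = M - c + c := (tsub_add_cancel_of_le hc).symm
  rw [← hM] at hs
  exact ((ENNReal.add_right_inj (ENNReal.sub_ne_top hfin)).1 (hs.symm.trans h2))

/-- A sequence starting at `z` along which the tail of `φ` on `(z,b)` halves at each step. -/
structure IsDyadicSeq (φ : ℝ → ℝ≥0∞) (z b : ℝ) (t : ℕ → ℝ) : Prop where
  zero : t 0 = z
  strictMono : StrictMono t
  lt : ∀ m, t m < b
  mass : ∀ m, ∫⁻ s in Ioo (t m) b, φ s = 2⁻¹ ^ m * ∫⁻ s in Ioo z b, φ s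
  exists_mem : ∀ x ∈ Ico z b, ∃ m, x ∈ Ico (t m) (t (m + 1))

theorem exists_isDyadicSeq {φ : ℝ → ℝ≥0∞} (hφ : Measurable φ) {z b : ℝ} (hzb : z < b)
    (hpos : ∀ t ∈ Ioo z b, 0 < φ t) (hfin : ∫⁻ s in Ioo z b, φ s ≠ ∞) :
    ∃ t, IsDyadicSeq φ z b t := by
  set M := ∫⁻ s in Ioo z b, φ s with hM
  have hM0 : 0 < M := lintegral_Ioo_pos hφ hzb hpos
  have hhalf : (2⁻¹ : ℝ≥0∞) < 1 := by simp
  have hle : ∀ m : ℕ, (2⁻¹ : ℝ≥0∞) ^ m * M ≤ M := fun m =>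
    mul_le_of_le_one_left zero_le (pow_le_one₀ zero_le hhalf.le)
  have hex : ∀ m : ℕ, ∃ x, z ≤ x ∧ x ≤ b ∧ (m = 0 → x = z) ∧
      ∫⁻ s in Ioo x b, φ s = (2⁻¹ : ℝ≥0∞) ^ m * M := by
    intro m
    rcases Nat.eq_zero_or_pos m with rfl | hm
    · exact ⟨z, le_rfl, hzb.le, fun _ => rfl, by simp [hM]⟩
    · obtain ⟨x, hx, hxe⟩ := exists_lintegral_Ioo_eq hφ hzb.le hfin (hle m)
      exact ⟨x, hx.1, hx.2, fun h => absurd h hm.ne', hxe⟩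
  choose t h1 h2 h3 h4 using hex
  have hlt : ∀ x y, ∫⁻ s in Ioo x b, φ s < ∫⁻ s in Ioo y b, φ s → y < x := fun x y h => by
    by_contra! hxy
    exact absurd (antitone_lintegral_Ioo_left φ b hxy) h.not_ge
  have hmono : StrictMono t := strictMono_nat_of_lt_succ fun m => hlt _ _ (by
    rw [h4, h4, pow_succ, mul_right_comm, mul_comm]
    have hp : (2⁻¹ : ℝ≥0∞) ^ m * M ≠ 0 := mul_ne_zero (pow_ne_zero _ (by simp)) hM0.ne'
    have ht : (2⁻¹ : ℝ≥0∞) ^ m * M ≠ ∞ := ((hle m).trans_lt hfin.lt_top).ne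
    calc 2⁻¹ * ((2⁻¹ : ℝ≥0∞) ^ m * M) < 1 * ((2⁻¹ : ℝ≥0∞) ^ m * M) :=
          (ENNReal.mul_lt_mul_iff_left hp ht).2 hhalf
      _ = _ := one_mul _)
  refine ⟨t, h3 0 rfl, hmono, fun m => (hmono (Nat.lt_succ_self m)).trans_le (h2 _), h4, ?_⟩
  intro x hx
  have hxpos : 0 < ∫⁻ s in Ioo x b, φ s :=
    lintegral_Ioo_pos hφ hx.2 fun s hs => hpos s ⟨hx.1.trans_lt hs.1, hs.2⟩
  have hN : ∃ N, x < t N := by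
    have hlim : Filter.Tendsto (fun m : ℕ => (2⁻¹ : ℝ≥0∞) ^ m * M) Filter.atTop (nhds (0 * M)) :=
      ENNReal.Tendsto.mul_const (ENNReal.tendsto_pow_atTop_nhds_zero_of_lt_one hhalf)
        (Or.inr hfin)
    rw [zero_mul] at hlim
    obtain ⟨N, hN⟩ := (hlim.eventually_lt_const hxpos).exists
    exact ⟨N, hlt _ _ (by rw [h4]; exact hN)⟩
  classical
  have hN0 : Nat.find hN ≠ 0 := by
    intro h0
    have := Nat.find_spec hN
    rw [h0, h3 0 rfl] at this
    exact absurd hx.1 this.not_ge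
  obtain ⟨m, hm⟩ := Nat.exists_eq_succ_of_ne_zero hN0
  refine ⟨m, ?_, ?_⟩
  · have := Nat.find_min hN (m := m) (by omega)
    exact not_lt.1 this
  · have := Nat.find_spec hN
    rwa [hm] at this

namespace IsDyadicSeq

variable {φ : ℝ → ℝ≥0∞} {z b : ℝ} {t : ℕ → ℝ}

theorem le (h : IsDyadicSeq φ z b t) (m : ℕ) : z ≤ t m :=
  h.zero ▸ h.strictMono.monotone (Nat.zero_le m)

theorem lt_succ (h : IsDyadicSeq φ z b t) (m : ℕ) : t m < t (m + 1) :=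
  h.strictMono (Nat.lt_succ_self m)

theorem pairwise_disjoint (h : IsDyadicSeq φ z b t) :
    Pairwise (Function.onFun Disjoint fun m => Ico (t m) (t (m + 1))) :=
  h.strictMono.monotone.pairwise_disjoint_on_Ico_succ

theorem iUnion_eq (h : IsDyadicSeq φ z b t) : ⋃ m, Ico (t m) (t (m + 1)) = Ico z b := by
  ext x
  simp only [mem_iUnion]
  constructor
  · rintro ⟨m, hm⟩
    exact ⟨(h.le m).trans hm.1, hm.2.trans (h.lt _)⟩
  · exact h.exists_mem x

theorem lintegral_eq_tsum (h : IsDyadicSeq φ z b t) (g : ℝ → ℝ≥0∞) :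
    ∫⁻ s in Ioo z b, g s = ∑' m, ∫⁻ s in Ioo (t m) (t (m + 1)), g s := by
  simp_rw [← lintegral_Ico_eq_Ioo]
  rw [← h.iUnion_eq, lintegral_iUnion (fun _ => measurableSet_Ico) h.pairwise_disjoint]

theorem mass_block (h : IsDyadicSeq φ z b t) (hfin : ∫⁻ s in Ioo z b, φ s ≠ ∞) (m : ℕ) :
    ∫⁻ s in Ioo (t m) (t (m + 1)), φ s = 2⁻¹ ^ (m + 1) * ∫⁻ s in Ioo z b, φ s := by
  have hs := lintegral_Ioo_split φ (h.lt_succ m).le (h.lt (m + 1)).le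
  rw [h.mass, h.mass] at hs
  set M := ∫⁻ s in Ioo z b, φ s
  have hq : (2⁻¹ : ℝ≥0∞) ^ (m + 1) * M ≠ ∞ :=
    ENNReal.mul_ne_top (ENNReal.pow_ne_top (by simp)) hfin
  have h2 : (2⁻¹ : ℝ≥0∞) ^ m * M = 2⁻¹ ^ (m + 1) * M + 2⁻¹ ^ (m + 1) * M := by
    rw [pow_succ, ← add_mul, ← mul_add, ENNReal.inv_two_add_inv_two, mul_one]
  rw [h2] at hs
  exact ((ENNReal.add_left_inj hq).1 hs).symm

end IsDyadicSeq

section Vr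

variable {r : ℝ} {v : ℝ → ℝ≥0∞}

theorem Vr_mono (hr0 : 0 < r) (hr1 : r ≤ 1) {x x' t t' : ℝ} (hx : x' ≤ x) (ht : t ≤ t') :
    Vr r v x t ≤ Vr r v x' t' := by
  unfold Vr
  split_ifs with h
  · exact essSup_mono_measure (Measure.restrict_mono (Ioo_subset_Ioo hx ht) le_rfl).absolutelyContinuous
  · exact ENNReal.rpow_le_rpow (lintegral_mono_set (Ioo_subset_Ioo hx ht))
      (div_nonneg (by linarith) hr0.le)

theorem Vr_eq_zero (hr0 : 0 < r) (hr1 : r ≤ 1) {x t : ℝ} (h : t ≤ x) : Vr r v x t = 0 := by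
  unfold Vr
  rw [Ioo_eq_empty h.not_gt]
  split_ifs with h1
  · simp
  · have : 0 < (1 - r) / r := div_pos (sub_pos.2 (lt_of_le_of_ne hr1 h1)) hr0
    simp [this]

theorem Vr_pos (hr0 : 0 < r) (hr1 : r ≤ 1) (hv : Measurable v) {x t : ℝ} (h : x < t)
    (hpos : ∀ s ∈ Ioo x t, 0 < v s) (hfin : ∀ s ∈ Ioo x t, v s < ∞) : 0 < Vr r v x t := by
  unfold Vr
  split_ifs with h1
  · rw [pos_iff_ne_zero]
    intro h0
    have hae := ENNReal.ae_le_essSup (μ := volume.restrict (Ioo x t)) v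
    rw [h0] at hae
    obtain ⟨y, hy, hy0⟩ := exists_mem_Ioo_of_ae hae h le_rfl
    exact absurd (hpos y hy) hy0.not_gt
  · have hr : 0 < 1 - r := sub_pos.2 (lt_of_le_of_ne hr1 h1)
    have hI : 0 < ∫⁻ s in Ioo x t, v s ^ (1 / (1 - r)) :=
      lintegral_Ioo_pos (hv.pow_const _) h fun s hs =>
        ENNReal.rpow_pos (hpos s hs) (hfin s hs).ne
    rcases eq_or_ne (∫⁻ s in Ioo x t, v s ^ (1 / (1 - r))) ∞ with htop | htop
    · rw [htop, ENNReal.top_rpow_of_pos (div_pos hr hr0)]; exact zero_lt_top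
    · exact ENNReal.rpow_pos hI htop

/-- Hölder's inequality with the sharp constant `V_r`. -/
theorem lintegral_rpow_mul_le (hr0 : 0 < r) (hr1 : r ≤ 1) (hv : Measurable v)
    {f : ℝ → ℝ≥0∞} (hf : Measurable f) (x t : ℝ) :
    ∫⁻ s in Ioo x t, f s ^ r * v s ≤ Vr r v x t ^ r * (∫⁻ s in Ioo x t, f s) ^ r := by
  unfold Vr
  split_ifs with h
  · subst h
    simp only [ENNReal.rpow_one]
    rw [← lintegral_const_mul _ hf]
    refine lintegral_mono_ae ?_
    filter_upwards [ENNReal.ae_le_essSup (μ := volume.restrict (Ioo x t)) v] with s hs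
    rw [mul_comm]
    gcongr
  · have hr : 0 < 1 - r := sub_pos.2 (lt_of_le_of_ne hr1 h)
    have hpq : (1 / r).HolderConjugate (1 / (1 - r)) := by
      rw [Real.holderConjugate_iff]
      refine ⟨?_, by simp⟩
      rw [lt_div_iff₀ hr0]; linarith
    have := ENNReal.lintegral_mul_le_Lp_mul_Lq (volume.restrict (Ioo x t)) hpq
      (f := fun s => f s ^ r) (g := v) (hf.pow_const r).aemeasurable hv.aemeasurable
    simp only [Pi.mul_apply, ← ENNReal.rpow_mul, mul_one_div_cancel hr0.ne', ENNReal.rpow_one,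
      one_div_one_div] at this
    rw [← ENNReal.rpow_mul, div_mul_cancel₀ _ hr0.ne', mul_comm]
    exact this

/-- Near-extremal functions for `V_r`. -/
theorem exists_lt_Vr (hr0 : 0 < r) (hr1 : r ≤ 1) (hv : Measurable v) {x t : ℝ} {c : ℝ≥0∞}
    (hc : c < Vr r v x t) :
    ∃ f : ℝ → ℝ≥0∞, Measurable f ∧ (∀ s, s ∉ Ioo x t → f s = 0) ∧ ∫⁻ s, f s ≤ 1 ∧
      c ^ r ≤ ∫⁻ s in Ioo x t, f s ^ r * v s := by
  unfold Vr at hc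
  split_ifs at hc with h
  · subst h
    set E := Ioo x t ∩ {s | c < v s} with hE
    have hEm : MeasurableSet E := measurableSet_Ioo.inter (measurableSet_lt measurable_const hv)
    have hE0 : volume E ≠ 0 := by
      intro h0
      refine absurd (essSup_le_of_ae_le (f := v) (μ := volume.restrict (Ioo x t)) c ?_) hc.not_ge
      change ∀ᵐ s ∂(volume.restrict (Ioo x t)), v s ≤ c
      rw [ae_restrict_iff' measurableSet_Ioo, ae_iff, ← h0]
      congr 1
      ext s
      simp [hE, and_assoc]
    have hEt : volume E ≠ ∞ :=
      ((measure_mono inter_subset_left).trans_lt (by simp [Real.volume_Ioo])).ne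
    refine ⟨E.indicator fun _ => (volume E)⁻¹, measurable_const.indicator hEm,
      fun s hs => indicator_of_notMem (fun h => hs h.1) _, ?_, ?_⟩
    · rw [lintegral_indicator hEm, setLIntegral_const, ENNReal.inv_mul_cancel hE0 hEt]
    · simp only [ENNReal.rpow_one]
      calc c = ∫⁻ s in E, (volume E)⁻¹ * c := by
            rw [setLIntegral_const, mul_right_comm, ENNReal.inv_mul_cancel hE0 hEt, one_mul]
        _ ≤ ∫⁻ s in E, E.indicator (fun _ => (volume E)⁻¹) s * v s := by
            refine setLIntegral_mono' hEm fun s hs => ?_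
            rw [indicator_of_mem hs]
            gcongr
            exact hs.2.le
        _ ≤ _ := lintegral_mono_set inter_subset_left
  · have hr : 0 < 1 - r := sub_pos.2 (lt_of_le_of_ne hr1 h)
    set m : ℕ → ℝ → ℝ≥0∞ := fun n s => min (v s) n with hm
    have hmm : ∀ n, Measurable (m n) := fun n => hv.min measurable_const
    have hmono : Monotone fun n s => m n s ^ (1 / (1 - r)) := fun i j hij s =>
      ENNReal.rpow_le_rpow (min_le_min le_rfl (by exact_mod_cast hij)) (by positivity)
    have hsup : ∀ s, ⨆ n, m n s ^ (1 / (1 - r)) = v s ^ (1 / (1 - r)) := by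
      intro s
      refine le_antisymm (iSup_le fun n => ENNReal.rpow_le_rpow (min_le_left _ _)
        (by positivity)) (le_of_forall_lt fun e he => ?_)
      have h1 : e ^ (1 - r) < v s := by
        have := ENNReal.rpow_lt_rpow he hr
        rwa [← ENNReal.rpow_mul, one_div_mul_cancel hr.ne', ENNReal.rpow_one] at this
      obtain ⟨n, hn⟩ := ENNReal.exists_nat_gt (h1.trans_le le_top).ne
      refine lt_iSup_iff.2 ⟨n, ?_⟩
      have h2 : e ^ (1 - r) < m n s := lt_min h1 hn
      have := ENNReal.rpow_lt_rpow h2 (one_div_pos.2 hr)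
      rwa [← ENNReal.rpow_mul, mul_one_div_cancel hr.ne', ENNReal.rpow_one] at this
    have hc' : c ^ (r / (1 - r)) < ∫⁻ s in Ioo x t, v s ^ (1 / (1 - r)) := by
      have := ENNReal.rpow_lt_rpow hc (div_pos hr0 hr)
      rwa [← ENNReal.rpow_mul, show (1 - r) / r * (r / (1 - r)) = 1 by field_simp,
        ENNReal.rpow_one] at this
    simp_rw [← hsup] at hc'
    rw [lintegral_iSup (fun n => (hmm n).pow_const _) hmono] at hc'
    obtain ⟨n, hn⟩ := lt_iSup_iff.1 hc'
    set I := ∫⁻ s in Ioo x t, m n s ^ (1 / (1 - r)) with hI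
    have hI0 : I ≠ 0 := (zero_le.trans_lt hn).ne'
    have hIt : I ≠ ∞ := by
      refine ((lintegral_mono (g := fun _ => (n : ℝ≥0∞) ^ (1 / (1 - r)))
        fun s => ENNReal.rpow_le_rpow (min_le_right _ _) (by positivity)).trans_lt ?_).ne
      rw [setLIntegral_const, Real.volume_Ioo]
      exact ENNReal.mul_lt_top (ENNReal.rpow_lt_top_of_nonneg (by positivity) (by simp))
        ENNReal.ofReal_lt_top
    refine ⟨(Ioo x t).indicator fun s => I⁻¹ * m n s ^ (1 / (1 - r)),
      (((hmm n).pow_const _).const_mul _).indicator measurableSet_Ioo,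
      fun s hs => indicator_of_notMem hs _, ?_, ?_⟩
    · rw [lintegral_indicator measurableSet_Ioo, lintegral_const_mul _ ((hmm n).pow_const _),
        ← hI, ENNReal.inv_mul_cancel hI0 hIt]
    · have h1 : c ^ r ≤ I ^ (1 - r) := by
        have := ENNReal.rpow_le_rpow hn.le hr.le
        rwa [← ENNReal.rpow_mul, div_mul_cancel₀ _ hr.ne'] at this
      refine h1.trans ?_
      calc I ^ (1 - r) = I⁻¹ ^ r * I := by
            rw [ENNReal.inv_rpow, ← ENNReal.rpow_neg]
            nth_rewrite 3 [← ENNReal.rpow_one I]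
            rw [← ENNReal.rpow_add _ _ hI0 hIt]
            congr 1; ring
        _ = ∫⁻ s in Ioo x t, I⁻¹ ^ r * m n s ^ (1 / (1 - r)) := by
            rw [lintegral_const_mul _ ((hmm n).pow_const _)]
        _ ≤ _ := by
            refine setLIntegral_mono' measurableSet_Ioo fun s hs => ?_
            rw [indicator_of_mem hs, ENNReal.mul_rpow_of_nonneg _ _ hr0.le, mul_assoc,
              ← ENNReal.rpow_mul]
            gcongr
            calc m n s ^ (1 / (1 - r)) = m n s ^ (1 / (1 - r) * r) * m n s := by
                  nth_rewrite 3 [← ENNReal.rpow_one (m n s)]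
                  rw [← ENNReal.rpow_add_of_nonneg _ _ (by positivity) (by norm_num)]
                  congr 1; field_simp; ring
              _ ≤ _ := by gcongr; exact min_le_left _ _

theorem exists_half_Vr_le (hr0 : 0 < r) (hr1 : r ≤ 1) (hv : Measurable v) {x t : ℝ}
    (hV : Vr r v x t ≠ ∞) :
    ∃ f : ℝ → ℝ≥0∞, Measurable f ∧ (∀ s, s ∉ Ioo x t → f s = 0) ∧ ∫⁻ s, f s ≤ 1 ∧
      (Vr r v x t / 2) ^ r ≤ ∫⁻ s in Ioo x t, f s ^ r * v s := by
  rcases eq_or_ne (Vr r v x t) 0 with h0 | h0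
  · exact ⟨fun _ => 0, measurable_const, fun _ _ => rfl, by simp, by simp [h0, hr0]⟩
  · exact exists_lt_Vr hr0 hr1 hv (ENNReal.half_lt_self h0 hV)

/-- `V_r` is dominated by its values on inner intervals. -/
theorem Vr_le_of_forall_inner (hr0 : 0 < r) (hr1 : r ≤ 1) (hv : Measurable v) {x t : ℝ}
    (hxt : x < t) {c : ℝ≥0∞}
    (h : ∀ x' t', x < x' → t' < t → x' < t' → Vr r v x' t' ≤ c) : Vr r v x t ≤ c := by
  refine le_of_forall_lt fun e he => ?_
  obtain ⟨e', he', he''⟩ := exists_between he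
  obtain ⟨f, hf, -, hf1, hfe⟩ := exists_lt_Vr hr0 hr1 hv he''
  have hle : ∫⁻ s in Ioo x t, f s ^ r * v s ≤ c ^ r := by
    refine lintegral_Ioo_le_of_forall_left hxt fun x' hx' => ?_
    refine lintegral_Ioo_le_of_forall_right hx'.2 fun t' ht' => ?_
    refine (lintegral_rpow_mul_le hr0 hr1 hv hf x' t').trans ?_
    calc _ ≤ c ^ r * 1 ^ r := by
          gcongr
          · exact h x' t' hx'.1 ht'.2 ht'.1
          · exact (setLIntegral_le_lintegral _ _).trans hf1
      _ = c ^ r := by simp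
  exact he'.trans_le ((ENNReal.rpow_le_rpow_iff hr0).1 (hfe.trans hle))

/-- Some power of `V_r` is subadditive with respect to concatenation of intervals. -/
theorem exists_Vr_rpow_le_add (hr0 : 0 < r) (hr1 : r ≤ 1) :
    ∃ ϱ : ℝ, 0 < ϱ ∧ ∀ v : ℝ → ℝ≥0∞, ∀ x y z : ℝ, x ≤ y → y ≤ z →
      Vr r v x z ^ ϱ ≤ Vr r v x y ^ ϱ + Vr r v y z ^ ϱ := by
  rcases eq_or_ne r 1 with rfl | h
  · refine ⟨1, one_pos, fun v x y z hxy hyz => ?_⟩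
    simp only [Vr, if_true, ENNReal.rpow_one]
    refine essSup_le_of_ae_le _ ?_
    change ∀ᵐ s ∂(volume.restrict (Ioo x z)), v s ≤ _
    rw [Measure.restrict_congr_set (Ioo_ae_eq_Ico (a := x) (b := z)),
      ← Ico_union_Ico_eq_Ico hxy hyz, ae_restrict_union_iff,
      ← Measure.restrict_congr_set (Ioo_ae_eq_Ico (a := x) (b := y)),
      ← Measure.restrict_congr_set (Ioo_ae_eq_Ico (a := y) (b := z))]
    refine ⟨?_, ?_⟩
    · filter_upwards [ENNReal.ae_le_essSup (μ := volume.restrict (Ioo x y)) v] with s hs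
      exact hs.trans le_self_add
    · filter_upwards [ENNReal.ae_le_essSup (μ := volume.restrict (Ioo y z)) v] with s hs
      exact hs.trans le_add_self
  · have hr : 0 < 1 - r := sub_pos.2 (lt_of_le_of_ne hr1 h)
    refine ⟨r / (1 - r), div_pos hr0 hr, fun v x y z hxy hyz => ?_⟩
    simp only [Vr, if_neg h, ← ENNReal.rpow_mul, show (1 - r) / r * (r / (1 - r)) = 1 by field_simp,
      ENNReal.rpow_one]
    exact (lintegral_Ioo_split _ hxy hyz).le

end Vr

theorem ennreal_pow_rpow (x : ℝ≥0∞) (m : ℕ) (y : ℝ) : (x ^ m) ^ y = (x ^ y) ^ m := by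
  rw [← ENNReal.rpow_natCast, ← ENNReal.rpow_mul, mul_comm, ENNReal.rpow_mul,
    ENNReal.rpow_natCast]

theorem mul_half_pow_succ (m : ℕ) (M : ℝ≥0∞) : 2⁻¹ ^ m * M = 2 * (2⁻¹ ^ (m + 1) * M) := by
  rw [pow_succ, mul_comm (2⁻¹ ^ m) (2⁻¹ : ℝ≥0∞), mul_assoc, ← mul_assoc 2 2⁻¹,
    ENNReal.mul_inv_cancel (by simp) (by simp), one_mul]

/-- The upper Hardy-type bound, with `q < P`. -/
theorem exists_lintegral_hardy_le {q P r : ℝ} (hq : 0 < q) (hqP : q < P) (hr : 0 < r) :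
    ∃ κ : ℝ≥0∞, κ < ∞ ∧ ∀ (z b : ℝ), z < b → ∀ u : ℝ → ℝ≥0∞, Measurable u →
      (∀ t ∈ Ioo z b, 0 < u t) → ∫⁻ s in Ioo z b, u s ≠ ∞ →
      ∀ (Φ H : ℝ → ℝ≥0∞) (ν : Measure ℝ), Monotone Φ → Monotone H → Φ z = 0 →
      (∀ s t, z ≤ s → s ≤ t → t < b → Φ t ≤ Φ s + (H t * ν (Ioc s t) ^ (1 / P)) ^ r) →
      ∫⁻ t in Ioo z b, Φ t ^ (q / r) * u t ≤
        κ * (∫⁻ t in Ioo z b, (∫⁻ s in Ioo t b, u s) ^ (q / (P - q)) * u t *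
          H t ^ (P * q / (P - q))) ^ ((P - q) / P) * ν univ ^ (q / P) := by
  obtain ⟨κ, hκ, hgeo⟩ := exists_tsum_geometric_mul_rpow_sum_le (s := q / r) (div_pos hq hr)
    (ρ := 2⁻¹) (by simp) (by simp)
  have hP : 0 < P := hq.trans hqP
  have hPq : 0 < P - q := sub_pos.2 hqP
  set τ : ℝ := P / (P - q) with hτ
  have hτ0 : 0 < τ := div_pos hP hPq
  have hτe : q / (P - q) + 1 = τ := by rw [hτ]; field_simp; ring
  have h4 : ((4 : ℝ≥0∞) ^ τ) ^ ((P - q) / P) < ∞ :=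
    ENNReal.rpow_lt_top_of_nonneg (by positivity)
      (ENNReal.rpow_lt_top_of_nonneg hτ0.le (by norm_num)).ne
  refine ⟨κ * ((4 : ℝ≥0∞) ^ τ) ^ ((P - q) / P), ENNReal.mul_lt_top hκ h4, ?_⟩
  intro z b hzb u hu hupos hufin Φ H ν hΦ hH hΦz hinc
  obtain ⟨t, ht⟩ := exists_isDyadicSeq hu hzb hupos hufin
  set M := ∫⁻ s in Ioo z b, u s with hM
  set d : ℕ → ℝ≥0∞ := fun j => (H (t (j + 1)) * ν (Ioc (t j) (t (j + 1))) ^ (1 / P)) ^ r with hd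
  have hsum : ∀ i, Φ (t i) ≤ ∑ j ∈ Finset.range i, d j := by
    intro i
    induction i with
    | zero => simp [ht.zero, hΦz]
    | succ i ih =>
      rw [Finset.sum_range_succ]
      exact (hinc _ _ (ht.le i) (ht.lt_succ i).le (ht.lt _)).trans (by gcongr)
  have hblock : ∀ i, ∫⁻ s in Ioo (t i) (t (i + 1)), Φ s ^ (q / r) * u s ≤
      2⁻¹ ^ i * (∑ j ∈ Finset.range (i + 1), d j) ^ (q / r) * M := by
    intro i
    calc _ ≤ ∫⁻ s in Ioo (t i) (t (i + 1)), Φ (t (i + 1)) ^ (q / r) * u s := by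
          refine setLIntegral_mono' measurableSet_Ioo fun s hs => ?_
          gcongr
          exact hΦ hs.2.le
      _ = Φ (t (i + 1)) ^ (q / r) * (2⁻¹ ^ (i + 1) * M) := by
          rw [lintegral_const_mul _ hu, ht.mass_block hufin]
      _ ≤ (∑ j ∈ Finset.range (i + 1), d j) ^ (q / r) * (2⁻¹ ^ i * M) := by
          gcongr ?_ ^ _ * (?_ * _)
          · exact hsum _
          · exact pow_le_pow_of_le_one zero_le (by simp) (Nat.le_succ i)
      _ = _ := by ring
  set X : ℕ → ℝ≥0∞ := fun j => (2⁻¹ ^ j * M) ^ τ * H (t (j + 1)) ^ (P * q / (P - q)) with hX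
  have hXle : ∀ j, X j ≤ 4 ^ τ * ∫⁻ s in Ioo (t (j + 1)) (t (j + 1 + 1)),
      (∫⁻ σ in Ioo s b, u σ) ^ (q / (P - q)) * u s * H s ^ (P * q / (P - q)) := by
    intro j
    have h2 : 2⁻¹ ^ j * M = 4 * (2⁻¹ ^ (j + 1 + 1) * M) := by
      rw [mul_half_pow_succ, mul_half_pow_succ (j + 1), ← mul_assoc]; norm_num
    set c := 2⁻¹ ^ (j + 1 + 1) * M with hc
    calc X j = 4 ^ τ * (c ^ (q / (P - q)) * c * H (t (j + 1)) ^ (P * q / (P - q))) := by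
          rw [hX]; dsimp only
          rw [h2, ENNReal.mul_rpow_of_nonneg _ _ hτ0.le, ← hτe,
            ENNReal.rpow_add_of_nonneg (x := c) _ _ (by positivity) zero_le_one, ENNReal.rpow_one]
          ring
      _ = 4 ^ τ * ∫⁻ s in Ioo (t (j + 1)) (t (j + 1 + 1)),
          c ^ (q / (P - q)) * u s * H (t (j + 1)) ^ (P * q / (P - q)) := by
          rw [lintegral_mul_const _ (hu.const_mul _), lintegral_const_mul _ hu,
            ht.mass_block hufin]
      _ ≤ _ := by
          gcongr 4 ^ τ * ?_
          refine setLIntegral_mono' measurableSet_Ioo fun s hs => ?_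
          have h5 : 0 < P * q / (P - q) := by positivity
          gcongr ?_ ^ _ * _ * ?_ ^ _
          · rw [← ht.mass]
            exact antitone_lintegral_Ioo_left u b hs.2.le
          · exact hH hs.1.le
  have hexp : (P - q) / P + q / P = 1 := by field_simp; ring
  calc _ = ∑' i, ∫⁻ s in Ioo (t i) (t (i + 1)), Φ s ^ (q / r) * u s := ht.lintegral_eq_tsum _
    _ ≤ ∑' i, 2⁻¹ ^ i * (∑ j ∈ Finset.range (i + 1), d j) ^ (q / r) * M :=
        ENNReal.tsum_le_tsum hblock
    _ ≤ κ * (∑' i, 2⁻¹ ^ i * d i ^ (q / r)) * M := by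
        rw [ENNReal.tsum_mul_right]
        gcongr
        exact hgeo d
    _ = κ * ∑' i, X i ^ ((P - q) / P) * ν (Ioc (t i) (t (i + 1))) ^ (q / P) := by
        rw [mul_assoc, ← ENNReal.tsum_mul_right]
        congr 1
        refine tsum_congr fun i => ?_
        simp only [hd, hX]
        rw [← ENNReal.rpow_mul, mul_div_cancel₀ _ hr.ne', ENNReal.mul_rpow_of_nonneg _ _ hq.le,
          ENNReal.mul_rpow_of_nonneg _ _ (div_pos hPq hP).le, ← ENNReal.rpow_mul,
          ← ENNReal.rpow_mul, ← ENNReal.rpow_mul,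
          show τ * ((P - q) / P) = 1 by rw [hτ]; field_simp,
          show P * q / (P - q) * ((P - q) / P) = q by field_simp,
          show 1 / P * q = q / P by ring, ENNReal.rpow_one]
        ring
    _ ≤ κ * ((∑' i, X i) ^ ((P - q) / P) * (∑' i, ν (Ioc (t i) (t (i + 1)))) ^ (q / P)) := by
        gcongr
        exact tsum_mul_le_rpow_mul_rpow (div_pos hPq hP) (div_pos hq hP) hexp _ _
    _ ≤ κ * ((4 ^ τ * ∫⁻ t in Ioo z b, (∫⁻ s in Ioo t b, u s) ^ (q / (P - q)) * u t *
          H t ^ (P * q / (P - q))) ^ ((P - q) / P) * ν univ ^ (q / P)) := by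
        have h6 : 0 < (P - q) / P := by positivity
        gcongr _ * (?_ ^ _ * ?_ ^ _)
        · rw [ht.lintegral_eq_tsum, ← ENNReal.tsum_mul_left]
          exact (ENNReal.tsum_le_tsum hXle).trans
            (ENNReal.tsum_comp_le_tsum_of_injective (add_left_injective 1)
              fun j => 4 ^ τ * ∫⁻ s in Ioo (t j) (t (j + 1)), _)
        · have hdisj : Pairwise (Function.onFun Disjoint fun i => Ioc (t i) (t (i + 1))) :=
            ht.strictMono.monotone.pairwise_disjoint_on_Ioc_succ
          rw [← measure_iUnion hdisj fun i => measurableSet_Ioc]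
          exact measure_mono (subset_univ _)
    _ = _ := by
        rw [ENNReal.mul_rpow_of_nonneg _ _ (div_pos hPq hP).le]
        ring

/-- The lower Hardy-type bound along a dyadic sequence, with `q < P`. -/
theorem exists_lintegral_le_of_dyadic {q P ϱ : ℝ} (hq : 0 < q) (hqP : q < P) (hϱ : 0 < ϱ) :
    ∃ κ : ℝ≥0∞, κ < ∞ ∧ ∀ (z b : ℝ) (u : ℝ → ℝ≥0∞), Measurable u →
      ∫⁻ s in Ioo z b, u s ≠ ∞ → ∀ t : ℕ → ℝ, IsDyadicSeq u z b t →
      ∀ (H : ℝ → ℝ≥0∞) (h : ℕ → ℝ≥0∞),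
      (∀ m, ∀ s ∈ Ioo (t m) (t (m + 1)), H s ^ ϱ ≤ ∑ j ∈ Finset.range (m + 2), h j ^ ϱ) →
      ∀ K : ℝ≥0∞, (∀ γ : ℕ → ℝ≥0∞, ∑' m, γ m ^ P ≤ 1 →
        ∑' m, (2⁻¹ ^ m * ∫⁻ s in Ioo z b, u s) * h m ^ q * γ m ^ q ≤ K) →
      ∫⁻ s in Ioo z b, (∫⁻ σ in Ioo s b, u σ) ^ (q / (P - q)) * u s *
        H s ^ (P * q / (P - q)) ≤ κ * K ^ (P / (P - q)) := by
  have hP : 0 < P := hq.trans hqP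
  have hPq : 0 < P - q := sub_pos.2 hqP
  set τ : ℝ := P / (P - q) with hτ
  have hτ0 : 0 < τ := div_pos hP hPq
  have hτe : q / (P - q) + 1 = τ := by rw [hτ]; field_simp; ring
  set σ : ℝ := P * q / (P - q) / ϱ with hσ
  have hσ0 : 0 < σ := by positivity
  set ρ : ℝ≥0∞ := 2⁻¹ ^ τ with hρ
  have hρ0 : ρ ≠ 0 := (ENNReal.rpow_pos (by simp) (by simp)).ne'
  have hρ1 : ρ < 1 := ENNReal.rpow_lt_one (by simp) hτ0
  obtain ⟨κ, hκ, hgeo⟩ := exists_tsum_geometric_mul_rpow_sum_le hσ0 hρ0 hρ1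
  refine ⟨ρ⁻¹ * κ, ENNReal.mul_lt_top (ENNReal.inv_lt_top.2 (pos_iff_ne_zero.2 hρ0)) hκ, ?_⟩
  intro z b u hu hufin t ht H h hH K hK
  set M := ∫⁻ s in Ioo z b, u s with hM
  have hblock : ∀ m, ∫⁻ s in Ioo (t m) (t (m + 1)), (∫⁻ σ in Ioo s b, u σ) ^ (q / (P - q)) *
      u s * H s ^ (P * q / (P - q)) ≤
      ρ⁻¹ * (ρ ^ (m + 1) * (∑ j ∈ Finset.range (m + 1 + 1), h j ^ ϱ) ^ σ) * M ^ τ := by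
    intro m
    set c := 2⁻¹ ^ m * M with hc
    set S := ∑ j ∈ Finset.range (m + 2), h j ^ ϱ with hS
    calc _ ≤ ∫⁻ s in Ioo (t m) (t (m + 1)), c ^ (q / (P - q)) * u s * S ^ σ := by
          refine setLIntegral_mono' measurableSet_Ioo fun s hs => ?_
          gcongr
          · rw [hc, ← ht.mass]
            exact antitone_lintegral_Ioo_left u b hs.1.le
          · rw [show P * q / (P - q) = ϱ * σ by rw [hσ]; field_simp, ENNReal.rpow_mul]
            gcongr
            exact hH m s hs
      _ = c ^ (q / (P - q)) * (2⁻¹ ^ (m + 1) * M) * S ^ σ := by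
          rw [lintegral_mul_const _ (hu.const_mul _), lintegral_const_mul _ hu,
            ht.mass_block hufin]
      _ ≤ c ^ (q / (P - q)) * c * S ^ σ := by
          gcongr
          rw [hc]
          gcongr ?_ * _
          exact pow_le_pow_of_le_one zero_le (by simp) (Nat.le_succ m)
      _ = ρ ^ m * M ^ τ * S ^ σ := by
          conv_lhs => enter [1, 2]; rw [← ENNReal.rpow_one c]
          rw [← ENNReal.rpow_add_of_nonneg _ _ (by positivity) zero_le_one, hτe, hc,
            ENNReal.mul_rpow_of_nonneg _ _ hτ0.le, ennreal_pow_rpow]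
      _ = ρ⁻¹ * ρ * ρ ^ m * M ^ τ * S ^ σ := by
          rw [ENNReal.inv_mul_cancel hρ0 (hρ1.trans one_lt_top).ne, one_mul]
      _ = _ := by rw [pow_succ]; ring
  calc _ = ∑' m, ∫⁻ s in Ioo (t m) (t (m + 1)), (∫⁻ σ in Ioo s b, u σ) ^ (q / (P - q)) *
      u s * H s ^ (P * q / (P - q)) := ht.lintegral_eq_tsum _
    _ ≤ ∑' m, ρ⁻¹ * (ρ ^ (m + 1) * (∑ j ∈ Finset.range (m + 1 + 1), h j ^ ϱ) ^ σ) * M ^ τ :=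
        ENNReal.tsum_le_tsum hblock
    _ ≤ ρ⁻¹ * (∑' i, ρ ^ i * (∑ j ∈ Finset.range (i + 1), h j ^ ϱ) ^ σ) * M ^ τ := by
        rw [ENNReal.tsum_mul_right, ENNReal.tsum_mul_left]
        gcongr ρ⁻¹ * ?_ * _
        exact ENNReal.tsum_comp_le_tsum_of_injective (add_left_injective 1)
          fun i => ρ ^ i * (∑ j ∈ Finset.range (i + 1), h j ^ ϱ) ^ σ
    _ ≤ ρ⁻¹ * (κ * ∑' i, ρ ^ i * (h i ^ ϱ) ^ σ) * M ^ τ := by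
        gcongr
        exact hgeo fun j => h j ^ ϱ
    _ = ρ⁻¹ * κ * ∑' i, ((2⁻¹ ^ i * M) * h i ^ q) ^ τ := by
        rw [mul_assoc, mul_assoc, mul_assoc, ← ENNReal.tsum_mul_right]
        congr 3
        refine funext fun i => ?_
        rw [ENNReal.mul_rpow_of_nonneg _ _ hτ0.le, ENNReal.mul_rpow_of_nonneg _ _ hτ0.le,
          ennreal_pow_rpow, ← ENNReal.rpow_mul, ← ENNReal.rpow_mul,
          show ϱ * σ = q * τ by rw [hσ, hτ]; field_simp]
        ring
    _ ≤ _ := by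
        gcongr
        exact tsum_rpow_le_of_forall_tsum_rpow_le_one hq hqP _ K hK

theorem Vr_mul_le_C₁ {a b p q r : ℝ} (hr0 : 0 < r) (hr1 : r ≤ 1) (hp : 0 < p) (hq : 0 < q)
    {u v w : ℝ → ℝ≥0∞} (hu : IsWeight a b u) (hv : IsWeight a b v)
    (hW : ∀ x ∈ Ioo a b, 0 < (∫⁻ t in Ioo x b, w t) ∧ (∫⁻ t in Ioo x b, w t) < ∞)
    {x t : ℝ} (hax : a < x) (hxt : x < t) (htb : t < b) :
    Vr r v x t * (∫⁻ s in Ioo t b, u s) ^ (1 / q) ≤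
      C₁ a b r p q u v w * (∫⁻ s in Ioo x b, w s) ^ (1 / p) := by
  set K := (∫⁻ s in Ioo t b, u s) ^ (1 / q) with hK
  set D := C₁ a b r p q u v w * (∫⁻ s in Ioo x b, w s) ^ (1 / p) with hD
  rcases eq_or_ne D ∞ with hDt | hDt
  · rw [hDt]; exact le_top
  have hU0 : 0 < ∫⁻ s in Ioo t b, u s := lintegral_Ioo_pos hu.1 htb fun s hs =>
    (hu.2 s ⟨hax.trans (hxt.trans hs.1), hs.2⟩).1
  have hK0 : K ≠ 0 := by
    rw [hK, Ne, ENNReal.rpow_eq_zero_iff]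
    rintro (h | h)
    · exact hU0.ne' h.1
    · exact absurd h.2 (not_lt.2 (by positivity))
  rw [← ENNReal.le_div_iff_mul_le (Or.inl hK0) (Or.inr hDt)]
  refine Vr_le_of_forall_inner hr0 hr1 hv.1 hxt fun x' t' hx' ht' hxt' => ?_
  rw [ENNReal.le_div_iff_mul_le (Or.inl hK0) (Or.inr hDt)]
  have hae := ENNReal.ae_le_essSup (μ := volume.restrict (Ioo a b))
    (fun x => (∫⁻ t in Set.Ioo x b, w t) ^ (-(1 / p)) *
      essSup (fun t => (∫⁻ s in Set.Ioo t b, u s) ^ (1 / q) * Vr r v x t)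
        (volume.restrict (Set.Ioo x b)))
  obtain ⟨x₁, hx₁, hx₁C⟩ := exists_mem_Ioo_of_ae
    (ae_restrict_of_ae_restrict_of_subset (Ioo_subset_Ioo_left hax.le) hae) hx'
    (hxt'.trans (ht'.trans htb)).le
  have hx₁b : x₁ < b := hx₁.2.trans (hxt'.trans (ht'.trans htb))
  obtain ⟨t₁, ht₁, ht₁C⟩ := exists_mem_Ioo_of_ae (ae_restrict_of_ae_restrict_of_subset
    (Ioo_subset_Ioo_left (hx₁.2.trans hxt').le) (ENNReal.ae_le_essSup
      (μ := volume.restrict (Ioo x₁ b))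
      (fun t => (∫⁻ s in Set.Ioo t b, u s) ^ (1 / q) * Vr r v x₁ t))) ht' htb.le
  have hWx := hW x₁ ⟨hax.trans hx₁.1, hx₁b⟩
  calc Vr r v x' t' * K ≤ (∫⁻ s in Ioo t₁ b, u s) ^ (1 / q) * Vr r v x₁ t₁ := by
        rw [mul_comm]
        gcongr
        · rw [hK]
          gcongr
          exact ht₁.2.le
        · exact Vr_mono hr0 hr1 hx₁.2.le ht₁.1.le
    _ ≤ _ := ht₁C
    _ = (∫⁻ t in Ioo x₁ b, w t) ^ (1 / p) * ((∫⁻ t in Ioo x₁ b, w t) ^ (-(1 / p)) *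
          essSup (fun t => (∫⁻ s in Set.Ioo t b, u s) ^ (1 / q) * Vr r v x₁ t)
            (volume.restrict (Set.Ioo x₁ b))) := by
        rw [← mul_assoc, ← ENNReal.rpow_add _ _ hWx.1.ne' hWx.2.ne, add_neg_cancel,
          ENNReal.rpow_zero, one_mul]
    _ ≤ (∫⁻ s in Ioo x b, w s) ^ (1 / p) * C₁ a b r p q u v w := by
        gcongr
        · exact hx₁.1.le
        · exact hx₁C
    _ = D := mul_comm _ _

theorem lintegral_Ioo_ne_top_of_Vr_mul_le {a b p q r : ℝ} (hr0 : 0 < r) (hr1 : r ≤ 1)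
    (hp : 0 < p) (hq : 0 < q) {u v w : ℝ → ℝ≥0∞} (hv : IsWeight a b v)
    (hW : ∀ x ∈ Ioo a b, 0 < (∫⁻ t in Ioo x b, w t) ∧ (∫⁻ t in Ioo x b, w t) < ∞)
    {C : ℝ≥0∞} (hC : C ≠ ∞)
    (h : ∀ x t, a < x → x < t → t < b → Vr r v x t * (∫⁻ s in Ioo t b, u s) ^ (1 / q) ≤
      C * (∫⁻ s in Ioo x b, w s) ^ (1 / p)) {t : ℝ} (ht : t ∈ Ioo a b) :
    ∫⁻ s in Ioo t b, u s ≠ ∞ := by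
  intro htop
  obtain ⟨x, hax, hxt⟩ := exists_between ht.1
  have hV : 0 < Vr r v x t := Vr_pos hr0 hr1 hv.1 hxt
    (fun s hs => (hv.2 s ⟨hax.trans hs.1, hs.2.trans ht.2⟩).1)
    (fun s hs => (hv.2 s ⟨hax.trans hs.1, hs.2.trans ht.2⟩).2)
  have h1 := h x t hax hxt ht.2
  rw [htop, ENNReal.top_rpow_of_pos (by positivity), ENNReal.mul_top hV.ne', top_le_iff] at h1
  exact ENNReal.mul_ne_top hC (ENNReal.rpow_lt_top_of_nonneg (by positivity)
    (hW x ⟨hax, hxt.trans ht.2⟩).2.ne).ne h1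

theorem exists_lintegral_local_le {q r : ℝ} (hq : 0 < q) (hq1 : q < 1) (hr0 : 0 < r)
    (hr1 : r ≤ 1) :
    ∃ κ : ℝ≥0∞, κ < ∞ ∧ ∀ (y x : ℝ), y < x → ∀ u v f : ℝ → ℝ≥0∞, Measurable u → Measurable v →
      Measurable f → (∀ t ∈ Ioo y x, 0 < u t) → ∫⁻ s in Ioo y x, u s ≠ ∞ →
      ∫⁻ t in Ioo y x, (∫⁻ s in Ioo y t, f s ^ r * v s) ^ (q / r) * u t ≤
        κ * (∫⁻ t in Ioo y x, (∫⁻ s in Ioo t x, u s) ^ (q / (1 - q)) * u t *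
          Vr r v y t ^ (q / (1 - q))) ^ (1 - q) * (∫⁻ s in Ioo y x, f s) ^ q := by
  obtain ⟨κ, hκ, hH⟩ := exists_lintegral_hardy_le hq hq1 hr0
  refine ⟨κ, hκ, fun y x hyx u v f hu hv hf hupos hufin => ?_⟩
  have h := hH y x hyx u hu hupos hufin (fun t => ∫⁻ s in Ioo y t, f s ^ r * v s)
    (fun t => Vr r v y t) ((volume.restrict (Ioo y x)).withDensity f)
    (monotone_lintegral_Ioo_right _ y) (fun s t hst => Vr_mono hr0 hr1 le_rfl hst) (by simp) ?_
  · simpa [one_mul, div_one, withDensity_apply] using h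
  · intro s t hs hst htx
    have hss : Ioc s t ⊆ Ioo y x := fun σ hσ => ⟨hs.trans_lt hσ.1, hσ.2.trans_lt htx⟩
    have hν : (volume.restrict (Ioo y x)).withDensity f (Ioc s t) = ∫⁻ σ in Ioo s t, f σ := by
      rw [withDensity_apply _ measurableSet_Ioc, Measure.restrict_restrict measurableSet_Ioc,
        inter_eq_left.2 hss,
        setLIntegral_congr Ioo_ae_eq_Ioc]
    simp only [hν, div_one, ENNReal.rpow_one]
    rw [lintegral_Ioo_split _ hs hst, ENNReal.mul_rpow_of_nonneg _ _ hr0.le]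
    gcongr
    refine (lintegral_rpow_mul_le hr0 hr1 hv hf s t).trans ?_
    gcongr
    exact Vr_mono hr0 hr1 hs le_rfl

theorem tsum_mass_mul_rpow_le {a b z p : ℝ} (hp : 0 < p) (hz : z ∈ Ioo a b) {w f : ℝ → ℝ≥0∞}
    (hw : Measurable w) (hfin : ∫⁻ s in Ioo z b, w s ≠ ∞) {x : ℕ → ℝ}
    (hx : IsDyadicSeq w z b x) :
    ∑' k, (2⁻¹ ^ k * ∫⁻ s in Ioo z b, w s) * (∫⁻ s in Ioo (x k) (x (k + 1)), f s) ^ p ≤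
      4 * ∫⁻ t in Ioo a b, (∫⁻ s in Ioo a t, f s) ^ p * w t := by
  calc _ ≤ ∑' k, 4 * ∫⁻ t in Ioo (x (k + 1)) (x (k + 1 + 1)), (∫⁻ s in Ioo a t, f s) ^ p * w t := by
        refine ENNReal.tsum_le_tsum fun k => ?_
        rw [mul_half_pow_succ, mul_half_pow_succ (k + 1), ← hx.mass_block hfin, ← mul_assoc,
          show (2 : ℝ≥0∞) * 2 = 4 by norm_num, mul_assoc, mul_comm (lintegral _ _),
          ← lintegral_const_mul _ hw]
        gcongr 4 * ?_
        refine setLIntegral_mono' measurableSet_Ioo fun t ht => ?_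
        gcongr ?_ ^ _ * _
        exact lintegral_mono_set (Ioo_subset_Ioo (hz.1.le.trans (hx.le k)) ht.1.le)
    _ ≤ 4 * ∑' k, ∫⁻ t in Ioo (x k) (x (k + 1)), (∫⁻ s in Ioo a t, f s) ^ p * w t := by
        rw [ENNReal.tsum_mul_left]
        gcongr 4 * ?_
        exact ENNReal.tsum_comp_le_tsum_of_injective (add_left_injective 1)
          fun k => ∫⁻ t in Ioo (x k) (x (k + 1)), (∫⁻ s in Ioo a t, f s) ^ p * w t
    _ ≤ _ := by
        rw [← hx.lintegral_eq_tsum]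
        gcongr 4 * ?_
        exact lintegral_mono_set (Ioo_subset_Ioo_left hz.1.le)

theorem C₅_rpow {a b p q r : ℝ} (hq : 0 < q) (hqp : q < p) (u v w : ℝ → ℝ≥0∞) :
    C₅ a b r p q u v w ^ (p * q / (p - q)) = ∫⁻ x in Set.Ioo a b, w x *
      ⨆ y ∈ Set.Ioo a x, (∫⁻ s in Set.Ioo y b, w s) ^ (-(p / (p - q))) *
        (∫⁻ t in Set.Ioo y x,
            (∫⁻ s in Set.Ioo t x, u s) ^ (q / (1 - q)) * u t * Vr r v y t ^ (q / (1 - q))) ^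
          (p * (1 - q) / (p - q)) := by
  have hp := hq.trans hqp
  have := sub_pos.2 hqp
  rw [C₅, ← ENNReal.rpow_mul, show (p - q) / (p * q) * (p * q / (p - q)) = 1 by field_simp,
    ENNReal.rpow_one]

theorem C₆_rpow {a b p q r : ℝ} (hq : 0 < q) (hqp : q < p) (u v w : ℝ → ℝ≥0∞) :
    C₆ a b r p q u v w ^ (p * q / (p - q)) = ∫⁻ x in Set.Ioo a b, w x *
      essSup (fun y => (∫⁻ s in Set.Ioo y b, w s)⁻¹ *
          (∫⁻ t in Set.Ioo y x, (∫⁻ s in Set.Ioo t b, u s) ^ (q / (p - q)) * u t *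
              (∫⁻ s in Set.Ioo a y, (∫⁻ σ in Set.Ioo s b, w σ) ^ (-(p / (p - r))) * w s *
                  Vr r v s y ^ (p * r / (p - r))) ^ ((p - r) * q / ((p - q) * r))))
        (volume.restrict (Set.Ioo a x)) := by
  have hp := hq.trans hqp
  have := sub_pos.2 hqp
  rw [C₆, ← ENNReal.rpow_mul, show (p - q) / (p * q) * (p * q / (p - q)) = 1 by field_simp,
    ENNReal.rpow_one]

/-- A sum over blocks is dominated by an integral with weight `w` one block later. -/
theorem tsum_mass_mul_le_of_forall_mem {a b z : ℝ} (hz : z ∈ Ioo a b) {w : ℝ → ℝ≥0∞}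
    (hw : Measurable w) (hfin : ∫⁻ s in Ioo z b, w s ≠ ∞) {x : ℕ → ℝ}
    (hx : IsDyadicSeq w z b x) (J : ℝ → ℝ≥0∞) (c : ℕ → ℝ≥0∞)
    (h : ∀ k, ∀ t ∈ Ioo (x (k + 1)) (x (k + 1 + 1)), c k ≤ J t) :
    ∑' k, (2⁻¹ ^ k * ∫⁻ s in Ioo z b, w s) * c k ≤ 4 * ∫⁻ t in Ioo a b, w t * J t := by
  calc _ ≤ ∑' k, 4 * ∫⁻ t in Ioo (x (k + 1)) (x (k + 1 + 1)), w t * J t := by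
        refine ENNReal.tsum_le_tsum fun k => ?_
        rw [mul_half_pow_succ, mul_half_pow_succ (k + 1), ← hx.mass_block hfin, ← mul_assoc,
          show (2 : ℝ≥0∞) * 2 = 4 by norm_num, mul_assoc, ← lintegral_mul_const _ hw]
        gcongr 4 * ?_
        refine setLIntegral_mono' measurableSet_Ioo fun t ht => ?_
        gcongr
        exact h k t ht
    _ ≤ 4 * ∑' k, ∫⁻ t in Ioo (x k) (x (k + 1)), w t * J t := by
        rw [ENNReal.tsum_mul_left]
        gcongr 4 * ?_
        exact ENNReal.tsum_comp_le_tsum_of_injective (add_left_injective 1)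
          fun k => ∫⁻ t in Ioo (x k) (x (k + 1)), w t * J t
    _ ≤ _ := by
        rw [← hx.lintegral_eq_tsum]
        gcongr 4 * ?_
        exact lintegral_mono_set (Ioo_subset_Ioo_left hz.1.le)

theorem exists_tsum_local_le {p q r : ℝ} (hq : 0 < q) (hqp : q < p) (hq1 : q < 1) (hr0 : 0 < r)
    (hr1 : r ≤ 1) :
    ∃ κ : ℝ≥0∞, κ < ∞ ∧ ∀ (a b z : ℝ), z ∈ Ioo a b → ∀ u v w f : ℝ → ℝ≥0∞,
      IsWeight a b u → IsWeight a b v → IsWeight a b w → Measurable f →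
      0 < ∫⁻ t in Ioo z b, w t → ∫⁻ t in Ioo z b, w t ≠ ∞ →
      ∫⁻ t in Ioo z b, u t ≠ ∞ → ∀ x, IsDyadicSeq w z b x →
      ∑' k, ∫⁻ t in Ioo (x k) (x (k + 1)), (∫⁻ s in Ioo (x k) t, f s ^ r * v s) ^ (q / r) * u t ≤
        κ * C₅ a b r p q u v w ^ q *
          (∫⁻ t in Ioo a b, (∫⁻ s in Ioo a t, f s) ^ p * w t) ^ (q / p) := by
  obtain ⟨κ, hκ, hloc⟩ := exists_lintegral_local_le hq hq1 hr0 hr1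
  have hp := hq.trans hqp
  have hpq := sub_pos.2 hqp
  have h1q := sub_pos.2 hq1
  have hexp : (p - q) / p + q / p = 1 := by field_simp; ring
  have h4 : ∀ y : ℝ, 0 < y → (4 : ℝ≥0∞) ^ y < ∞ := fun y hy =>
    ENNReal.rpow_lt_top_of_nonneg hy.le (by norm_num)
  have halg : ∀ c : ℝ≥0∞, c ≠ 0 → c ≠ ∞ → ∀ X Y : ℝ≥0∞, X ^ (1 - q) * Y ^ q =
      (c * (c ^ (-(p / (p - q))) * X ^ (p * (1 - q) / (p - q)))) ^ ((p - q) / p) *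
        (c * Y ^ p) ^ (q / p) := by
    intro c hc0 hct X Y
    rw [ENNReal.mul_rpow_of_nonneg _ _ (by positivity : 0 ≤ (p - q) / p),
      ENNReal.mul_rpow_of_nonneg _ _ (by positivity : 0 ≤ (p - q) / p),
      ENNReal.mul_rpow_of_nonneg _ _ (by positivity : 0 ≤ q / p), ← ENNReal.rpow_mul,
      ← ENNReal.rpow_mul, ← ENNReal.rpow_mul,
      show p * (1 - q) / (p - q) * ((p - q) / p) = 1 - q by field_simp,
      show p * (q / p) = q by field_simp]
    calc _ = c ^ ((p - q) / p + -(p / (p - q)) * ((p - q) / p) + q / p) *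
          (X ^ (1 - q) * Y ^ q) := by
          rw [show (p - q) / p + -(p / (p - q)) * ((p - q) / p) + q / p = 0 by
            field_simp; ring, ENNReal.rpow_zero, one_mul]
      _ = _ := by
          rw [ENNReal.rpow_add _ _ hc0 hct, ENNReal.rpow_add _ _ hc0 hct]
          ring
  refine ⟨κ * (4 ^ ((p - q) / p) * 4 ^ (q / p)), ENNReal.mul_lt_top hκ (ENNReal.mul_lt_top
    (h4 _ (by positivity)) (h4 _ (by positivity))), ?_⟩
  intro a b z hz u v w f hu hv hw hf hW0 hWfin hUfin x hx
  set M := ∫⁻ t in Ioo z b, w t with hM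
  set B : ℕ → ℝ≥0∞ := fun k => ∫⁻ t in Ioo (x k) (x (k + 1)),
    (∫⁻ s in Ioo t (x (k + 1)), u s) ^ (q / (1 - q)) * u t * Vr r v (x k) t ^ (q / (1 - q)) with hB
  set g : ℕ → ℝ≥0∞ := fun k => ∫⁻ s in Ioo (x k) (x (k + 1)), f s with hg
  have hm0 : ∀ k : ℕ, 2⁻¹ ^ k * M ≠ 0 := fun k => mul_ne_zero (pow_ne_zero _ (by simp)) hW0.ne'
  have hmt : ∀ k : ℕ, 2⁻¹ ^ k * M ≠ ∞ := fun k =>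
    ENNReal.mul_ne_top (ENNReal.pow_ne_top (by simp)) hWfin
  have hC5 : ∑' k, (2⁻¹ ^ k * M) * ((2⁻¹ ^ k * M) ^ (-(p / (p - q))) *
      B k ^ (p * (1 - q) / (p - q))) ≤ 4 * C₅ a b r p q u v w ^ (p * q / (p - q)) := by
    rw [C₅_rpow hq hqp]
    refine tsum_mass_mul_le_of_forall_mem hz hw.1 hWfin hx _ _ fun k t ht => ?_
    refine le_trans ?_ (le_iSup₂ (x k) ⟨hz.1.trans_le (hx.le k), (hx.lt_succ k).trans ht.1⟩)
    rw [hx.mass]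
    have : 0 < q / (1 - q) := by positivity
    have : 0 < p * (1 - q) / (p - q) := by positivity
    gcongr _ * ?_ ^ _
    refine (lintegral_mono_set (Ioo_subset_Ioo_right ht.1.le)).trans' ?_
    refine setLIntegral_mono' measurableSet_Ioo fun s hs => ?_
    gcongr ?_ ^ _ * _ * _
    exact lintegral_mono_set (Ioo_subset_Ioo_right ht.1.le)
  have hsub : ∀ k, Ioo (x k) (x (k + 1)) ⊆ Ioo a b := fun k =>
    Ioo_subset_Ioo (hz.1.le.trans (hx.le k)) (hx.lt _).le
  calc _ ≤ ∑' k, κ * (((2⁻¹ ^ k * M) * ((2⁻¹ ^ k * M) ^ (-(p / (p - q))) *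
        B k ^ (p * (1 - q) / (p - q)))) ^ ((p - q) / p) * ((2⁻¹ ^ k * M) * g k ^ p) ^ (q / p)) := by
        refine ENNReal.tsum_le_tsum fun k => ?_
        refine (hloc (x k) (x (k + 1)) (hx.lt_succ k) u v f hu.1 hv.1 hf
          (fun t ht => (hu.2 t (hsub k ht)).1) ?_).trans_eq ?_
        · exact ((lintegral_mono_set (Ioo_subset_Ioo (hx.le k) (hx.lt _).le)).trans_lt
            hUfin.lt_top).ne
        · rw [mul_assoc]
          congr 1
          exact halg _ (hm0 k) (hmt k) _ _
    _ ≤ κ * ((4 * C₅ a b r p q u v w ^ (p * q / (p - q))) ^ ((p - q) / p) *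
        (4 * ∫⁻ t in Ioo a b, (∫⁻ s in Ioo a t, f s) ^ p * w t) ^ (q / p)) := by
        rw [ENNReal.tsum_mul_left]
        gcongr
        refine (tsum_mul_le_rpow_mul_rpow (by positivity) (by positivity) hexp _ _).trans ?_
        have : 0 < (p - q) / p := by positivity
        have : 0 < q / p := by positivity
        gcongr ?_ ^ _ * ?_ ^ _
        exact tsum_mass_mul_rpow_le hp hz hw.1 hWfin hx
    _ = _ := by
        rw [ENNReal.mul_rpow_of_nonneg _ _ (by positivity : 0 ≤ (p - q) / p),
          ENNReal.mul_rpow_of_nonneg _ _ (by positivity : 0 ≤ q / p), ← ENNReal.rpow_mul,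
          show p * q / (p - q) * ((p - q) / p) = q by field_simp]
        ring

theorem exists_lintegral_global_le {p q r : ℝ} (hq : 0 < q) (hqp : q < p) (hr0 : 0 < r)
    (hr1 : r ≤ 1) (hrp : r < p) :
    ∃ κ : ℝ≥0∞, κ < ∞ ∧ ∀ (a b z : ℝ), z ∈ Ioo a b → ∀ u v w f : ℝ → ℝ≥0∞,
      IsWeight a b u → IsWeight a b v → IsWeight a b w → Measurable f →
      (∀ x ∈ Ioo a b, 0 < (∫⁻ t in Ioo x b, w t) ∧ (∫⁻ t in Ioo x b, w t) < ∞) →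
      ∫⁻ t in Ioo z b, u t ≠ ∞ → ∀ x, IsDyadicSeq w z b x →
      ∫⁻ t in Ioo z b, (∑' j, if x (j + 2) ≤ t then
          ∫⁻ s in Ioo (x (j + 1)) (x (j + 2)), f s ^ r * v s else 0) ^ (q / r) * u t ≤
        κ * C₆ a b r p q u v w ^ q *
          (∫⁻ t in Ioo a b, (∫⁻ s in Ioo a t, f s) ^ p * w t) ^ (q / p) := by
  obtain ⟨κ, hκ, hhardy⟩ := exists_lintegral_hardy_le hq hqp hr0
  have hp := hq.trans hqp
  have hpq := sub_pos.2 hqp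
  have hpr := sub_pos.2 hrp
  set β : ℝ := p * r / (p - r) with hβ
  have hβ0 : 0 < β := by positivity
  set θ : ℝ := (p - r) * q / ((p - q) * r) with hθ
  have hθ0 : 0 < θ := by positivity
  have hexp : r / β + r / p = 1 := by rw [hβ]; field_simp; ring
  set κ' : ℝ≥0∞ := 2 ^ (p / (p - r)) with hκ'
  have hκ't : κ' < ∞ := ENNReal.rpow_lt_top_of_nonneg (by positivity) (by norm_num)
  have hκθ : κ' ^ θ < ∞ := ENNReal.rpow_lt_top_of_nonneg hθ0.le hκ't.ne
  have h4θ : κ' ^ θ * 4 < ∞ := ENNReal.mul_lt_top hκθ (by norm_num)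
  refine ⟨κ * ((κ' ^ θ * 4) ^ ((p - q) / p) * 4 ^ (q / p)), ENNReal.mul_lt_top hκ
    (ENNReal.mul_lt_top (ENNReal.rpow_lt_top_of_nonneg (by positivity) h4θ.ne)
    (ENNReal.rpow_lt_top_of_nonneg (by positivity) (by norm_num))), ?_⟩
  intro a b z hz u v w f hu hv hw hf hW hUfin x hx
  have hWz := hW z hz
  set M := ∫⁻ t in Ioo z b, w t with hM
  have hm0 : ∀ k : ℕ, 2⁻¹ ^ k * M ≠ 0 := fun k => mul_ne_zero (pow_ne_zero _ (by simp)) hWz.1.ne'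
  have hmt : ∀ k : ℕ, 2⁻¹ ^ k * M ≠ ∞ := fun k =>
    ENNReal.mul_ne_top (ENNReal.pow_ne_top (by simp)) hWz.2.ne
  set A : ℕ → ℝ≥0∞ := fun j => ∫⁻ s in Ioo (x (j + 1)) (x (j + 2)), f s ^ r * v s with hA
  set c : ℕ → ℝ≥0∞ := fun j => 2⁻¹ ^ (j + 1) * M with hc
  have hc0 : ∀ j, c j ≠ 0 := fun j => hm0 _
  have hct : ∀ j, c j ≠ ∞ := fun j => hmt _
  set V : ℕ → ℝ≥0∞ := fun j => Vr r v (x (j + 1)) (x (j + 2)) with hV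
  set e : ℕ → ℝ≥0∞ := fun j => c j ^ (-(r / (p - r))) * V j ^ β with he
  set n : ℕ → ℝ≥0∞ := fun j => c j * (∫⁻ s in Ioo (x (j + 1)) (x (j + 2)), f s) ^ p with hn
  have hAle : ∀ j, A j ≤ e j ^ (r / β) * n j ^ (r / p) := by
    intro j
    refine (lintegral_rpow_mul_le hr0 hr1 hv.1 hf _ _).trans_eq ?_
    simp only [he, hn]
    rw [ENNReal.mul_rpow_of_nonneg _ _ (by positivity : 0 ≤ r / β),
      ENNReal.mul_rpow_of_nonneg _ _ (by positivity : 0 ≤ r / p), ← ENNReal.rpow_mul,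
      ← ENNReal.rpow_mul, ← ENNReal.rpow_mul, mul_div_cancel₀ _ hβ0.ne', mul_div_cancel₀ _ hp.ne',
      mul_mul_mul_comm, ← ENNReal.rpow_add _ _ (hc0 _) (hct _),
      show -(r / (p - r)) * (r / β) + r / p = 0 by rw [hβ]; field_simp; ring]
    simp [hV]
  set Φ : ℝ → ℝ≥0∞ := fun t => ∑' j, if x (j + 2) ≤ t then A j else 0 with hΦ
  set E : ℝ → ℝ≥0∞ := fun t => ∑' j, if x (j + 2) ≤ t then e j else 0 with hE
  have hmonoif : ∀ g : ℕ → ℝ≥0∞, Monotone fun t => ∑' j, if x (j + 2) ≤ t then g j else 0 := by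
    intro g s t hst
    refine ENNReal.tsum_le_tsum fun j => ?_
    by_cases h1 : x (j + 2) ≤ s
    · simp [h1, h1.trans hst]
    · simp [h1]
  set ν : Measure ℝ := Measure.sum fun j => n j • Measure.dirac (x (j + 2)) with hν
  have hνuniv : ν univ ≤ 4 * ∫⁻ t in Ioo a b, (∫⁻ s in Ioo a t, f s) ^ p * w t := by
    rw [hν, Measure.sum_apply _ MeasurableSet.univ]
    simp only [Measure.smul_apply, measure_univ, smul_eq_mul, mul_one]
    refine le_trans ?_ (tsum_mass_mul_rpow_le hp hz hw.1 hWz.2.ne hx)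
    exact ENNReal.tsum_comp_le_tsum_of_injective (add_left_injective 1)
      fun k => (2⁻¹ ^ k * ∫⁻ s in Ioo z b, w s) * (∫⁻ s in Ioo (x k) (x (k + 1)), f s) ^ p
  have hH := hhardy z b hz.2 u hu.1 (fun t ht => (hu.2 t ⟨hz.1.trans ht.1, ht.2⟩).1) hUfin Φ
    (fun t => E t ^ (1 / β)) ν (hmonoif A)
    (fun s t hst => ENNReal.rpow_le_rpow (hmonoif e hst) (by positivity)) ?_ ?_
  · refine hH.trans ?_
    have hblock : ∀ k, ∀ t ∈ Ioo (x k) (x (k + 1)), E t ≤ κ' * ∫⁻ s in Ioo a (x k),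
        (∫⁻ σ in Set.Ioo s b, w σ) ^ (-(p / (p - r))) * w s * Vr r v s (x k) ^ β := by
      intro k t ht
      set X : ℝ → ℝ≥0∞ := fun s =>
        (∫⁻ σ in Set.Ioo s b, w σ) ^ (-(p / (p - r))) * w s * Vr r v s (x k) ^ β with hX
      calc E t ≤ ∑' j, κ' * ∫⁻ s in Ioo (x j) (x (j + 1)), (Ioo a (x k)).indicator X s := by
            refine ENNReal.tsum_le_tsum fun j => ?_
            split_ifs with hj
            swap
            · exact zero_le
            have hjk : j + 2 ≤ k := by
              by_contra! h
              exact absurd (hj.trans_lt ht.2) (not_lt.2 (hx.strictMono.monotone (by omega)))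
            have h2 : 2⁻¹ ^ j * M = 2 * c j := mul_half_pow_succ _ _
            calc e j = κ' * ((2 * c j) ^ (-(p / (p - r))) * c j * V j ^ β) := by
                  rw [ENNReal.mul_rpow_of_ne_top (by simp) (hct _), hκ']
                  simp only [he]
                  rw [show -(r / (p - r)) = -(p / (p - r)) + 1 by field_simp; ring,
                    ENNReal.rpow_add _ _ (hc0 _) (hct _), ENNReal.rpow_one, ENNReal.rpow_neg 2]
                  simp only [← mul_assoc]
                  rw [ENNReal.mul_inv_cancel (ENNReal.rpow_pos (by simp) (by simp)).ne' hκ't.ne,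
                    one_mul]
              _ = κ' * ∫⁻ s in Ioo (x j) (x (j + 1)), (2 * c j) ^ (-(p / (p - r))) * w s *
                    V j ^ β := by
                  rw [lintegral_mul_const _ (hw.1.const_mul _), lintegral_const_mul _ hw.1,
                    hx.mass_block hWz.2.ne]
              _ ≤ _ := by
                  gcongr κ' * ?_
                  refine setLIntegral_mono' measurableSet_Ioo fun s hs => ?_
                  rw [indicator_of_mem (show s ∈ Ioo a (x k) from
                    ⟨(hz.1.trans_le (hx.le j)).trans hs.1,
                      hs.2.trans_le (hx.strictMono.monotone (by omega))⟩)]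
                  simp only [hX]
                  gcongr ?_ * _ * ?_ ^ _
                  · rw [ENNReal.rpow_neg, ENNReal.rpow_neg, ENNReal.inv_le_inv, ← h2, ← hx.mass]
                    have : 0 < p / (p - r) := by positivity
                    gcongr
                    exact hs.1.le
                  · exact Vr_mono hr0 hr1 hs.2.le (hx.strictMono.monotone (by omega))
        _ = κ' * ∫⁻ s in Ioo z b, (Ioo a (x k)).indicator X s := by
            rw [ENNReal.tsum_mul_left, hx.lintegral_eq_tsum]
        _ ≤ _ := by
            gcongr κ' * ?_
            refine (setLIntegral_le_lintegral _ _).trans_eq ?_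
            rw [lintegral_indicator measurableSet_Ioo]
    set G : ℝ → ℝ≥0∞ := fun y => ∫⁻ s in Ioo a y,
        (∫⁻ σ in Set.Ioo s b, w σ) ^ (-(p / (p - r))) * w s * Vr r v s y ^ β with hG
    have hGmono : Monotone G := by
      intro y y' hy
      refine (lintegral_mono_set (Ioo_subset_Ioo_right hy)).trans (lintegral_mono fun s => ?_)
      gcongr
      exact Vr_mono hr0 hr1 le_rfl hy
    set Y : ℕ → ℝ≥0∞ := fun k => ∫⁻ t in Ioo (x k) (x (k + 1)),
      (∫⁻ s in Ioo t b, u s) ^ (q / (p - q)) * u t * G (x k) ^ θ with hY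
    have hC6 : ∑' k, Y k ≤ 4 * C₆ a b r p q u v w ^ (p * q / (p - q)) := by
      rw [C₆_rpow hq hqp]
      refine le_trans (le_of_eq ?_) (tsum_mass_mul_le_of_forall_mem hz hw.1 hWz.2.ne hx _
        (fun k => (2⁻¹ ^ k * M)⁻¹ * Y k) fun k t ht => ?_)
      · refine tsum_congr fun k => ?_
        rw [← mul_assoc, ENNReal.mul_inv_cancel (hm0 k) (hmt k), one_mul]
      · set J := essSup (fun y => (∫⁻ s in Set.Ioo y b, w s)⁻¹ *
          (∫⁻ t in Set.Ioo y t, (∫⁻ s in Set.Ioo t b, u s) ^ (q / (p - q)) * u t *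
              G y ^ θ)) (volume.restrict (Set.Ioo a t)) with hJ
        change (2⁻¹ ^ k * M)⁻¹ * Y k ≤ J
        have hae := ENNReal.ae_le_essSup (μ := volume.restrict (Ioo a t)) (fun y =>
          (∫⁻ s in Set.Ioo y b, w s)⁻¹ *
          (∫⁻ t in Set.Ioo y t, (∫⁻ s in Set.Ioo t b, u s) ^ (q / (p - q)) * u t * G y ^ θ))
        have hYle : Y k ≤ 2⁻¹ ^ k * M * J := by
          refine lintegral_Ioo_le_of_forall_left (hx.lt_succ k) fun y hy => ?_
          obtain ⟨y', hy', hy'J⟩ := exists_mem_Ioo_of_ae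
            (ae_restrict_of_ae_restrict_of_subset
              (Ioo_subset_Ioo_left (hz.1.le.trans (hx.le k))) hae) hy.1 (hy.2.trans ht.1).le
          have hWy := hW y' ⟨(hz.1.trans_le (hx.le k)).trans hy'.1,
            hy'.2.trans (hy.2.trans (hx.lt _))⟩
          calc _ ≤ ∫⁻ s in Ioo y' t, (∫⁻ σ in Set.Ioo s b, u σ) ^ (q / (p - q)) * u s *
                G y' ^ θ := by
                refine (lintegral_mono_set (Ioo_subset_Ioo hy'.2.le ht.1.le)).trans
                  (lintegral_mono fun s => ?_)
                gcongr
                exact hGmono hy'.1.le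
            _ = (∫⁻ s in Ioo y' b, w s) * ((∫⁻ s in Ioo y' b, w s)⁻¹ *
                ∫⁻ s in Ioo y' t, (∫⁻ σ in Set.Ioo s b, u σ) ^ (q / (p - q)) * u s *
                G y' ^ θ) := by
                rw [← mul_assoc, ENNReal.mul_inv_cancel hWy.1.ne' hWy.2.ne, one_mul]
            _ ≤ _ := by
                gcongr
                rw [hM, ← hx.mass]
                exact antitone_lintegral_Ioo_left w b hy'.1.le
        calc _ ≤ (2⁻¹ ^ k * M)⁻¹ * (2⁻¹ ^ k * M * J) := by gcongr
          _ = J := by rw [← mul_assoc, ENNReal.inv_mul_cancel (hm0 k) (hmt k), one_mul]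
    have hint : ∫⁻ t in Ioo z b, (∫⁻ s in Ioo t b, u s) ^ (q / (p - q)) * u t *
        (E t ^ (1 / β)) ^ (p * q / (p - q)) ≤
        κ' ^ θ * 4 * C₆ a b r p q u v w ^ (p * q / (p - q)) := by
      rw [hx.lintegral_eq_tsum, mul_assoc]
      calc _ ≤ ∑' k, κ' ^ θ * Y k := by
            refine ENNReal.tsum_le_tsum fun k => ?_
            rw [← lintegral_const_mul' _ _ hκθ.ne]
            refine setLIntegral_mono' measurableSet_Ioo fun t ht => ?_
            rw [← ENNReal.rpow_mul, show 1 / β * (p * q / (p - q)) = θ by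
              rw [hβ, hθ]; field_simp]
            calc _ ≤ (∫⁻ s in Ioo t b, u s) ^ (q / (p - q)) * u t * (κ' * G (x k)) ^ θ := by
                  gcongr
                  exact hblock k t ht
              _ = _ := by
                  rw [ENNReal.mul_rpow_of_nonneg _ _ hθ0.le]; ring
        _ ≤ _ := by rw [ENNReal.tsum_mul_left]; gcongr
    calc _ ≤ κ * (κ' ^ θ * 4 * C₆ a b r p q u v w ^ (p * q / (p - q))) ^ ((p - q) / p) *
          (4 * ∫⁻ t in Ioo a b, (∫⁻ s in Ioo a t, f s) ^ p * w t) ^ (q / p) := by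
          have : 0 < (p - q) / p := by positivity
          gcongr
      _ = _ := by
          rw [ENNReal.mul_rpow_of_nonneg _ _ (by positivity : 0 ≤ (p - q) / p),
            ENNReal.mul_rpow_of_nonneg _ _ (by positivity : 0 ≤ q / p),
            ← ENNReal.rpow_mul (C₆ a b r p q u v w), show p * q / (p - q) * ((p - q) / p) = q by field_simp]
          ring
  · simp only [hΦ, ENNReal.tsum_eq_zero]
    intro j
    rw [if_neg]
    rw [not_le, ← hx.zero]
    exact hx.strictMono (by omega)
  · intro s t hs hst htb
    set N : ℕ → ℝ≥0∞ := fun j => if s < x (j + 2) ∧ x (j + 2) ≤ t then n j else 0 with hN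
    have hνN : ν (Ioc s t) = ∑' j, N j := by
      rw [hν, Measure.sum_apply _ measurableSet_Ioc]
      refine tsum_congr fun j => ?_
      rw [Measure.smul_apply, Measure.dirac_apply' _ measurableSet_Ioc, hN]
      simp [indicator_apply]
    calc Φ t ≤ ∑' j, ((if x (j + 2) ≤ s then A j else 0) +
          (if x (j + 2) ≤ t then e j else 0) ^ (r / β) * N j ^ (r / p)) := by
          refine ENNReal.tsum_le_tsum fun j => ?_
          by_cases h1 : x (j + 2) ≤ s
          · simp [h1, h1.trans hst]
          · by_cases h2 : x (j + 2) ≤ t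
            · simpa [hN, h1, h2, not_le.1 h1] using hAle j
            · simp [h2]
      _ = Φ s + ∑' j, (if x (j + 2) ≤ t then e j else 0) ^ (r / β) * N j ^ (r / p) :=
          ENNReal.tsum_add
      _ ≤ Φ s + E t ^ (r / β) * (∑' j, N j) ^ (r / p) := by
          gcongr
          exact tsum_mul_le_rpow_mul_rpow (by positivity) (by positivity) hexp _ _
      _ = _ := by
          rw [hνN, ENNReal.mul_rpow_of_nonneg _ _ hr0.le, ← ENNReal.rpow_mul, ← ENNReal.rpow_mul,
            one_div_mul_eq_div, one_div_mul_eq_div]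

/-- Monotone convergence for a family of integrands on `(z,b)` as `z` decreases to `a`. -/
theorem lintegral_Ioo_le_of_forall_truncation {a b : ℝ} (hab : a < b) {g : ℝ → ℝ≥0∞}
    {F : ℝ → ℝ → ℝ≥0∞} (hF : ∀ z, Measurable (F z)) (hanti : ∀ t, Antitone fun z => F z t)
    (hg : ∀ t ∈ Ioo a b, ∀ c < g t, ∃ z ∈ Ioo a t, c < F z t) {E : ℝ≥0∞}
    (h : ∀ z ∈ Ioo a b, ∫⁻ t in Ioo z b, F z t ≤ E) : ∫⁻ t in Ioo a b, g t ≤ E := by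
  obtain ⟨y, hy, hyc, hlim⟩ := exists_seq_strictAnti_tendsto' hab
  calc ∫⁻ t in Ioo a b, g t ≤ ∫⁻ t in Ioo a b, ⨆ n, (Ioo (y n) b).indicator (F (y n)) t := by
        refine setLIntegral_mono' measurableSet_Ioo fun t ht => le_of_forall_lt fun c hc => ?_
        obtain ⟨z, hz, hcz⟩ := hg t ht c hc
        obtain ⟨n, hn⟩ := (hlim.eventually_lt_const hz.1).exists
        refine lt_iSup_iff.2 ⟨n, ?_⟩
        rw [indicator_of_mem (show t ∈ Ioo (y n) b from ⟨hn.trans hz.2, ht.2⟩)]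
        exact hcz.trans_le (hanti t hn.le)
    _ = ⨆ n, ∫⁻ t in Ioo a b, (Ioo (y n) b).indicator (F (y n)) t := by
        refine lintegral_iSup (fun n => (hF _).indicator measurableSet_Ioo)
          (monotone_nat_of_le_succ fun n t => ?_)
        by_cases ht : t ∈ Ioo (y n) b
        · rw [indicator_of_mem ht, indicator_of_mem
            (show t ∈ Ioo (y (n + 1)) b from ⟨(hy (Nat.lt_succ_self n)).trans ht.1, ht.2⟩)]
          exact hanti t (hy (Nat.lt_succ_self n)).le
        · rw [indicator_of_notMem ht]; exact zero_le
    _ ≤ E := by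
        refine iSup_le fun n => ((setLIntegral_le_lintegral _ _).trans_eq ?_).trans (h _ (hyc n))
        rw [lintegral_indicator measurableSet_Ioo]

theorem IsDyadicSeq.lintegral_Ioo_le {φ : ℝ → ℝ≥0∞} {z b : ℝ} {x : ℕ → ℝ}
    (hx : IsDyadicSeq φ z b x) (g : ℝ → ℝ≥0∞) {k : ℕ} {t : ℝ} (ht : x k ≤ t) :
    ∫⁻ s in Ioo z t, g s ≤ (if x 1 ≤ t then ∫⁻ s in Ioo (x 0) (x 1), g s else 0) +
      (∑' j, if x (j + 2) ≤ t then ∫⁻ s in Ioo (x (j + 1)) (x (j + 2)), g s else 0) +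
      ∫⁻ s in Ioo (x k) t, g s := by
  have hsum : ∀ k, ∫⁻ s in Ioo (x 0) (x k), g s =
      ∑ j ∈ Finset.range k, ∫⁻ s in Ioo (x j) (x (j + 1)), g s := by
    intro k
    induction k with
    | zero => simp
    | succ k ih =>
      rw [Finset.sum_range_succ, ← ih, ← lintegral_Ioo_split g
        (hx.strictMono.monotone (Nat.zero_le k)) (hx.lt_succ k).le]
  rw [← hx.zero, lintegral_Ioo_split g (hx.strictMono.monotone (Nat.zero_le k)) ht, hsum]
  gcongr
  cases k with
  | zero => simp
  | succ k =>
    rw [Finset.sum_range_succ', add_comm, if_pos ((hx.strictMono.monotone (by omega)).trans ht)]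
    gcongr
    refine le_trans (Finset.sum_le_sum fun j hj => ?_) (ENNReal.sum_le_tsum (Finset.range k))
    rw [Finset.mem_range] at hj
    rw [if_pos ((hx.strictMono.monotone (by omega)).trans ht)]

theorem exists_cesCesIneq {p q r : ℝ} (hq : 0 < q) (hqp : q < p) (hq1 : q < 1) (hr0 : 0 < r)
    (hr1 : r ≤ 1) (hrp : r < p) :
    ∃ κ : ℝ≥0∞, κ < ∞ ∧ ∀ (a b : ℝ), a < b → ∀ u v w : ℝ → ℝ≥0∞,
      IsWeight a b u → IsWeight a b v → IsWeight a b w →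
      (∀ x ∈ Ioo a b, 0 < (∫⁻ t in Ioo x b, w t) ∧ (∫⁻ t in Ioo x b, w t) < ∞) →
      C₁ a b r p q u v w ≠ ∞ →
      CesCesIneq a b r p q u v w
        (κ * (C₁ a b r p q u v w + C₅ a b r p q u v w + C₆ a b r p q u v w)) := by
  obtain ⟨κ₁, hκ₁, hloc⟩ := exists_tsum_local_le hq hqp hq1 hr0 hr1
  obtain ⟨κ₂, hκ₂, hglob⟩ := exists_lintegral_global_le hq hqp hr0 hr1 hrp
  have hs : 0 < q / r := div_pos hq hr0
  have hp := hq.trans hqp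
  have hqp' : 0 < q / p := div_pos hq hp
  obtain ⟨κ₃, hκ₃, hadd⟩ := exists_add_rpow_le hs
  have h4 : (4 : ℝ≥0∞) ^ (q / p) < ∞ := ENNReal.rpow_lt_top_of_nonneg hqp'.le (by norm_num)
  set κ : ℝ≥0∞ := κ₃ * (κ₃ * (4 ^ (q / p) + κ₂) + κ₁) with hκ
  have hκt : κ < ∞ := ENNReal.mul_lt_top hκ₃ (ENNReal.add_lt_top.2 ⟨ENNReal.mul_lt_top hκ₃
    (ENNReal.add_lt_top.2 ⟨h4, hκ₂⟩), hκ₁⟩)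
  refine ⟨κ ^ (1 / q), ENNReal.rpow_lt_top_of_nonneg (by positivity) hκt.ne, ?_⟩
  intro a b hab u v w hu hv hw hW hC1 f hf
  set S := C₁ a b r p q u v w + C₅ a b r p q u v w + C₆ a b r p q u v w with hS
  set N := ∫⁻ t in Ioo a b, (∫⁻ s in Ioo a t, f s) ^ p * w t with hN
  have hS1 : C₁ a b r p q u v w ≤ S := le_self_add.trans le_self_add
  have hS5 : C₅ a b r p q u v w ≤ S := le_add_self.trans le_self_add
  have hS6 : C₆ a b r p q u v w ≤ S := le_add_self
  have hVU : ∀ x t, a < x → x < t → t < b → Vr r v x t * (∫⁻ s in Ioo t b, u s) ^ (1 / q) ≤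
      C₁ a b r p q u v w * (∫⁻ s in Ioo x b, w s) ^ (1 / p) := fun x t h1 h2 h3 =>
    Vr_mul_le_C₁ hr0 hr1 hp hq hu hv hW h1 h2 h3
  have hg : ∀ (y : ℝ), Monotone fun t => ∫⁻ s in Ioo y t, f s ^ r * v s := fun y =>
    monotone_lintegral_Ioo_right _ y
  suffices hmain : ∫⁻ t in Ioo a b, (∫⁻ s in Ioo a t, f s ^ r * v s) ^ (q / r) * u t ≤
      κ * S ^ q * N ^ (q / p) by
    calc _ ≤ (κ * S ^ q * N ^ (q / p)) ^ (1 / q) := by gcongr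
      _ = _ := by
        rw [ENNReal.mul_rpow_of_nonneg _ _ (by positivity : 0 ≤ 1 / q),
          ENNReal.mul_rpow_of_nonneg _ _ (by positivity : 0 ≤ 1 / q), ← ENNReal.rpow_mul S,
          ← ENNReal.rpow_mul N, mul_one_div_cancel hq.ne', ENNReal.rpow_one,
          show q / p * (1 / q) = 1 / p by field_simp]
  refine lintegral_Ioo_le_of_forall_truncation hab
    (F := fun z t => (∫⁻ s in Ioo z t, f s ^ r * v s) ^ (q / r) * u t)
    (fun z => ((hg z).measurable.pow_const _).mul hu.1) (fun t z z' hz => ?_) (fun t ht c hc => ?_)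
    fun z hz => ?_
  · simp only
    gcongr
  · by_contra! hle
    refine absurd hc (not_lt.2 ?_)
    have hu0 := hu.2 t ht
    rw [← ENNReal.le_div_iff_mul_le (Or.inl hu0.1.ne') (Or.inl hu0.2.ne)]
    have h1 : ∫⁻ s in Ioo a t, f s ^ r * v s ≤ (c / u t) ^ (q / r)⁻¹ := by
      refine lintegral_Ioo_le_of_forall_left ht.1 fun y hy => ?_
      rw [ENNReal.le_rpow_inv_iff hs,
        ENNReal.le_div_iff_mul_le (Or.inl hu0.1.ne') (Or.inl hu0.2.ne)]
      exact hle y hy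
    rwa [ENNReal.le_rpow_inv_iff hs] at h1
  have hUfin : ∫⁻ t in Ioo z b, u t ≠ ∞ :=
    lintegral_Ioo_ne_top_of_Vr_mul_le hr0 hr1 hp hq hv hW hC1 hVU hz
  obtain ⟨x, hx⟩ := exists_isDyadicSeq hw.1 hz.2
    (fun t ht => (hw.2 t ⟨hz.1.trans ht.1, ht.2⟩).1) (hW z hz).2.ne
  set A := ∫⁻ s in Ioo (x 0) (x 1), f s ^ r * v s with hA
  set Φ : ℝ → ℝ≥0∞ := fun t => ∑' j, if x (j + 2) ≤ t then
    ∫⁻ s in Ioo (x (j + 1)) (x (j + 2)), f s ^ r * v s else 0 with hΦ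
  have hΦm : Measurable Φ := by
    refine Measurable.tsum fun j => ?_
    exact Measurable.ite measurableSet_Ici measurable_const measurable_const
  have hAm : Measurable fun t => (if x 1 ≤ t then A else 0) ^ (q / r) * u t :=
    ((Measurable.ite measurableSet_Ici measurable_const measurable_const).pow_const _).mul hu.1
  have hfirst : ∫⁻ t in Ioo z b, (if x 1 ≤ t then A else 0) ^ (q / r) * u t ≤
      4 ^ (q / p) * S ^ q * N ^ (q / p) := by
    calc _ ≤ ∫⁻ t in Ioo z b, (Ico (x 1) b).indicator (fun t => A ^ (q / r) * u t) t := by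
          refine setLIntegral_mono' measurableSet_Ioo fun t ht => ?_
          by_cases h1 : x 1 ≤ t
          · rw [if_pos h1, indicator_of_mem (show t ∈ Ico (x 1) b from ⟨h1, ht.2⟩)]
          · simp [h1, hs]
      _ ≤ A ^ (q / r) * ∫⁻ t in Ioo (x 1) b, u t := by
          refine (setLIntegral_le_lintegral _ _).trans_eq ?_
          rw [lintegral_indicator measurableSet_Ico, lintegral_const_mul _ hu.1,
            lintegral_Ico_eq_Ioo]
      _ ≤ (Vr r v (x 0) (x 1) ^ r * (∫⁻ s in Ioo (x 0) (x 1), f s) ^ r) ^ (q / r) *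
            ∫⁻ t in Ioo (x 1) b, u t := by
          gcongr
          exact lintegral_rpow_mul_le hr0 hr1 hv.1 hf _ _
      _ = (Vr r v (x 0) (x 1) * (∫⁻ t in Ioo (x 1) b, u t) ^ (1 / q)) ^ q *
            (∫⁻ s in Ioo (x 0) (x 1), f s) ^ q := by
          rw [ENNReal.mul_rpow_of_nonneg _ _ hs.le, ENNReal.mul_rpow_of_nonneg _ _ hq.le,
            ← ENNReal.rpow_mul, ← ENNReal.rpow_mul, ← ENNReal.rpow_mul,
            mul_div_cancel₀ _ hr0.ne', one_div_mul_cancel hq.ne', ENNReal.rpow_one]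
          ring
      _ ≤ (S * (∫⁻ s in Ioo (x 0) b, w s) ^ (1 / p)) ^ q *
            (∫⁻ s in Ioo (x 0) (x 1), f s) ^ q := by
          gcongr ?_ ^ _ * _
          refine (hVU (x 0) (x 1) (by rw [hx.zero]; exact hz.1) (hx.lt_succ 0) (hx.lt _)).trans ?_
          gcongr
      _ = S ^ q * ((2⁻¹ ^ 0 * ∫⁻ s in Ioo z b, w s) *
            (∫⁻ s in Ioo (x 0) (x (0 + 1)), f s) ^ p) ^ (q / p) := by
          rw [← hx.mass 0, ENNReal.mul_rpow_of_nonneg _ _ hq.le,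
            ENNReal.mul_rpow_of_nonneg _ _ hqp'.le, ← ENNReal.rpow_mul, ← ENNReal.rpow_mul,
            mul_div_cancel₀ _ hp.ne', one_div_mul_eq_div, zero_add]
          ring
      _ ≤ S ^ q * (4 * N) ^ (q / p) := by
          gcongr S ^ q * ?_ ^ _
          exact (ENNReal.le_tsum (f := fun k => (2⁻¹ ^ k * ∫⁻ s in Ioo z b, w s) *
            (∫⁻ s in Ioo (x k) (x (k + 1)), f s) ^ p) 0).trans
            (tsum_mass_mul_rpow_le hp hz hw.1 (hW z hz).2.ne hx)
      _ = _ := by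
          rw [ENNReal.mul_rpow_of_nonneg _ _ hqp'.le]; ring
  have hsecond : ∫⁻ t in Ioo z b, Φ t ^ (q / r) * u t ≤ κ₂ * S ^ q * N ^ (q / p) :=
    (hglob a b z hz u v w f hu hv hw hf hW hUfin x hx).trans (by gcongr)
  have hthird : ∑' k, ∫⁻ t in Ioo (x k) (x (k + 1)),
      (∫⁻ s in Ioo (x k) t, f s ^ r * v s) ^ (q / r) * u t ≤ κ₁ * S ^ q * N ^ (q / p) :=
    (hloc a b z hz u v w f hu hv hw hf (hW z hz).1 (hW z hz).2.ne hUfin x hx).trans (by gcongr)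
  set g₁ : ℝ → ℝ≥0∞ := fun t => (if x 1 ≤ t then A else 0) ^ (q / r) * u t with hg₁
  set g₂ : ℝ → ℝ≥0∞ := fun t => Φ t ^ (q / r) * u t with hg₂
  have hg₂m : Measurable g₂ := (hΦm.pow_const _).mul hu.1
  have hgm : Measurable fun t => κ₃ * (g₁ t + g₂ t) := (hAm.add hg₂m).const_mul _
  calc ∫⁻ t in Ioo z b, (∫⁻ s in Ioo z t, f s ^ r * v s) ^ (q / r) * u t
      = ∑' k, ∫⁻ t in Ioo (x k) (x (k + 1)),
          (∫⁻ s in Ioo z t, f s ^ r * v s) ^ (q / r) * u t := hx.lintegral_eq_tsum _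
    _ ≤ ∑' k, κ₃ * (κ₃ * ((∫⁻ t in Ioo (x k) (x (k + 1)), g₁ t) +
          ∫⁻ t in Ioo (x k) (x (k + 1)), g₂ t) + ∫⁻ t in Ioo (x k) (x (k + 1)),
          (∫⁻ s in Ioo (x k) t, f s ^ r * v s) ^ (q / r) * u t) := by
        refine ENNReal.tsum_le_tsum fun k => ?_
        rw [← lintegral_add_left hAm, ← lintegral_const_mul' _ _ hκ₃.ne,
          ← lintegral_add_left hgm, ← lintegral_const_mul' _ _ hκ₃.ne]
        refine setLIntegral_mono' measurableSet_Ioo fun t ht => ?_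
        calc _ ≤ ((if x 1 ≤ t then A else 0) + Φ t + ∫⁻ s in Ioo (x k) t, f s ^ r * v s) ^ (q / r)
              * u t := by
              gcongr
              exact hx.lintegral_Ioo_le _ ht.1.le
          _ ≤ (κ₃ * (κ₃ * ((if x 1 ≤ t then A else 0) ^ (q / r) + Φ t ^ (q / r)) +
              (∫⁻ s in Ioo (x k) t, f s ^ r * v s) ^ (q / r))) * u t := by
              gcongr
              refine (hadd _ _).trans ?_
              gcongr
              exact hadd _ _
          _ = _ := by simp only [hg₁, hg₂]; ring
    _ = κ₃ * (κ₃ * ((∫⁻ t in Ioo z b, g₁ t) + ∫⁻ t in Ioo z b, g₂ t) +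
          ∑' k, ∫⁻ t in Ioo (x k) (x (k + 1)),
          (∫⁻ s in Ioo (x k) t, f s ^ r * v s) ^ (q / r) * u t) := by
        rw [ENNReal.tsum_mul_left, ENNReal.tsum_add, ENNReal.tsum_mul_left, ENNReal.tsum_add,
          ← hx.lintegral_eq_tsum, ← hx.lintegral_eq_tsum]
    _ ≤ κ₃ * (κ₃ * (4 ^ (q / p) * S ^ q * N ^ (q / p) + κ₂ * S ^ q * N ^ (q / p)) +
          κ₁ * S ^ q * N ^ (q / p)) := by gcongr
    _ = _ := by rw [hκ]; ring

theorem CesCesIneq.lintegral_le {a b p q r : ℝ} (hq : 0 < q) {u v w : ℝ → ℝ≥0∞} {C : ℝ≥0∞}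
    (h : CesCesIneq a b r p q u v w C) {f : ℝ → ℝ≥0∞} (hf : Measurable f) :
    ∫⁻ t in Ioo a b, (∫⁻ s in Ioo a t, f s ^ r * v s) ^ (q / r) * u t ≤
      C ^ q * (∫⁻ t in Ioo a b, (∫⁻ s in Ioo a t, f s) ^ p * w t) ^ (q / p) := by
  have h1 := ENNReal.rpow_le_rpow (h f hf) hq.le
  rwa [ENNReal.mul_rpow_of_nonneg _ _ hq.le, ← ENNReal.rpow_mul, ← ENNReal.rpow_mul,
    one_div_mul_cancel hq.ne', ENNReal.rpow_one, one_div_mul_eq_div] at h1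

theorem CesCesIneq.Vr_mul_le {a b p q r : ℝ} (hr0 : 0 < r) (hr1 : r ≤ 1) (hp : 0 < p) (hq : 0 < q)
    {u v w : ℝ → ℝ≥0∞} (hu : Measurable u) (hv : Measurable v) {C : ℝ≥0∞}
    (h : CesCesIneq a b r p q u v w C) {x t : ℝ} (hax : a < x) (hxt : x < t) (htb : t < b) :
    Vr r v x t * (∫⁻ s in Ioo t b, u s) ^ (1 / q) ≤ C * (∫⁻ s in Ioo x b, w s) ^ (1 / p) := by
  refine ENNReal.mul_le_of_forall_lt fun c hc d hd => ?_
  obtain ⟨f, hf, hf0, hf1, hfc⟩ := exists_lt_Vr hr0 hr1 hv hc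
  have hs : 0 < q / r := div_pos hq hr0
  calc c * d ≤ c * (∫⁻ s in Ioo t b, u s) ^ (1 / q) := by gcongr
    _ = (∫⁻ s in Ioo t b, (c ^ r) ^ (q / r) * u s) ^ (1 / q) := by
        rw [lintegral_const_mul _ hu, ENNReal.mul_rpow_of_nonneg _ _ (by positivity),
          ← ENNReal.rpow_mul, ← ENNReal.rpow_mul, show r * (q / r * (1 / q)) = 1 by field_simp,
          ENNReal.rpow_one]
    _ ≤ (∫⁻ s in Ioo a b, (∫⁻ σ in Ioo a s, f σ ^ r * v σ) ^ (q / r) * u s) ^ (1 / q) := by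
        gcongr ?_ ^ _
        refine le_trans ?_ (lintegral_mono_set (Ioo_subset_Ioo_left (hax.trans hxt).le))
        refine setLIntegral_mono' measurableSet_Ioo fun s hs => ?_
        gcongr
        exact hfc.trans (lintegral_mono_set (Ioo_subset_Ioo hax.le hs.1.le))
    _ ≤ C * (∫⁻ s in Ioo a b, (∫⁻ σ in Ioo a s, f σ) ^ p * w s) ^ (1 / p) := h f hf
    _ ≤ C * (∫⁻ s in Ioo x b, w s) ^ (1 / p) := by
        gcongr C * ?_ ^ _
        rw [lintegral_Ioo_split _ hax.le (hxt.trans htb).le]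
        have h0 : ∫⁻ s in Ioo a x, (∫⁻ σ in Ioo a s, f σ) ^ p * w s = 0 := by
          refine le_antisymm ?_ bot_le
          calc _ ≤ ∫⁻ s in Ioo a x, 0 := by
                refine setLIntegral_mono' measurableSet_Ioo fun s hs => ?_
                have : ∫⁻ σ in Ioo a s, f σ = 0 := by
                  refine le_antisymm ?_ bot_le
                  calc _ ≤ ∫⁻ σ in Ioo a s, 0 := by
                        refine setLIntegral_mono' measurableSet_Ioo fun σ hσ => ?_
                        rw [hf0 σ fun hm => absurd (hσ.2.trans hs.2) hm.1.not_gt]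
                    _ = 0 := by simp
                simp [this, hp]
            _ = 0 := by simp
        rw [h0, zero_add]
        refine lintegral_mono fun s => ?_
        calc _ ≤ 1 ^ p * w s := by
              gcongr
              exact (setLIntegral_le_lintegral _ _).trans hf1
          _ = w s := by simp

theorem C₁_le_of_Vr_mul_le {a b p q r : ℝ} {u v w : ℝ → ℝ≥0∞}
    (hW : ∀ x ∈ Ioo a b, 0 < (∫⁻ t in Ioo x b, w t) ∧ (∫⁻ t in Ioo x b, w t) < ∞)
    {C : ℝ≥0∞}
    (h : ∀ x t, a < x → x < t → t < b → Vr r v x t * (∫⁻ s in Ioo t b, u s) ^ (1 / q) ≤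
      C * (∫⁻ s in Ioo x b, w s) ^ (1 / p)) :
    C₁ a b r p q u v w ≤ C := by
  refine essSup_le_of_ae_le _ ?_
  refine (ae_restrict_iff' measurableSet_Ioo).2 (Filter.Eventually.of_forall fun x hx => ?_)
  simp only
  calc _ ≤ (∫⁻ t in Ioo x b, w t) ^ (-(1 / p)) * (C * (∫⁻ t in Ioo x b, w t) ^ (1 / p)) := by
        gcongr
        refine essSup_le_of_ae_le _ ?_
        refine (ae_restrict_iff' measurableSet_Ioo).2 (Filter.Eventually.of_forall fun t ht => ?_)
        simp only
        rw [mul_comm]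
        exact h x t hx.1 ht.1 ht.2
    _ = C := by
        rw [mul_left_comm, ← ENNReal.rpow_add _ _ (hW x hx).1.ne' (hW x hx).2.ne]
        simp

/-- Norm of a test function built from normalized pieces adapted to a dyadic sequence. -/
theorem exists_lintegral_tsum_le {p : ℝ} (hp : 0 < p) :
    ∃ κ : ℝ≥0∞, κ < ∞ ∧ ∀ (a b z : ℝ), z ∈ Ioo a b → ∀ w : ℝ → ℝ≥0∞, Measurable w →
      ∫⁻ s in Ioo z b, w s ≠ ∞ → ∀ x : ℕ → ℝ, IsDyadicSeq w z b x →
      ∀ f : ℕ → ℝ → ℝ≥0∞, (∀ l, Measurable (f l)) → (∀ l, ∫⁻ s, f l s ≤ 1) →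
      (∀ l, ∀ s, s ≤ x (l - 1) → f l s = 0) → ∀ c : ℕ → ℝ≥0∞,
      ∫⁻ t in Ioo a b, (∫⁻ s in Ioo a t, ∑' l, c l * f l s) ^ p * w t ≤
        κ * ∑' l, (2⁻¹ ^ l * ∫⁻ s in Ioo z b, w s) * c l ^ p := by
  obtain ⟨κ, hκ, hgeo⟩ := exists_tsum_geometric_mul_rpow_sum_le hp (ρ := 2⁻¹) (by simp) (by simp)
  refine ⟨κ, hκ, ?_⟩
  intro a b z hz w hw hwfin x hx f hf hf1 hf0 c
  set M := ∫⁻ s in Ioo z b, w s with hM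
  have hF : ∀ t, ∫⁻ s in Ioo a t, ∑' l, c l * f l s = ∑' l, c l * ∫⁻ s in Ioo a t, f l s := by
    intro t
    rw [lintegral_tsum fun l => ((hf l).const_mul _).aemeasurable]
    simp_rw [lintegral_const_mul _ (hf _)]
  have hzero : ∀ l t, t ≤ x (l - 1) → ∫⁻ s in Ioo a t, f l s = 0 := by
    intro l t ht
    refine le_antisymm ?_ bot_le
    calc _ ≤ ∫⁻ s in Ioo a t, 0 := by
          refine setLIntegral_mono' measurableSet_Ioo fun s hs => ?_
          rw [hf0 l s (hs.2.le.trans ht)]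
      _ = 0 := by simp
  rw [lintegral_Ioo_split _ hz.1.le hz.2.le]
  have h0 : ∫⁻ t in Ioo a z, (∫⁻ s in Ioo a t, ∑' l, c l * f l s) ^ p * w t = 0 := by
    refine le_antisymm ?_ bot_le
    calc _ ≤ ∫⁻ s in Ioo a z, 0 := by
          refine setLIntegral_mono' measurableSet_Ioo fun t ht => ?_
          rw [hF]
          simp [hzero _ t (ht.2.le.trans (hx.le _)), hp]
      _ = 0 := by simp
  rw [h0, zero_add, hx.lintegral_eq_tsum]
  calc _ ≤ ∑' k, M * (2⁻¹ ^ (k + 1) * (∑ l ∈ Finset.range (k + 1 + 1), c l) ^ p) := by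
        refine ENNReal.tsum_le_tsum fun k => ?_
        calc _ ≤ ∫⁻ t in Ioo (x k) (x (k + 1)), (∑ l ∈ Finset.range (k + 1 + 1), c l) ^ p * w t := by
              refine setLIntegral_mono' measurableSet_Ioo fun t ht => ?_
              gcongr
              rw [hF, tsum_eq_sum (s := Finset.range (k + 1 + 1)) fun l hl => ?_]
              · refine Finset.sum_le_sum fun l _ => ?_
                calc _ ≤ c l * 1 := by
                      gcongr
                      exact (setLIntegral_le_lintegral _ _).trans (hf1 l)
                  _ = c l := mul_one _
              · rw [Finset.mem_range, not_lt] at hl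
                rw [hzero l t (ht.2.le.trans (hx.strictMono.monotone (by omega))), mul_zero]
          _ = _ := by
              rw [lintegral_const_mul _ hw, hx.mass_block hwfin]
              ring
    _ = M * ∑' k, 2⁻¹ ^ (k + 1) * (∑ l ∈ Finset.range (k + 1 + 1), c l) ^ p :=
        ENNReal.tsum_mul_left
    _ ≤ M * ∑' k, 2⁻¹ ^ k * (∑ l ∈ Finset.range (k + 1), c l) ^ p := by
        gcongr M * ?_
        exact ENNReal.tsum_comp_le_tsum_of_injective (add_left_injective 1)
          fun k => 2⁻¹ ^ k * (∑ l ∈ Finset.range (k + 1), c l) ^ p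
    _ ≤ M * (κ * ∑' k, 2⁻¹ ^ k * c k ^ p) := by
        gcongr
        exact hgeo c
    _ = _ := by
        rw [mul_left_comm, ← ENNReal.tsum_mul_left]
        congr 2
        ext l
        ring

/-- A testing characterisation of the local part of the inequality from below. -/
theorem exists_lintegral_le_of_forall_test {q r : ℝ} (hq : 0 < q) (hq1 : q < 1) (hr0 : 0 < r)
    (hr1 : r ≤ 1) :
    ∃ κ : ℝ≥0∞, κ < ∞ ∧ ∀ (y x : ℝ), y < x → ∀ u v : ℝ → ℝ≥0∞, Measurable u → Measurable v →
      (∀ t ∈ Ioo y x, 0 < u t) → ∫⁻ t in Ioo y x, u t ≠ ∞ → (∀ t < x, Vr r v y t ≠ ∞) →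
      ∀ K : ℝ≥0∞, (∀ f : ℝ → ℝ≥0∞, Measurable f → ∫⁻ s, f s ≤ 1 →
        ∫⁻ t in Ioo y x, (∫⁻ s in Ioo y t, f s ^ r * v s) ^ (q / r) * u t ≤ K) →
      ∫⁻ t in Ioo y x, (∫⁻ s in Ioo t x, u s) ^ (q / (1 - q)) * u t * Vr r v y t ^ (q / (1 - q)) ≤
        κ * K ^ (1 / (1 - q)) := by
  obtain ⟨κ, hκ, hlow⟩ := exists_lintegral_le_of_dyadic hq hq1 one_pos
  have hq1' : 0 < 1 - q := sub_pos.2 hq1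
  have h2 : (2 : ℝ≥0∞) * 2 ^ q ≠ ∞ :=
    ENNReal.mul_ne_top (by simp) (ENNReal.rpow_ne_top_of_nonneg hq.le (by simp))
  refine ⟨κ * (2 * 2 ^ q) ^ (1 / (1 - q)), ENNReal.mul_lt_top hκ
    (ENNReal.rpow_lt_top_of_nonneg (by positivity) h2), ?_⟩
  intro y x hyx u v hu hv hupos hufin hV K hK
  obtain ⟨t, ht⟩ := exists_isDyadicSeq hu hyx hupos hufin
  rw [mul_assoc, ← ENNReal.mul_rpow_of_nonneg _ _ (by positivity : 0 ≤ 1 / (1 - q))]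
  have key := hlow y x u hu hufin t ht (fun s => Vr r v y s) (fun m => Vr r v y (t m)) ?_
    (2 * 2 ^ q * K) ?_
  · simpa only [one_mul] using key
  · intro m s hs
    simp only [ENNReal.rpow_one]
    exact (Vr_mono hr0 hr1 le_rfl hs.2.le).trans (Finset.single_le_sum
      (f := fun j => Vr r v y (t j)) (fun _ _ => zero_le) (Finset.self_mem_range_succ (m + 1)))
  · intro γ hγ
    simp only [ENNReal.rpow_one] at hγ
    choose f hf hf0 hf1 hfV using fun m => exists_half_Vr_le hr0 hr1 hv (hV (t m) (ht.lt m))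
    have hF := hK (fun s => ∑' m, γ m * f m s) (Measurable.tsum fun m => (hf m).const_mul _) (by
      rw [lintegral_tsum fun m => ((hf m).const_mul _).aemeasurable]
      simp_rw [lintegral_const_mul _ (hf _)]
      refine le_trans (ENNReal.tsum_le_tsum fun m => ?_) hγ
      exact (mul_le_mul_right (hf1 m) _).trans_eq (mul_one _))
    rw [ht.lintegral_eq_tsum] at hF
    calc _ ≤ ∑' m, 2 * 2 ^ q * ∫⁻ s in Ioo (t m) (t (m + 1)),
          (∫⁻ σ in Ioo y s, (∑' m, γ m * f m σ) ^ r * v σ) ^ (q / r) * u s := by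
          refine ENNReal.tsum_le_tsum fun m => ?_
          have hle : ((γ m) ^ r * (Vr r v y (t m) / 2) ^ r) ^ (q / r) *
              ∫⁻ s in Ioo (t m) (t (m + 1)), u s ≤ ∫⁻ s in Ioo (t m) (t (m + 1)),
              (∫⁻ σ in Ioo y s, (∑' m, γ m * f m σ) ^ r * v σ) ^ (q / r) * u s := by
            rw [← lintegral_const_mul _ hu]
            refine setLIntegral_mono' measurableSet_Ioo fun s hs => ?_
            gcongr
            calc _ ≤ γ m ^ r * ∫⁻ σ in Ioo y (t m), f m σ ^ r * v σ := by
                  gcongr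
                  exact hfV m
              _ = ∫⁻ σ in Ioo y (t m), γ m ^ r * (f m σ ^ r * v σ) :=
                  (lintegral_const_mul _ (((hf m).pow_const _).mul hv)).symm
              _ ≤ ∫⁻ σ in Ioo y s, γ m ^ r * (f m σ ^ r * v σ) :=
                  lintegral_mono_set (Ioo_subset_Ioo_right hs.1.le)
              _ ≤ _ := by
                  refine lintegral_mono fun σ => ?_
                  rw [← mul_assoc, ← ENNReal.mul_rpow_of_nonneg _ _ hr0.le]
                  gcongr
                  exact ENNReal.le_tsum (f := fun m => γ m * f m σ) m
          refine le_trans (le_of_eq ?_) (mul_le_mul_right hle _)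
          rw [ht.mass_block hufin, ← ENNReal.mul_rpow_of_nonneg _ _ hr0.le, ← ENNReal.rpow_mul,
            mul_div_cancel₀ _ hr0.ne', ENNReal.mul_rpow_of_nonneg _ _ hq.le,
            ENNReal.div_rpow_of_nonneg _ _ hq.le, mul_half_pow_succ]
          have h2q : (2 : ℝ≥0∞) ^ q * (Vr r v y (t m) ^ q / 2 ^ q) = Vr r v y (t m) ^ q :=
            ENNReal.mul_div_cancel (by simp) (ENNReal.rpow_ne_top_of_nonneg hq.le (by simp))
          nth_rewrite 1 [← h2q]
          ring
      _ ≤ 2 * 2 ^ q * K := by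
          rw [ENNReal.tsum_mul_left]
          gcongr

theorem ennreal_const_mul_tsum_rpow_le {r : ℝ} (hr : 0 ≤ r) (c f : ℕ → ℝ≥0∞) (l : ℕ) :
    c l ^ r * f l ^ r ≤ (∑' m, c m * f m) ^ r := by
  rw [← ENNReal.mul_rpow_of_nonneg _ _ hr]
  gcongr
  exact ENNReal.le_tsum (f := fun m => c m * f m) l

theorem exists_tsum_shifted_block_le {p q r : ℝ} (hq : 0 < q) (hqp : q < p) (hr0 : 0 < r) :
    ∃ κ : ℝ≥0∞, κ < ∞ ∧ ∀ (a b z : ℝ), z ∈ Ioo a b → ∀ u v w : ℝ → ℝ≥0∞,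
      Measurable u → Measurable v → Measurable w → ∫⁻ s in Ioo z b, w s ≠ 0 →
      ∫⁻ s in Ioo z b, w s ≠ ∞ → ∀ x : ℕ → ℝ, IsDyadicSeq w z b x →
      ∀ C : ℝ≥0∞, CesCesIneq a b r p q u v w C → ∀ (n : ℕ) (f : ℕ → ℝ → ℝ≥0∞),
      (∀ j, Measurable (f j)) → (∀ j, ∫⁻ s, f j s ≤ 1) →
      ∑' j, ((2⁻¹ ^ (j + 1) * ∫⁻ s in Ioo z b, w s) ^ (-(q / p)) *
        ∫⁻ t in Ioo (x (j + n)) (x (j + n + 1)),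
          (∫⁻ s in Ioo (x j) t, f j s ^ r * v s) ^ (q / r) * u t) ^ (p / (p - q)) ≤
        κ * C ^ (p * q / (p - q)) := by
  have hp := hq.trans hqp
  have hpq := sub_pos.2 hqp
  have hs : 0 < q / r := div_pos hq hr0
  have hτ : 0 < p / (p - q) := div_pos hp hpq
  have hqp' : 0 < q / p := div_pos hq hp
  obtain ⟨κ, hκ, hnorm⟩ := exists_lintegral_tsum_le hp
  have h2κ : (κ * 2) ^ (q / p) ≠ ∞ := ENNReal.rpow_ne_top_of_nonneg hqp'.le
    (ENNReal.mul_ne_top hκ.ne (by simp))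
  refine ⟨((κ * 2) ^ (q / p)) ^ (p / (p - q)), ENNReal.rpow_lt_top_of_nonneg hτ.le h2κ, ?_⟩
  intro a b z hz u v w hu hv hw hw0 hwfin x hx C hC n f hf hf1
  set M := ∫⁻ s in Ioo z b, w s with hM
  have hm0 : ∀ j : ℕ, (2⁻¹ : ℝ≥0∞) ^ (j + 1) * M ≠ 0 := fun j =>
    mul_ne_zero (pow_ne_zero _ (by simp)) hw0
  have hmt : ∀ j : ℕ, (2⁻¹ : ℝ≥0∞) ^ (j + 1) * M ≠ ∞ := fun j =>
    ENNReal.mul_ne_top (ENNReal.pow_ne_top (by simp)) hwfin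
  suffices hdual : ∀ γ : ℕ → ℝ≥0∞, ∑' j, γ j ^ p ≤ 1 →
      ∑' j, ((2⁻¹ ^ (j + 1) * M) ^ (-(q / p)) * ∫⁻ t in Ioo (x (j + n)) (x (j + n + 1)),
          (∫⁻ s in Ioo (x j) t, f j s ^ r * v s) ^ (q / r) * u t) * γ j ^ q ≤
        (κ * 2) ^ (q / p) * C ^ q by
    refine (tsum_rpow_le_of_forall_tsum_rpow_le_one hq hqp _ _ hdual).trans_eq ?_
    rw [ENNReal.mul_rpow_of_nonneg _ _ hτ.le, ← ENNReal.rpow_mul C]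
    congr 2
    ring
  intro γ hγ
  set c : ℕ → ℝ≥0∞ := fun j => γ j * (2⁻¹ ^ (j + 1) * M) ^ (-(1 / p)) with hc
  set g : ℕ → ℝ → ℝ≥0∞ := fun j => (Ioi (x j)).indicator (f j) with hg
  have hgm : ∀ j, Measurable (g j) := fun j => (hf j).indicator measurableSet_Ioi
  have hN := hnorm a b z hz w hw hwfin x hx g hgm
    (fun j => (lintegral_mono (indicator_le_self _ _)).trans (hf1 j))
    (fun j s hs => indicator_of_notMem
      (fun h => absurd (hs.trans (hx.strictMono.monotone (by omega))) (not_le.2 h)) _) c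
  have hS : ∑' l, (2⁻¹ ^ l * M) * c l ^ p ≤ 2 := by
    calc _ = ∑' l, 2 * γ l ^ p := by
          refine tsum_congr fun l => ?_
          rw [hc]
          simp only
          rw [ENNReal.mul_rpow_of_nonneg _ _ hp.le, ← ENNReal.rpow_mul, mul_half_pow_succ,
            show -(1 / p) * p = -1 by field_simp, ENNReal.rpow_neg_one]
          have := ENNReal.mul_inv_cancel (hm0 l) (hmt l)
          calc _ = 2 * γ l ^ p * ((2⁻¹ ^ (l + 1) * M) * (2⁻¹ ^ (l + 1) * M)⁻¹) := by ring
            _ = _ := by rw [this, mul_one]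
      _ ≤ 2 * 1 := by
          rw [ENNReal.tsum_mul_left]
          gcongr
      _ = 2 := mul_one _
  have hT := hC.lintegral_le hq (f := fun s => ∑' l, c l * g l s)
    (Measurable.tsum fun l => (hgm l).const_mul _)
  calc _ ≤ ∑' j, ∫⁻ t in Ioo (x (j + n)) (x (j + n + 1)),
        (∫⁻ s in Ioo a t, (∑' l, c l * g l s) ^ r * v s) ^ (q / r) * u t := by
        refine ENNReal.tsum_le_tsum fun j => ?_
        have hcq : c j ^ q = (2⁻¹ ^ (j + 1) * M) ^ (-(q / p)) * γ j ^ q := by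
          rw [hc]
          simp only
          rw [ENNReal.mul_rpow_of_nonneg _ _ hq.le, ← ENNReal.rpow_mul, mul_comm]
          congr 2
          field_simp
        have hmeas : Measurable fun t =>
            (∫⁻ s in Ioo (x j) t, f j s ^ r * v s) ^ (q / r) * u t :=
          ((monotone_lintegral_Ioo_right _ _).measurable.pow_const _).mul hu
        rw [mul_right_comm, ← hcq, ← lintegral_const_mul _ hmeas]
        refine setLIntegral_mono' measurableSet_Ioo fun t ht => ?_
        rw [← mul_assoc]
        gcongr
        calc _ = (c j ^ r * ∫⁻ s in Ioo (x j) t, f j s ^ r * v s) ^ (q / r) := by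
              rw [ENNReal.mul_rpow_of_nonneg _ _ hs.le, ← ENNReal.rpow_mul,
                mul_div_cancel₀ _ hr0.ne']
          _ ≤ _ := by
              gcongr
              have hfv : Measurable fun s => f j s ^ r * v s := ((hf j).pow_const _).mul hv
              rw [← lintegral_const_mul _ hfv]
              calc _ ≤ ∫⁻ s in Ioo (x j) t, (∑' l, c l * g l s) ^ r * v s := by
                    refine setLIntegral_mono' measurableSet_Ioo fun s hs => ?_
                    rw [← mul_assoc]
                    gcongr
                    refine le_trans ?_ (ennreal_const_mul_tsum_rpow_le hr0.le c (fun l => g l s) j)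
                    rw [hg]
                    simp only
                    rw [indicator_of_mem (show s ∈ Ioi (x j) from hs.1)]
                _ ≤ _ := lintegral_mono_set (Ioo_subset_Ioo_left (hz.1.le.trans (hx.le j)))
    _ ≤ ∑' j, ∫⁻ t in Ioo (x j) (x (j + 1)),
        (∫⁻ s in Ioo a t, (∑' l, c l * g l s) ^ r * v s) ^ (q / r) * u t :=
        ENNReal.tsum_comp_le_tsum_of_injective (add_left_injective n) fun j =>
          ∫⁻ t in Ioo (x j) (x (j + 1)),
            (∫⁻ s in Ioo a t, (∑' l, c l * g l s) ^ r * v s) ^ (q / r) * u t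
    _ = ∫⁻ t in Ioo z b,
        (∫⁻ s in Ioo a t, (∑' l, c l * g l s) ^ r * v s) ^ (q / r) * u t :=
        (hx.lintegral_eq_tsum _).symm
    _ ≤ _ := lintegral_mono_set (Ioo_subset_Ioo_left hz.1.le)
    _ ≤ _ := hT
    _ ≤ C ^ q * (κ * 2) ^ (q / p) := by
        gcongr
        exact hN.trans (by gcongr)
    _ = _ := mul_comm _ _

theorem Vr_ne_top_of_Vr_mul_le {a b p q r : ℝ} (hr0 : 0 < r) (hr1 : r ≤ 1) (hp : 0 < p)
    (hq : 0 < q) {u v w : ℝ → ℝ≥0∞} (hu : IsWeight a b u)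
    (hW : ∀ x ∈ Ioo a b, 0 < (∫⁻ t in Ioo x b, w t) ∧ (∫⁻ t in Ioo x b, w t) < ∞)
    {C : ℝ≥0∞} (hC : C ≠ ∞)
    (h : ∀ x t, a < x → x < t → t < b → Vr r v x t * (∫⁻ s in Ioo t b, u s) ^ (1 / q) ≤
      C * (∫⁻ s in Ioo x b, w s) ^ (1 / p)) {x t : ℝ} (hax : a < x) (htb : t < b) :
    Vr r v x t ≠ ∞ := by
  rcases le_or_gt t x with htx | hxt
  · simp [Vr_eq_zero hr0 hr1 htx]
  intro htop
  have h1 := h x t hax hxt htb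
  have hU : 0 < ∫⁻ s in Ioo t b, u s :=
    lintegral_Ioo_pos hu.1 htb fun s hs => (hu.2 s ⟨(hax.trans hxt).trans hs.1, hs.2⟩).1
  rw [htop, ENNReal.top_mul (by
    rw [Ne, ENNReal.rpow_eq_zero_iff]
    simp [hU.ne', hq.le]), top_le_iff] at h1
  exact ENNReal.mul_ne_top hC (ENNReal.rpow_ne_top_of_nonneg (by positivity)
    (hW x ⟨hax, hxt.trans htb⟩).2.ne) h1

theorem IsDyadicSeq.lintegral_Ioo_eq_sum {φ : ℝ → ℝ≥0∞} {z b : ℝ} {x : ℕ → ℝ}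
    (hx : IsDyadicSeq φ z b x) (g : ℝ → ℝ≥0∞) (j n : ℕ) :
    ∫⁻ s in Ioo (x j) (x (j + n)), g s =
      ∑ d ∈ Finset.range n, ∫⁻ s in Ioo (x (j + d)) (x (j + d + 1)), g s := by
  induction n with
  | zero => simp
  | succ n ih =>
    rw [Finset.sum_range_succ, ← ih, ← add_assoc]
    exact lintegral_Ioo_split g (hx.strictMono.monotone (by omega)) (hx.lt_succ _).le

theorem exists_C₅_le {p q r : ℝ} (hq : 0 < q) (hqp : q < p) (hq1 : q < 1) (hr0 : 0 < r)
    (hr1 : r ≤ 1) :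
    ∃ κ : ℝ≥0∞, κ < ∞ ∧ ∀ (a b : ℝ), a < b → ∀ u v w : ℝ → ℝ≥0∞,
      IsWeight a b u → IsWeight a b v → IsWeight a b w →
      (∀ x ∈ Ioo a b, 0 < (∫⁻ t in Ioo x b, w t) ∧ (∫⁻ t in Ioo x b, w t) < ∞) →
      ∀ C : ℝ≥0∞, C ≠ ∞ → CesCesIneq a b r p q u v w C → C₅ a b r p q u v w ≤ κ * C := by
  have hp := hq.trans hqp
  have hpq := sub_pos.2 hqp
  have hq1' := sub_pos.2 hq1
  have hτ : 0 < p / (p - q) := div_pos hp hpq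
  have hα : 0 < p * q / (p - q) := div_pos (mul_pos hp hq) hpq
  obtain ⟨κ₁, hκ₁, htest⟩ := exists_lintegral_le_of_forall_test hq hq1 hr0 hr1
  obtain ⟨κ₂, hκ₂, hshift⟩ := exists_tsum_shifted_block_le hq hqp hr0
  obtain ⟨κ₃, hκ₃, hgeo⟩ := exists_tsum_geometric_mul_rpow_sum_le hτ (ρ := 2⁻¹) (by simp) (by simp)
  set σ := p * (1 - q) / (p - q) with hσ
  have hσ0 : 0 < σ := by positivity
  have hκ₁σ : κ₁ ^ σ < ∞ := ENNReal.rpow_lt_top_of_nonneg hσ0.le hκ₁.ne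
  set κ : ℝ≥0∞ := κ₁ ^ σ * (κ₃ * (2 * (2 * κ₂))) with hκ
  have hκt : κ < ∞ := ENNReal.mul_lt_top hκ₁σ (ENNReal.mul_lt_top hκ₃ (ENNReal.mul_lt_top (by simp)
    (ENNReal.mul_lt_top (by simp) hκ₂)))
  refine ⟨κ ^ (p * q / (p - q))⁻¹, ENNReal.rpow_lt_top_of_nonneg (by positivity) hκt.ne, ?_⟩
  intro a b hab u v w hu hv hw hW C hCt hC
  have hVU : ∀ x t, a < x → x < t → t < b → Vr r v x t * (∫⁻ s in Ioo t b, u s) ^ (1 / q) ≤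
      C * (∫⁻ s in Ioo x b, w s) ^ (1 / p) := fun x t h1 h2 h3 =>
    hC.Vr_mul_le hr0 hr1 hp hq hu.1 hv.1 h1 h2 h3
  suffices hmain : C₅ a b r p q u v w ^ (p * q / (p - q)) ≤ κ * C ^ (p * q / (p - q)) by
    rw [← ENNReal.rpow_le_rpow_iff hα, ENNReal.mul_rpow_of_nonneg _ _ hα.le, ← ENNReal.rpow_mul,
      inv_mul_cancel₀ hα.ne', ENNReal.rpow_one]
    exact hmain
  rw [C₅_rpow hq hqp]
  set E : ℝ → ℝ → ℝ≥0∞ := fun y x => ∫⁻ t in Ioo y x,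
    (∫⁻ s in Ioo t x, u s) ^ (q / (1 - q)) * u t * Vr r v y t ^ (q / (1 - q)) with hE
  have hq2 : 0 < q / (1 - q) := by positivity
  have hEmono : ∀ y y' x x', y' ≤ y → x ≤ x' → E y x ≤ E y' x' := by
    intro y y' x x' hy hx
    refine le_trans ?_ (lintegral_mono_set (Ioo_subset_Ioo hy hx))
    refine setLIntegral_mono' measurableSet_Ioo fun t ht => ?_
    gcongr ?_ ^ _ * _ * ?_ ^ _
    · exact monotone_lintegral_Ioo_right _ _ hx
    · exact Vr_mono hr0 hr1 hy le_rfl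
  set T : ℝ → ℝ → ℝ≥0∞ := fun y x => (∫⁻ s in Ioo y b, w s) ^ (-(p / (p - q))) * E y x ^ σ with hT
  have hTmono : ∀ y, Monotone (T y) := fun y x x' hx => by
    simp only [hT]
    gcongr
    exact hEmono _ _ _ _ le_rfl hx
  have hSmono : ∀ z, Monotone fun x => ⨆ y ∈ Ico z x, T y x := fun z x x' hx =>
    iSup₂_le fun y hy => (hTmono y hx).trans (le_iSup₂_of_le y ⟨hy.1, hy.2.trans_le hx⟩ le_rfl)
  refine lintegral_Ioo_le_of_forall_truncation hab
    (F := fun z x => w x * ⨆ y ∈ Ico z x, T y x)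
    (fun z => hw.1.mul (hSmono z).measurable) (fun x z z' hz => ?_) (fun x hx c hc => ?_)
    fun z hz => ?_
  · simp only
    gcongr w x * ?_
    exact biSup_mono fun y (hy : y ∈ Ico z' x) => ⟨hz.trans hy.1, hy.2⟩
  · simp only [ENNReal.mul_iSup, lt_iSup_iff] at hc
    obtain ⟨y, hy, hcy⟩ := hc
    exact ⟨y, hy, hcy.trans_le (by
      gcongr
      exact le_iSup₂ (f := fun y' _ => T y' x) y ⟨le_rfl, hy.2⟩)⟩
  obtain ⟨x, hx⟩ := exists_isDyadicSeq hw.1 hz.2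
    (fun t ht => (hw.2 t ⟨hz.1.trans ht.1, ht.2⟩).1) (hW z hz).2.ne
  set M := ∫⁻ s in Ioo z b, w s with hM
  have hM0 : M ≠ 0 := (hW z hz).1.ne'
  have hMt : M ≠ ∞ := (hW z hz).2.ne
  have hax : ∀ j, a < x j := fun j => hz.1.trans_le (hx.le j)
  have hm0 : ∀ j : ℕ, (2⁻¹ : ℝ≥0∞) ^ (j + 1) * M ≠ 0 := fun j =>
    mul_ne_zero (pow_ne_zero _ (by simp)) hM0
  have hmt : ∀ j : ℕ, (2⁻¹ : ℝ≥0∞) ^ (j + 1) * M ≠ ∞ := fun j =>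
    ENNReal.mul_ne_top (ENNReal.pow_ne_top (by simp)) hMt
  set ι := {f : ℝ → ℝ≥0∞ // Measurable f ∧ ∫⁻ s, f s ≤ 1} with hι
  have : Nonempty ι := ⟨⟨fun _ => 0, measurable_const, by simp⟩⟩
  set φ : ℕ → ℕ → ι → ℝ≥0∞ := fun j n f => ∫⁻ t in Ioo (x (j + n)) (x (j + n + 1)),
    (∫⁻ s in Ioo (x j) t, f.1 s ^ r * v s) ^ (q / r) * u t with hφ
  set β : ℕ → ℕ → ℝ≥0∞ := fun j n => ⨆ f, φ j n f with hβ
  have hEβ : ∀ j n, E (x j) (x (j + n + 1)) ^ σ ≤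
      κ₁ ^ σ * (∑ d ∈ Finset.range (n + 1), β j d) ^ (p / (p - q)) := by
    intro j n
    have h1 := htest (x j) (x (j + n + 1)) (hx.strictMono (by omega)) u v hu.1 hv.1
      (fun t ht => (hu.2 t ⟨(hax j).trans ht.1, ht.2.trans (hx.lt _)⟩).1)
      (ne_top_of_le_ne_top (lintegral_Ioo_ne_top_of_Vr_mul_le hr0 hr1 hp hq hv hW hCt hVU
        ⟨hax j, hx.lt j⟩) (lintegral_mono_set (Ioo_subset_Ioo_right (hx.lt _).le)))
      (fun t ht => Vr_ne_top_of_Vr_mul_le hr0 hr1 hp hq hu hW hCt hVU (hax j)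
        (ht.trans (hx.lt _)))
      (∑ d ∈ Finset.range (n + 1), β j d) (fun f hf hf1 => by
        rw [add_assoc, hx.lintegral_Ioo_eq_sum]
        exact Finset.sum_le_sum fun d _ => le_iSup (φ j d) ⟨f, hf, hf1⟩)
    calc _ ≤ (κ₁ * (∑ d ∈ Finset.range (n + 1), β j d) ^ (1 / (1 - q))) ^ σ := by gcongr
      _ = _ := by
        rw [ENNReal.mul_rpow_of_nonneg _ _ hσ0.le, ← ENNReal.rpow_mul, hσ]
        congr 2
        field_simp
  set m : ℕ → ℝ≥0∞ := fun j => 2⁻¹ ^ (j + 1) * M with hm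
  have hSle : ∀ k, ∀ t ∈ Ioo (x k) (x (k + 1)), ⨆ y ∈ Ico z t, T y t ≤
      ∑ j ∈ Finset.range (k + 1), m j ^ (-(p / (p - q))) * E (x j) (x (k + 1)) ^ σ := by
    intro k t ht
    refine iSup₂_le fun y hy => ?_
    have htb : t < b := ht.2.trans (hx.lt _)
    obtain ⟨j, hj⟩ := hx.exists_mem y ⟨hy.1, hy.2.trans htb⟩
    have hjk : j < k + 1 := hx.strictMono.lt_iff_lt.1 (hj.1.trans_lt (hy.2.trans ht.2))
    refine le_trans ?_ (Finset.single_le_sum (f := fun j => m j ^ (-(p / (p - q))) *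
      E (x j) (x (k + 1)) ^ σ) (fun _ _ => zero_le) (Finset.mem_range.2 hjk))
    simp only [hT, hm]
    gcongr ?_ * ?_ ^ _
    · rw [ENNReal.rpow_neg, ENNReal.rpow_neg, ← hx.mass]
      gcongr
      exact hj.2.le
    · exact hEmono _ _ _ _ hj.1 ht.2.le
  have hinner : ∀ n, ∑' j, (m j ^ (-(q / p)) * β j n) ^ (p / (p - q)) ≤
      2 * (κ₂ * C ^ (p * q / (p - q))) := by
    intro n
    have hiS : ∀ j, (m j ^ (-(q / p)) * β j n) ^ (p / (p - q)) =
        ⨆ f, (m j ^ (-(q / p)) * φ j n f) ^ (p / (p - q)) := by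
      intro j
      rw [hβ]
      simp only [ENNReal.mul_iSup]
      exact (ENNReal.orderIsoRpow _ hτ).map_iSup _
    simp_rw [hiS]
    refine tsum_iSup_le_two_mul _ _ fun g => ?_
    exact hshift a b z hz u v w hu.1 hv.1 hw.1 hM0 hMt x hx C hC n (fun j => (g j).1)
      (fun j => (g j).2.1) (fun j => (g j).2.2)
  calc ∫⁻ t in Ioo z b, w t * ⨆ y ∈ Ico z t, T y t
      = ∑' k, ∫⁻ t in Ioo (x k) (x (k + 1)), w t * ⨆ y ∈ Ico z t, T y t :=
        hx.lintegral_eq_tsum _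
    _ ≤ ∑' k, ∑ j ∈ Finset.range (k + 1), κ₁ ^ σ * (2⁻¹ ^ (k + 1) * M * (m j ^ (-(p / (p - q))) *
          (∑ d ∈ Finset.range (k - j + 1), β j d) ^ (p / (p - q)))) := by
        refine ENNReal.tsum_le_tsum fun k => ?_
        calc _ ≤ ∫⁻ t in Ioo (x k) (x (k + 1)), w t *
              ∑ j ∈ Finset.range (k + 1), m j ^ (-(p / (p - q))) * E (x j) (x (k + 1)) ^ σ := by
              refine setLIntegral_mono' measurableSet_Ioo fun t ht => ?_
              gcongr
              exact hSle k t ht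
          _ = 2⁻¹ ^ (k + 1) * M *
              ∑ j ∈ Finset.range (k + 1), m j ^ (-(p / (p - q))) * E (x j) (x (k + 1)) ^ σ := by
              rw [lintegral_mul_const _ hw.1, hx.mass_block hMt]
          _ ≤ _ := by
              rw [Finset.mul_sum]
              refine Finset.sum_le_sum fun j hj => ?_
              have hjk : j + (k - j) = k := by
                have := Finset.mem_range.1 hj
                omega
              calc _ ≤ 2⁻¹ ^ (k + 1) * M * (m j ^ (-(p / (p - q))) * (κ₁ ^ σ *
                    (∑ d ∈ Finset.range (k - j + 1), β j d) ^ (p / (p - q)))) := by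
                    gcongr _ * (_ * ?_)
                    have := hEβ j (k - j)
                    rwa [hjk] at this
                _ = _ := by ring
    _ = ∑' j, ∑' n, κ₁ ^ σ * (2⁻¹ ^ (j + n + 1) * M * (m j ^ (-(p / (p - q))) *
          (∑ d ∈ Finset.range (n + 1), β j d) ^ (p / (p - q)))) := by
        rw [← tsum_range_succ_sub]
        refine tsum_congr fun k => Finset.sum_congr rfl fun j hj => ?_
        have hjk : j + (k - j) = k := by
          have := Finset.mem_range.1 hj
          omega
        rw [hjk]
    _ = κ₁ ^ σ * ∑' j, m j ^ (1 - p / (p - q)) * ∑' n, 2⁻¹ ^ n *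
          (∑ d ∈ Finset.range (n + 1), β j d) ^ (p / (p - q)) := by
        rw [← ENNReal.tsum_mul_left]
        refine tsum_congr fun j => ?_
        rw [← mul_assoc, ← ENNReal.tsum_mul_left]
        refine tsum_congr fun n => ?_
        rw [sub_eq_add_neg 1, ENNReal.rpow_add (x := m j) _ _ (hm0 j) (hmt j), ENNReal.rpow_one]
        simp only [hm]
        rw [show j + n + 1 = (j + 1) + n by ring, pow_add]
        ring
    _ ≤ κ₁ ^ σ * ∑' j, m j ^ (1 - p / (p - q)) * (κ₃ * ∑' n, 2⁻¹ ^ n *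
          β j n ^ (p / (p - q))) := by
        gcongr with j
        exact hgeo _
    _ = κ₁ ^ σ * (κ₃ * ∑' n, 2⁻¹ ^ n * ∑' j, (m j ^ (-(q / p)) * β j n) ^ (p / (p - q))) := by
        congr 1
        simp_rw [← ENNReal.tsum_mul_left]
        rw [ENNReal.tsum_comm]
        refine tsum_congr fun n => tsum_congr fun j => ?_
        rw [ENNReal.mul_rpow_of_nonneg _ _ hτ.le, ← ENNReal.rpow_mul,
          show -(q / p) * (p / (p - q)) = 1 - p / (p - q) by field_simp; ring]
        ring
    _ ≤ κ₁ ^ σ * (κ₃ * ∑' n : ℕ, 2⁻¹ ^ n * (2 * (κ₂ * C ^ (p * q / (p - q))))) := by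
        gcongr with n
        exact hinner n
    _ = κ * C ^ (p * q / (p - q)) := by
        rw [ENNReal.tsum_mul_right, ENNReal.tsum_geometric, ENNReal.one_sub_inv_two, inv_inv, hκ]
        ring

theorem exists_sum_range_tail_rpow_le {σ s : ℝ} (hσ : 0 < σ) (hs : 0 < s) :
    ∃ κ : ℝ≥0∞, κ < ∞ ∧ ∀ M : ℝ≥0∞, M ≠ 0 → M ≠ ∞ → ∀ (d : ℕ → ℝ≥0∞) (i : ℕ),
      ∑ l ∈ Finset.range (i + 1), (2⁻¹ ^ l * M) ^ (-σ) * (∑ k ∈ Finset.Ico l (i + 1), d k) ^ s ≤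
        κ * ∑ l ∈ Finset.range (i + 1), (2⁻¹ ^ l * M) ^ (-σ) * d l ^ s := by
  have hρ0 : (2⁻¹ : ℝ≥0∞) ^ σ ≠ 0 := by simp
  obtain ⟨κ, hκ, hgeo⟩ := exists_tsum_geometric_mul_rpow_sum_le hs hρ0
    (ENNReal.rpow_lt_one (by simp) hσ)
  refine ⟨κ, hκ, fun M hM0 hMt d i => ?_⟩
  set ρ : ℝ≥0∞ := 2⁻¹ ^ σ with hρ
  have hm0 : ∀ j : ℕ, (2⁻¹ : ℝ≥0∞) ^ j * M ≠ 0 := fun j =>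
    mul_ne_zero (pow_ne_zero _ (by simp)) hM0
  have hmass : ∀ j ≤ i, (2⁻¹ ^ (i - j) * M) ^ (-σ) = (2⁻¹ ^ i * M) ^ (-σ) * ρ ^ j := by
    intro j hj
    have h1 : (2⁻¹ : ℝ≥0∞) ^ i * M = 2⁻¹ ^ j * (2⁻¹ ^ (i - j) * M) := by
      rw [← mul_assoc, ← pow_add]
      congr 2
      omega
    have h2 : ((2⁻¹ : ℝ≥0∞) ^ j) ^ (-σ) * ρ ^ j = 1 := by
      rw [hρ, ← ennreal_pow_rpow, ← ENNReal.rpow_add _ _ (pow_ne_zero _ (by simp))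
        (ENNReal.pow_ne_top (by simp))]
      simp
    rw [h1, ENNReal.mul_rpow_of_ne_zero (pow_ne_zero _ (by simp)) (hm0 _), mul_right_comm, h2,
      one_mul]
  set d' : ℕ → ℝ≥0∞ := fun j => if j ≤ i then d (i - j) else 0 with hd'
  have hinner : ∀ j ≤ i, ∑ k ∈ Finset.Ico (i - j) (i + 1), d k =
      ∑ m ∈ Finset.range (j + 1), d' m := by
    intro j hj
    refine Finset.sum_nbij' (fun k => i - k) (fun m => i - m) ?_ ?_ ?_ ?_ ?_
    · intro k hk
      rw [Finset.mem_Ico] at hk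
      rw [Finset.mem_range]
      omega
    · intro k hk
      rw [Finset.mem_range] at hk
      rw [Finset.mem_Ico]
      omega
    · intro k hk
      rw [Finset.mem_Ico] at hk
      omega
    · intro k hk
      rw [Finset.mem_range] at hk
      omega
    · intro k hk
      rw [Finset.mem_Ico] at hk
      simp only [hd']
      rw [if_pos (by omega)]
      congr 1
      omega
  rw [← Finset.sum_range_reflect, ← Finset.sum_range_reflect (fun l => _ * d l ^ s)]
  simp only [Nat.add_sub_cancel]
  calc _ = (2⁻¹ ^ i * M) ^ (-σ) *
        ∑ j ∈ Finset.range (i + 1), ρ ^ j * (∑ m ∈ Finset.range (j + 1), d' m) ^ s := by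
        rw [Finset.mul_sum]
        refine Finset.sum_congr rfl fun j hj => ?_
        have hji := Nat.lt_succ_iff.1 (Finset.mem_range.1 hj)
        rw [hmass j hji, hinner j hji, mul_assoc]
    _ ≤ (2⁻¹ ^ i * M) ^ (-σ) * (κ * ∑' j, ρ ^ j * d' j ^ s) := by
        gcongr _ * ?_
        exact (ENNReal.sum_le_tsum _).trans (hgeo d')
    _ = _ := by
        rw [mul_left_comm, tsum_eq_sum (s := Finset.range (i + 1)) fun j hj => ?_]
        · rw [Finset.mul_sum]
          congr 1
          refine Finset.sum_congr rfl fun j hj => ?_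
          have hji := Nat.lt_succ_iff.1 (Finset.mem_range.1 hj)
          rw [hmass j hji, mul_assoc]
          simp only [hd', if_pos hji]
        · simp only [hd', if_neg (fun h : j ≤ i => hj (Finset.mem_range.2 (Nat.lt_succ_of_le h)))]
          simp [hs]

theorem Vr_rpow_le_sum_Ico {r ϱ : ℝ} (hϱ : 0 < ϱ) (hr0 : 0 < r) (hr1 : r ≤ 1)
    (h : ∀ (v : ℝ → ℝ≥0∞) (x y z : ℝ), x ≤ y → y ≤ z →
      Vr r v x z ^ ϱ ≤ Vr r v x y ^ ϱ + Vr r v y z ^ ϱ)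
    (v : ℝ → ℝ≥0∞) {y : ℕ → ℝ} (hy : Monotone y) {l i : ℕ} (hli : l ≤ i) :
    Vr r v (y l) (y i) ^ ϱ ≤ ∑ k ∈ Finset.Ico l i, Vr r v (y k) (y (k + 1)) ^ ϱ := by
  induction i, hli using Nat.le_induction with
  | base => simp [Vr_eq_zero hr0 hr1 le_rfl, hϱ]
  | succ i hli ih =>
    rw [Finset.sum_Ico_succ_top hli]
    exact (h v _ _ _ (hy hli) (hy (Nat.le_succ i))).trans (by gcongr)

theorem monotone_of_mem_Ico_succ {x y : ℕ → ℝ} (h0 : y 0 = x 0)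
    (h : ∀ i, y (i + 1) ∈ Ico (x i) (x (i + 1))) : Monotone y := by
  refine monotone_nat_of_le_succ fun n => ?_
  cases n with
  | zero => exact h0.trans_le (h 0).1
  | succ n => exact ((h n).2.le).trans (h (n + 1)).1

theorem exists_lintegral_mul_Vr_le {p r : ℝ} (hr0 : 0 < r) (hr1 : r ≤ 1) (hrp : r < p) :
    ∃ κ : ℝ≥0∞, κ < ∞ ∧ ∀ (z b : ℝ) (v w : ℝ → ℝ≥0∞), Measurable w →
      ∫⁻ s in Ioo z b, w s ≠ 0 → ∫⁻ s in Ioo z b, w s ≠ ∞ →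
      ∀ x : ℕ → ℝ, IsDyadicSeq w z b x → ∀ y : ℕ → ℝ, y 0 = x 0 →
      (∀ i, y (i + 1) ∈ Ico (x i) (x (i + 1))) → ∀ i,
      ∫⁻ s in Ioo z (y (i + 1)), (∫⁻ σ in Ioo s b, w σ) ^ (-(p / (p - r))) * w s *
          Vr r v s (y (i + 1)) ^ (p * r / (p - r)) ≤
        κ * ∑ l ∈ Finset.range (i + 1), (2⁻¹ ^ l * ∫⁻ s in Ioo z b, w s) ^ (-(r / (p - r))) *
          Vr r v (y l) (y (l + 1)) ^ (p * r / (p - r)) := by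
  have hp := hr0.trans hrp
  have hpr := sub_pos.2 hrp
  set β := p * r / (p - r) with hβ
  have hβ0 : 0 < β := by positivity
  have hσ : 0 < r / (p - r) := by positivity
  obtain ⟨ϱ, hϱ, hadd⟩ := exists_Vr_rpow_le_add hr0 hr1
  obtain ⟨κ, hκ, htail⟩ := exists_sum_range_tail_rpow_le hσ (div_pos hβ0 hϱ)
  have h2 : (2 : ℝ≥0∞) ^ (r / (p - r)) < ∞ := ENNReal.rpow_lt_top_of_nonneg hσ.le (by simp)
  refine ⟨2 ^ (r / (p - r)) * κ, ENNReal.mul_lt_top h2 hκ, ?_⟩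
  intro z b v w hw hM0 hMt x hx y hy0 hy i
  have hym := monotone_of_mem_Ico_succ hy0 hy
  set M := ∫⁻ s in Ioo z b, w s with hM
  have hyx : ∀ l, y l ≤ x l := by
    intro l
    cases l with
    | zero => exact hy0.le
    | succ l => exact (hy l).2.le
  have hm0 : ∀ j : ℕ, (2⁻¹ : ℝ≥0∞) ^ (j + 1) * M ≠ 0 := fun j =>
    mul_ne_zero (pow_ne_zero _ (by simp)) hM0
  have hmt : ∀ j : ℕ, (2⁻¹ : ℝ≥0∞) ^ (j + 1) * M ≠ ∞ := fun j =>
    ENNReal.mul_ne_top (ENNReal.pow_ne_top (by simp)) hMt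
  have hblock : ∀ l, ∫⁻ s in Ioo (x l) (x (l + 1)), (∫⁻ σ in Ioo s b, w σ) ^ (-(p / (p - r))) *
      w s * Vr r v s (y (i + 1)) ^ β ≤
      2 ^ (r / (p - r)) * (2⁻¹ ^ l * M) ^ (-(r / (p - r))) * Vr r v (y l) (y (i + 1)) ^ β := by
    intro l
    calc _ ≤ ∫⁻ s in Ioo (x l) (x (l + 1)), (2⁻¹ ^ (l + 1) * M) ^ (-(p / (p - r))) *
          w s * Vr r v (y l) (y (i + 1)) ^ β := by
          refine setLIntegral_mono' measurableSet_Ioo fun s hs => ?_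
          gcongr ?_ * _ * ?_ ^ _
          · rw [ENNReal.rpow_neg, ENNReal.rpow_neg, ← hx.mass]
            gcongr
            exact hs.2.le
          · exact Vr_mono hr0 hr1 ((hyx l).trans hs.1.le) le_rfl
      _ = (2⁻¹ ^ (l + 1) * M) ^ (-(p / (p - r))) * (2⁻¹ ^ (l + 1) * M) ^ (1 : ℝ) *
            Vr r v (y l) (y (i + 1)) ^ β := by
          rw [lintegral_mul_const _ (hw.const_mul _), lintegral_const_mul _ hw,
            hx.mass_block hMt, ENNReal.rpow_one]
      _ = _ := by
          rw [← ENNReal.rpow_add _ _ (hm0 l) (hmt l),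
            show -(p / (p - r)) + 1 = -(r / (p - r)) by field_simp; ring, mul_half_pow_succ l,
            ENNReal.mul_rpow_of_ne_zero (by simp) (hm0 l), ← mul_assoc,
            ← ENNReal.rpow_add _ _ (by simp) (by simp)]
          simp
  calc _ ≤ ∫⁻ s in Ioo (x 0) (x (0 + (i + 1))), (∫⁻ σ in Ioo s b, w σ) ^ (-(p / (p - r))) * w s *
          Vr r v s (y (i + 1)) ^ β := by
        refine lintegral_mono_set (Ioo_subset_Ioo hx.zero.le ?_)
        rw [zero_add]
        exact (hy i).2.le
    _ ≤ ∑ l ∈ Finset.range (i + 1), 2 ^ (r / (p - r)) * (2⁻¹ ^ l * M) ^ (-(r / (p - r))) *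
          Vr r v (y l) (y (i + 1)) ^ β := by
        rw [hx.lintegral_Ioo_eq_sum]
        refine Finset.sum_le_sum fun l _ => ?_
        rw [zero_add]
        exact hblock l
    _ = 2 ^ (r / (p - r)) * ∑ l ∈ Finset.range (i + 1), (2⁻¹ ^ l * M) ^ (-(r / (p - r))) *
          Vr r v (y l) (y (i + 1)) ^ β := by
        rw [Finset.mul_sum]
        exact Finset.sum_congr rfl fun l _ => mul_assoc _ _ _
    _ ≤ 2 ^ (r / (p - r)) * ∑ l ∈ Finset.range (i + 1), (2⁻¹ ^ l * M) ^ (-(r / (p - r))) *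
          (∑ k ∈ Finset.Ico l (i + 1), Vr r v (y k) (y (k + 1)) ^ ϱ) ^ (β / ϱ) := by
        gcongr _ * ?_
        refine Finset.sum_le_sum fun l hl => ?_
        gcongr _ * ?_
        calc _ = (Vr r v (y l) (y (i + 1)) ^ ϱ) ^ (β / ϱ) := by
              rw [← ENNReal.rpow_mul, mul_div_cancel₀ _ hϱ.ne']
          _ ≤ _ := by
              gcongr
              exact Vr_rpow_le_sum_Ico hϱ hr0 hr1 hadd v hym (Finset.mem_range.1 hl).le
    _ ≤ 2 ^ (r / (p - r)) * (κ * ∑ l ∈ Finset.range (i + 1), (2⁻¹ ^ l * M) ^ (-(r / (p - r))) *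
          (Vr r v (y l) (y (l + 1)) ^ ϱ) ^ (β / ϱ)) := by
        gcongr _ * ?_
        exact htail M hM0 hMt _ i
    _ = _ := by
        simp_rw [← ENNReal.rpow_mul, mul_div_cancel₀ _ hϱ.ne']
        ring

theorem tsum_ite_lintegral_Ioo_le {a : ℝ} {y : ℕ → ℝ} (hy : Monotone y) (hay : a ≤ y 0)
    (F : ℝ → ℝ≥0∞) (t : ℝ) :
    ∑' l, (if y (l + 1) ≤ t then ∫⁻ s in Ioo (y l) (y (l + 1)), F s else 0) ≤
      ∫⁻ s in Ioo a t, F s := by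
  have hdisj : Pairwise (Function.onFun Disjoint fun l => Ioo (y l) (y (l + 1)) ∩ Iio t) :=
    fun i j hij => (hy.pairwise_disjoint_on_Ioo_succ hij).mono inter_subset_left inter_subset_left
  calc _ ≤ ∑' l, ∫⁻ s in Ioo (y l) (y (l + 1)) ∩ Iio t, F s := by
        refine ENNReal.tsum_le_tsum fun l => ?_
        split_ifs with h
        · exact lintegral_mono_set fun s hs => ⟨hs, hs.2.trans_le h⟩
        · exact zero_le
    _ = ∫⁻ s in ⋃ l, Ioo (y l) (y (l + 1)) ∩ Iio t, F s :=
        (lintegral_iUnion (fun l => measurableSet_Ioo.inter measurableSet_Iio) hdisj _).symm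
    _ ≤ _ := by
        refine lintegral_mono_set (iUnion_subset fun l => ?_)
        rintro s ⟨hs, hst⟩
        exact ⟨(hay.trans (hy (Nat.zero_le l))).trans_lt hs.1, hst⟩

theorem rpow_mul_rpow_mul_rpow_self {p r : ℝ} (hr0 : 0 < r) (hrp : r < p) {W V : ℝ≥0∞}
    (hW0 : W ≠ 0) (hWt : W ≠ ∞) :
    (W ^ (-(r / (p - r))) * V ^ (p * r / (p - r))) ^ (r / p) * W ^ (-(r / p)) * V ^ r =
      W ^ (-(r / (p - r))) * V ^ (p * r / (p - r)) := by
  have hp := hr0.trans hrp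
  have hpr := sub_pos.2 hrp
  rw [ENNReal.mul_rpow_of_nonneg _ _ (by positivity), ← ENNReal.rpow_mul, ← ENNReal.rpow_mul]
  calc _ = (W ^ (-(r / (p - r)) * (r / p)) * W ^ (-(r / p))) *
        (V ^ (p * r / (p - r) * (r / p)) * V ^ r) := by ring
    _ = _ := by
      rw [← ENNReal.rpow_add _ _ hW0 hWt, ← ENNReal.rpow_add_of_nonneg _ _ (by positivity) hr0.le]
      congr 2 <;> field_simp <;> ring

theorem exists_tsum_block_test_le {p q r : ℝ} (hq : 0 < q) (hqp : q < p) (hr0 : 0 < r)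
    (hr1 : r ≤ 1) (hrp : r < p) :
    ∃ κ : ℝ≥0∞, κ < ∞ ∧ ∀ (a b z : ℝ), z ∈ Ioo a b → ∀ u v w : ℝ → ℝ≥0∞,
      Measurable u → Measurable v → Measurable w → ∫⁻ s in Ioo z b, w s ≠ 0 →
      ∫⁻ s in Ioo z b, w s ≠ ∞ → ∫⁻ s in Ioo z b, u s ≠ ∞ →
      ∀ x : ℕ → ℝ, IsDyadicSeq w z b x → ∀ t : ℕ → ℝ, IsDyadicSeq u z b t →
      ∀ y : ℕ → ℝ, y 0 = x 0 → (∀ i, y (i + 1) ∈ Ico (x i) (x (i + 1))) →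
      (∀ l, Vr r v (y l) (y (l + 1)) ≠ ∞) →
      ∀ N : ℕ → ℕ, (∀ l, y (l + 1) ≤ t (N l)) → ∀ e g : ℕ → ℝ≥0∞,
      (∀ l, e l = (2⁻¹ ^ l * ∫⁻ s in Ioo z b, w s) ^ (-(r / (p - r))) *
        Vr r v (y l) (y (l + 1)) ^ (p * r / (p - r))) →
      (∀ m, g m = ∑' l, if N l = m then e l else 0) → (∀ m, g m ≠ ∞) →
      ∀ C : ℝ≥0∞, CesCesIneq a b r p q u v w C → ∀ γ : ℕ → ℝ≥0∞, ∑' m, γ m ^ p ≤ 1 →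
      ∑' m, (2⁻¹ ^ m * ∫⁻ s in Ioo z b, u s) * (g m ^ (p * r / (p - r))⁻¹) ^ q * γ m ^ q ≤
        κ * C ^ q := by
  have hp := hq.trans hqp
  have hpr := sub_pos.2 hrp
  have hqp' : 0 < q / p := div_pos hq hp
  obtain ⟨κ, hκ, hnorm⟩ := exists_lintegral_tsum_le hp
  have h2q : (2 : ℝ≥0∞) ^ q ≠ ∞ := ENNReal.rpow_ne_top_of_nonneg hq.le (by simp)
  refine ⟨2 * 2 ^ q * κ ^ (q / p), ENNReal.mul_lt_top (ENNReal.mul_lt_top (by simp) h2q.lt_top)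
    (ENNReal.rpow_lt_top_of_nonneg hqp'.le hκ.ne), ?_⟩
  intro a b z hz u v w hu hv hw hM0 hMt hU x hx t ht y hy0 hy hV N hN e g he hg hgt C hC γ hγ
  have hym := monotone_of_mem_Ico_succ hy0 hy
  set M := ∫⁻ s in Ioo z b, w s with hM
  have hW0 : ∀ j : ℕ, (2⁻¹ : ℝ≥0∞) ^ j * M ≠ 0 := fun j =>
    mul_ne_zero (pow_ne_zero _ (by simp)) hM0
  have hWt : ∀ j : ℕ, (2⁻¹ : ℝ≥0∞) ^ j * M ≠ ∞ := fun j =>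
    ENNReal.mul_ne_top (ENNReal.pow_ne_top (by simp)) hMt
  choose f hf hf0 hf1 hfV using fun l => exists_half_Vr_le hr0 hr1 hv (hV l)
  set c : ℕ → ℝ≥0∞ := fun l => γ (N l) * (e l * (2⁻¹ ^ l * M)⁻¹ * (g (N l))⁻¹) ^ (1 / p) with hc
  have hcp : ∀ l, (2⁻¹ ^ l * M) * c l ^ p = γ (N l) ^ p * (e l * (g (N l))⁻¹) := by
    intro l
    simp only [hc]
    rw [ENNReal.mul_rpow_of_nonneg _ _ hp.le, ← ENNReal.rpow_mul, one_div_mul_cancel hp.ne',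
      ENNReal.rpow_one]
    have := ENNReal.mul_inv_cancel (hW0 l) (hWt l)
    calc _ = γ (N l) ^ p * (e l * (g (N l))⁻¹) * ((2⁻¹ ^ l * M) * (2⁻¹ ^ l * M)⁻¹) := by ring
      _ = _ := by rw [this, mul_one]
  have hcr : ∀ l, c l ^ r * Vr r v (y l) (y (l + 1)) ^ r =
      γ (N l) ^ r * g (N l) ^ (-(r / p)) * e l := by
    intro l
    have hself := rpow_mul_rpow_mul_rpow_self hr0 hrp (V := Vr r v (y l) (y (l + 1)))
      (hW0 l) (hWt l)
    rw [← he] at hself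
    have hrp' : 0 < r / p := div_pos hr0 hp
    simp only [hc]
    rw [ENNReal.mul_rpow_of_nonneg _ _ hr0.le, ← ENNReal.rpow_mul, one_div_mul_eq_div,
      ENNReal.mul_rpow_of_nonneg _ _ hrp'.le, ENNReal.mul_rpow_of_nonneg _ _ hrp'.le,
      ENNReal.inv_rpow, ENNReal.inv_rpow, ← ENNReal.rpow_neg, ← ENNReal.rpow_neg]
    nth_rewrite 2 [← hself]
    ring
  have hS : ∑' l, (2⁻¹ ^ l * M) * c l ^ p ≤ 1 := by
    simp_rw [hcp]
    calc _ = ∑' l, ∑' m, if N l = m then γ m ^ p * (e l * (g m)⁻¹) else 0 := by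
          simp_rw [tsum_ite_eq']
      _ = ∑' m, γ m ^ p * (g m)⁻¹ * g m := by
          rw [ENNReal.tsum_comm]
          refine tsum_congr fun m => ?_
          nth_rewrite 3 [hg]
          rw [← ENNReal.tsum_mul_left]
          refine tsum_congr fun l => ?_
          split_ifs <;> ring
      _ ≤ ∑' m, γ m ^ p := by
          refine ENNReal.tsum_le_tsum fun m => ?_
          rw [mul_assoc]
          exact (mul_le_mul_right (ENNReal.inv_mul_le_one _) _).trans_eq (mul_one _)
      _ ≤ 1 := hγ
  have hN1 := hnorm a b z hz w hw hMt x hx f hf hf1 (fun l s hs => hf0 l s fun hmem => by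
    refine absurd hmem.1 (not_lt.2 (hs.trans ?_))
    cases l with
    | zero => exact hy0.ge
    | succ l => exact (hy l).1) c
  have hT := hC.lintegral_le hq (f := fun s => ∑' l, c l * f l s)
    (Measurable.tsum fun l => (hf l).const_mul _)
  have hlow : ∀ m, ∀ s ∈ Ioo (t m) (t (m + 1)),
      (γ m * g m ^ (p * r / (p - r))⁻¹ / 2) ^ r ≤
        ∫⁻ σ in Ioo a s, (∑' l, c l * f l σ) ^ r * v σ := by
    intro m s hs
    rcases eq_or_ne (g m) 0 with hg0 | hg0
    · rw [hg0, ENNReal.zero_rpow_of_pos (by positivity)]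
      simp [hr0]
    have hpow : g m ^ (-(r / p)) * g m = (g m ^ (p * r / (p - r))⁻¹) ^ r := by
      nth_rewrite 2 [← ENNReal.rpow_one (g m)]
      rw [← ENNReal.rpow_add _ _ hg0 (hgt m), ← ENNReal.rpow_mul]
      congr 1
      field_simp
      ring
    calc _ = (2 ^ r)⁻¹ * (γ m ^ r * g m ^ (-(r / p)) * g m) := by
          rw [ENNReal.div_rpow_of_nonneg _ _ hr0.le, ENNReal.mul_rpow_of_nonneg _ _ hr0.le,
            mul_assoc, hpow, ENNReal.div_eq_inv_mul]
      _ = ∑' l, if N l = m then (2 ^ r)⁻¹ * (c l ^ r * Vr r v (y l) (y (l + 1)) ^ r) else 0 := by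
          nth_rewrite 2 [hg]
          rw [← ENNReal.tsum_mul_left, ← ENNReal.tsum_mul_left]
          refine tsum_congr fun l => ?_
          split_ifs with h
          · rw [hcr, h]
          · simp
      _ ≤ ∑' l, (if y (l + 1) ≤ s then
            ∫⁻ σ in Ioo (y l) (y (l + 1)), (∑' l, c l * f l σ) ^ r * v σ else 0) := by
          refine ENNReal.tsum_le_tsum fun l => ?_
          split_ifs with h h' h'
          · calc _ = c l ^ r * (Vr r v (y l) (y (l + 1)) / 2) ^ r := by
                  rw [ENNReal.div_rpow_of_nonneg _ _ hr0.le, ENNReal.div_eq_inv_mul]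
                  ring
              _ ≤ c l ^ r * ∫⁻ σ in Ioo (y l) (y (l + 1)), f l σ ^ r * v σ := by
                  gcongr
                  exact hfV l
              _ = ∫⁻ σ in Ioo (y l) (y (l + 1)), c l ^ r * (f l σ ^ r * v σ) :=
                  (lintegral_const_mul _ (((hf l).pow_const _).mul hv)).symm
              _ ≤ _ := by
                  refine lintegral_mono fun σ => ?_
                  simp only
                  rw [← mul_assoc]
                  gcongr
                  exact ennreal_const_mul_tsum_rpow_le hr0.le c (fun l => f l σ) l
          · exact absurd ((hN l).trans (h ▸ hs.1.le)) h'
          · exact zero_le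
          · exact le_rfl
      _ ≤ _ := tsum_ite_lintegral_Ioo_le hym (by rw [hy0, hx.zero]; exact hz.1.le) _ _
  calc _ ≤ ∑' m, 2 * 2 ^ q * ∫⁻ s in Ioo (t m) (t (m + 1)),
        (∫⁻ σ in Ioo a s, (∑' l, c l * f l σ) ^ r * v σ) ^ (q / r) * u s := by
        refine ENNReal.tsum_le_tsum fun m => ?_
        have hle : (γ m * g m ^ (p * r / (p - r))⁻¹ / 2) ^ q *
            ∫⁻ s in Ioo (t m) (t (m + 1)), u s ≤ ∫⁻ s in Ioo (t m) (t (m + 1)),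
            (∫⁻ σ in Ioo a s, (∑' l, c l * f l σ) ^ r * v σ) ^ (q / r) * u s := by
          rw [← lintegral_const_mul _ hu]
          refine setLIntegral_mono' measurableSet_Ioo fun s hs => ?_
          gcongr
          calc _ = ((γ m * g m ^ (p * r / (p - r))⁻¹ / 2) ^ r) ^ (q / r) := by
                rw [← ENNReal.rpow_mul, mul_div_cancel₀ _ hr0.ne']
            _ ≤ _ := by
                gcongr
                exact hlow m s hs
        refine le_trans (le_of_eq ?_) (mul_le_mul_right hle _)
        rw [ht.mass_block hU, ENNReal.div_rpow_of_nonneg _ _ hq.le,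
          ENNReal.mul_rpow_of_nonneg _ _ hq.le, mul_half_pow_succ, ENNReal.div_eq_inv_mul]
        have h2 : (2 : ℝ≥0∞) ^ q * (2 ^ q)⁻¹ = 1 := ENNReal.mul_inv_cancel (by simp) h2q
        calc _ = 2 * (2⁻¹ ^ (m + 1) * ∫⁻ s in Ioo z b, u s) *
              (g m ^ (p * r / (p - r))⁻¹) ^ q * γ m ^ q * (2 ^ q * (2 ^ q)⁻¹) := by
              rw [h2, mul_one]
          _ = _ := by ring
    _ = 2 * 2 ^ q * ∫⁻ s in Ioo z b,
        (∫⁻ σ in Ioo a s, (∑' l, c l * f l σ) ^ r * v σ) ^ (q / r) * u s := by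
        rw [ENNReal.tsum_mul_left, ← ht.lintegral_eq_tsum]
    _ ≤ 2 * 2 ^ q * (C ^ q * (κ * 1) ^ (q / p)) := by
        gcongr _ * ?_
        refine (lintegral_mono_set (Ioo_subset_Ioo_left hz.1.le)).trans (hT.trans ?_)
        gcongr
        exact hN1.trans (by gcongr)
    _ = _ := by rw [mul_one]; ring

theorem exists_tsum_block_mul_rpow_le {p q r : ℝ} (hq : 0 < q) (hqp : q < p) (hr0 : 0 < r)
    (hr1 : r ≤ 1) (hrp : r < p) :
    ∃ κ : ℝ≥0∞, κ < ∞ ∧ ∀ (a b z : ℝ), z ∈ Ioo a b → ∀ u v w : ℝ → ℝ≥0∞,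
      IsWeight a b u → IsWeight a b v → IsWeight a b w →
      (∀ x ∈ Ioo a b, 0 < (∫⁻ t in Ioo x b, w t) ∧ (∫⁻ t in Ioo x b, w t) < ∞) →
      ∀ C : ℝ≥0∞, C ≠ ∞ → CesCesIneq a b r p q u v w C →
      ∀ x : ℕ → ℝ, IsDyadicSeq w z b x → ∀ y : ℕ → ℝ, y 0 = x 0 →
      (∀ i, y (i + 1) ∈ Ico (x i) (x (i + 1))) →
      ∑' i, (∫⁻ t in Ioo (y (i + 1)) (x (i + 1)), (∫⁻ s in Ioo t b, u s) ^ (q / (p - q)) * u t) *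
        (∫⁻ s in Ioo z (y (i + 1)), (∫⁻ σ in Ioo s b, w σ) ^ (-(p / (p - r))) * w s *
          Vr r v s (y (i + 1)) ^ (p * r / (p - r))) ^ ((p - r) * q / ((p - q) * r)) ≤
        κ * C ^ (p * q / (p - q)) := by
  have hp := hq.trans hqp
  have hpq := sub_pos.2 hqp
  have hpr := sub_pos.2 hrp
  set β := p * r / (p - r) with hβ
  have hβ0 : 0 < β := by positivity
  set θ := (p - r) * q / ((p - q) * r) with hθ
  have hθ0 : 0 < θ := by positivity
  have hτ0 : 0 < p / (p - q) := by positivity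
  obtain ⟨κ₁, hκ₁, hG⟩ := exists_lintegral_mul_Vr_le hr0 hr1 hrp
  obtain ⟨κ₂, hκ₂, hhardy⟩ := exists_lintegral_le_of_dyadic hq hqp hβ0
  obtain ⟨κ₃, hκ₃, htest⟩ := exists_tsum_block_test_le hq hqp hr0 hr1 hrp
  refine ⟨κ₁ ^ θ * (κ₂ * κ₃ ^ (p / (p - q))), ENNReal.mul_lt_top
    (ENNReal.rpow_lt_top_of_nonneg hθ0.le hκ₁.ne) (ENNReal.mul_lt_top hκ₂
    (ENNReal.rpow_lt_top_of_nonneg hτ0.le hκ₃.ne)), ?_⟩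
  intro a b z hz u v w hu hv hw hW C hCt hC x hx y hy0 hy
  have hVU : ∀ x t, a < x → x < t → t < b → Vr r v x t * (∫⁻ s in Ioo t b, u s) ^ (1 / q) ≤
      C * (∫⁻ s in Ioo x b, w s) ^ (1 / p) := fun x t h1 h2 h3 =>
    hC.Vr_mul_le hr0 hr1 hp hq hu.1 hv.1 h1 h2 h3
  have hM0 := (hW z hz).1.ne'
  have hMt := (hW z hz).2.ne
  have hUt : ∫⁻ s in Ioo z b, u s ≠ ∞ :=
    lintegral_Ioo_ne_top_of_Vr_mul_le hr0 hr1 hp hq hv hW hCt hVU hz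
  obtain ⟨t, ht⟩ := exists_isDyadicSeq hu.1 hz.2
    (fun s hs => (hu.2 s ⟨hz.1.trans hs.1, hs.2⟩).1) hUt
  have hzx : ∀ l, z ≤ x l := hx.le
  have hay : ∀ l, a < y l := fun l => by
    cases l with
    | zero => rw [hy0, hx.zero]; exact hz.1
    | succ l => exact hz.1.trans_le ((hzx l).trans (hy l).1)
  have hyb : ∀ l, y (l + 1) < b := fun l => (hy l).2.trans (hx.lt _)
  have hV : ∀ l, Vr r v (y l) (y (l + 1)) ≠ ∞ := fun l =>
    Vr_ne_top_of_Vr_mul_le hr0 hr1 hp hq hu hW hCt hVU (hay l) (hyb l)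
  choose N' hN' using fun l => ht.exists_mem (y (l + 1)) ⟨(hzx l).trans (hy l).1, hyb l⟩
  set e : ℕ → ℝ≥0∞ := fun l => (2⁻¹ ^ l * ∫⁻ s in Ioo z b, w s) ^ (-(r / (p - r))) *
    Vr r v (y l) (y (l + 1)) ^ β with he
  have het : ∀ l, e l ≠ ∞ := fun l => ENNReal.mul_ne_top (by
      rw [ENNReal.rpow_neg, Ne, ENNReal.inv_eq_top, ENNReal.rpow_eq_zero_iff]
      have : (2⁻¹ : ℝ≥0∞) ^ l * ∫⁻ s in Ioo z b, w s ≠ 0 :=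
        mul_ne_zero (pow_ne_zero _ (by simp)) hM0
      have hr' : 0 < r / (p - r) := by positivity
      simp only [this, false_and, false_or, not_and, not_lt]
      exact fun _ => hr'.le) (ENNReal.rpow_ne_top_of_nonneg hβ0.le (hV l))
  set g : ℕ → ℝ≥0∞ := fun m => ∑' l, if N' l + 1 = m then e l else 0 with hg
  have hgt : ∀ m, g m ≠ ∞ := by
    intro m
    obtain ⟨k, hk⟩ := hx.exists_mem (t m) ⟨ht.le m, ht.lt m⟩
    have : g m = ∑ l ∈ Finset.range (k + 1), if N' l + 1 = m then e l else 0 := by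
      refine tsum_eq_sum fun l hl => if_neg fun h => hl (Finset.mem_range.2 ?_)
      refine hx.strictMono.lt_iff_lt.1 ?_
      calc x l ≤ y (l + 1) := (hy l).1
        _ < t m := h ▸ (hN' l).2
        _ < _ := hk.2
    rw [this]
    refine ENNReal.sum_ne_top.2 fun l _ => ?_
    split_ifs
    · exact het l
    · simp
  set B : ℝ → ℝ≥0∞ := fun s => ∑' l, if y (l + 1) ≤ s then e l else 0 with hB
  have hBg : ∀ m, ∀ s ∈ Ioo (t m) (t (m + 1)), B s ≤ ∑ j ∈ Finset.range (m + 2), g j := by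
    intro m s hs
    simp only [hB, hg]
    rw [← Summable.tsum_finsetSum fun _ _ => ENNReal.summable]
    refine ENNReal.tsum_le_tsum fun l => ?_
    split_ifs with h
    · have hlt : N' l < m + 1 := ht.strictMono.lt_iff_lt.1 ((hN' l).1.trans_lt (h.trans_lt hs.2))
      rw [Finset.sum_ite_eq, if_pos (Finset.mem_range.2 (by omega))]
    · exact zero_le
  have hroot : ∀ c : ℝ≥0∞, (c ^ β⁻¹) ^ β = c := fun c => by
    rw [← ENNReal.rpow_mul, inv_mul_cancel₀ hβ0.ne', ENNReal.rpow_one]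
  have hH := hhardy z b u hu.1 hUt t ht (fun s => B s ^ β⁻¹) (fun m => g m ^ β⁻¹)
    (fun m s hs => by simpa only [hroot] using hBg m s hs) (κ₃ * C ^ q) fun γ hγ =>
      htest a b z hz u v w hu.1 hv.1 hw.1 hM0 hMt hUt x hx t ht y hy0 hy hV (fun l => N' l + 1)
        (fun l => (hN' l).2.le) e g (fun _ => rfl) (fun _ => rfl) hgt C hC γ hγ
  set A : ℝ → ℝ≥0∞ := fun s => (∫⁻ σ in Ioo s b, u σ) ^ (q / (p - q)) * u s with hA
  have hGB : ∀ i, ∀ s ∈ Ioo (y (i + 1)) (x (i + 1)),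
      ∫⁻ s in Ioo z (y (i + 1)), (∫⁻ σ in Ioo s b, w σ) ^ (-(p / (p - r))) * w s *
          Vr r v s (y (i + 1)) ^ β ≤ κ₁ * B s := by
    intro i s hs
    refine (hG z b v w hw.1 hM0 hMt x hx y hy0 hy i).trans ?_
    gcongr _ * ?_
    refine le_trans (Finset.sum_le_sum fun l hl => ?_) (ENNReal.sum_le_tsum (Finset.range (i + 1)))
    have hym := monotone_of_mem_Ico_succ hy0 hy
    rw [if_pos ((hym (Finset.mem_range.1 hl)).trans hs.1.le)]
  have hAm : Measurable A :=
    ((antitone_lintegral_Ioo_left u b).measurable.pow_const _).mul hu.1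
  calc _ ≤ ∑' i, ∫⁻ s in Ioo (x i) (x (i + 1)), κ₁ ^ θ * (A s * B s ^ θ) := by
        refine ENNReal.tsum_le_tsum fun i => ?_
        rw [← lintegral_mul_const _ hAm]
        refine le_trans ?_ (lintegral_mono_set (Ioo_subset_Ioo_left (hy i).1))
        refine setLIntegral_mono' measurableSet_Ioo fun s hs => ?_
        calc _ ≤ A s * (κ₁ * B s) ^ θ := by
              gcongr
              exact hGB i s hs
          _ = _ := by
              rw [ENNReal.mul_rpow_of_nonneg _ _ hθ0.le]
              ring
    _ = κ₁ ^ θ * ∫⁻ s in Ioo z b, A s * B s ^ θ := by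
        rw [← hx.lintegral_eq_tsum,
          lintegral_const_mul' _ _ (ENNReal.rpow_ne_top_of_nonneg hθ0.le hκ₁.ne)]
    _ ≤ κ₁ ^ θ * (κ₂ * (κ₃ * C ^ q) ^ (p / (p - q))) := by
        gcongr _ * ?_
        refine le_trans (le_of_eq ?_) hH
        refine lintegral_congr fun s => ?_
        rw [← ENNReal.rpow_mul]
        congr 2
        rw [hβ, hθ]
        field_simp
    _ = _ := by
        rw [ENNReal.mul_rpow_of_nonneg _ _ hτ0.le, ← ENNReal.rpow_mul, ← mul_assoc, ← mul_assoc,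
          mul_div_assoc', mul_comm q p]
        ring

theorem exists_C₆_le {p q r : ℝ} (hq : 0 < q) (hqp : q < p) (hr0 : 0 < r) (hr1 : r ≤ 1)
    (hrp : r < p) :
    ∃ κ : ℝ≥0∞, κ < ∞ ∧ ∀ (a b : ℝ), a < b → ∀ u v w : ℝ → ℝ≥0∞,
      IsWeight a b u → IsWeight a b v → IsWeight a b w →
      (∀ x ∈ Ioo a b, 0 < (∫⁻ t in Ioo x b, w t) ∧ (∫⁻ t in Ioo x b, w t) < ∞) →
      ∀ C : ℝ≥0∞, C ≠ ∞ → CesCesIneq a b r p q u v w C → C₆ a b r p q u v w ≤ κ * C := by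
  have hp := hq.trans hqp
  have hpq := sub_pos.2 hqp
  have hpr := sub_pos.2 hrp
  have hα : 0 < p * q / (p - q) := div_pos (mul_pos hp hq) hpq
  obtain ⟨κ₀, hκ₀, hblock⟩ := exists_tsum_block_mul_rpow_le hq hqp hr0 hr1 hrp
  set β := p * r / (p - r) with hβ
  have hβ0 : 0 < β := by positivity
  set θ := (p - r) * q / ((p - q) * r) with hθ
  have hθ0 : 0 < θ := by positivity
  set κ : ℝ≥0∞ := 2 * (2 * κ₀) with hκ
  have hκt : κ < ∞ := ENNReal.mul_lt_top (by simp) (ENNReal.mul_lt_top (by simp) hκ₀)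
  refine ⟨κ ^ (p * q / (p - q))⁻¹, ENNReal.rpow_lt_top_of_nonneg (by positivity) hκt.ne, ?_⟩
  intro a b hab u v w hu hv hw hW C hCt hC
  suffices hmain : C₆ a b r p q u v w ^ (p * q / (p - q)) ≤ κ * C ^ (p * q / (p - q)) by
    rw [← ENNReal.rpow_le_rpow_iff hα, ENNReal.mul_rpow_of_nonneg _ _ hα.le, ← ENNReal.rpow_mul,
      inv_mul_cancel₀ hα.ne', ENNReal.rpow_one]
    exact hmain
  rw [C₆_rpow hq hqp]
  set A : ℝ → ℝ≥0∞ := fun s => (∫⁻ σ in Ioo s b, u σ) ^ (q / (p - q)) * u s with hA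
  have hAm : Measurable A :=
    ((antitone_lintegral_Ioo_left u b).measurable.pow_const _).mul hu.1
  set J : ℝ → ℝ → ℝ≥0∞ := fun y x => ∫⁻ t in Ioo y x, A t with hJ
  set G : ℝ → ℝ → ℝ≥0∞ := fun z y => ∫⁻ s in Ioo z y,
    (∫⁻ σ in Ioo s b, w σ) ^ (-(p / (p - r))) * w s * Vr r v s y ^ β with hG
  have hGanti : ∀ y, Antitone fun z => G z y := fun y => antitone_lintegral_Ioo_left _ y
  have hGmono : ∀ z, Monotone (G z) := fun z y y' hy => by
    refine le_trans (lintegral_mono fun s => ?_) (lintegral_mono_set (Ioo_subset_Ioo_right hy))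
    simp only
    gcongr
    exact Vr_mono hr0 hr1 le_rfl hy
  have hJmono : ∀ y, Monotone (J y) := fun y => monotone_lintegral_Ioo_right A y
  set T : ℝ → ℝ → ℝ → ℝ≥0∞ := fun z y x =>
    (∫⁻ s in Ioo y b, w s)⁻¹ * (J y x * G z y ^ θ) with hT
  have hSmono : ∀ z, Monotone fun x => ⨆ y ∈ Ico z x, T z y x := fun z x x' hx =>
    iSup₂_le fun y hy => le_iSup₂_of_le y ⟨hy.1, hy.2.trans_le hx⟩ (by
      simp only [hT]
      gcongr
      exact hJmono y hx)
  refine lintegral_Ioo_le_of_forall_truncation hab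
    (F := fun z x => w x * ⨆ y ∈ Ico z x, T z y x)
    (fun z => hw.1.mul (hSmono z).measurable) (fun x z z' hz => ?_) (fun x hx c hc => ?_)
    fun z hz => ?_
  · simp only
    gcongr w x * ?_
    refine iSup₂_le fun y hy => le_iSup₂_of_le y ⟨hz.trans hy.1, hy.2⟩ ?_
    simp only [hT]
    gcongr
    exact hGanti y hz
  · have hc' : c < w x * ⨆ y ∈ Ioo a x, T a y x := by
      refine hc.trans_le ?_
      gcongr w x * ?_
      refine essSup_le_of_ae_le _ ?_
      filter_upwards [ae_restrict_mem measurableSet_Ioo] with y hy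
      refine le_iSup₂_of_le y hy ?_
      rw [lintegral_mul_const _ hAm]
    simp only [ENNReal.mul_iSup, lt_iSup_iff] at hc'
    obtain ⟨y, hy, hcy⟩ := hc'
    set K := w x * ((∫⁻ s in Ioo y b, w s)⁻¹ * J y x) with hK
    have hKT : ∀ z, w x * T z y x = G z y ^ θ * K := fun z => by
      simp only [hT, hK]
      ring
    rw [hKT] at hcy
    have hK0 : K ≠ 0 := fun h => by simp [h] at hcy
    have hcon : ∃ z ∈ Ioo a y, c < G z y ^ θ * K := by
      by_contra! hcon
      refine absurd hcy (not_lt.2 ?_)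
      rw [← ENNReal.le_div_iff_mul_le (.inl hK0) (.inr hcy.ne_top), ← ENNReal.le_rpow_inv_iff hθ0]
      refine lintegral_Ioo_le_of_forall_left hy.1 fun z hz => ?_
      rw [ENNReal.le_rpow_inv_iff hθ0, ENNReal.le_div_iff_mul_le (.inl hK0) (.inr hcy.ne_top)]
      exact hcon z hz
    obtain ⟨z, hz, hcz⟩ := hcon
    refine ⟨z, ⟨hz.1, hz.2.trans hy.2⟩, hcz.trans_le ?_⟩
    rw [← hKT]
    gcongr
    exact le_iSup₂ (f := fun y' _ => T z y' x) y ⟨hz.2.le, hy.2⟩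
  obtain ⟨x, hx⟩ := exists_isDyadicSeq hw.1 hz.2
    (fun t ht => (hw.2 t ⟨hz.1.trans ht.1, ht.2⟩).1) (hW z hz).2.ne
  set M := ∫⁻ s in Ioo z b, w s with hM
  have hM0 : M ≠ 0 := (hW z hz).1.ne'
  have hMt : M ≠ ∞ := (hW z hz).2.ne
  set m : ℕ → ℝ≥0∞ := fun j => 2⁻¹ ^ (j + 1) * M with hm
  have hm0 : ∀ j : ℕ, m j ≠ 0 := fun j => mul_ne_zero (pow_ne_zero _ (by simp)) hM0
  have hmt : ∀ j : ℕ, m j ≠ ∞ := fun j => ENNReal.mul_ne_top (ENNReal.pow_ne_top (by simp)) hMt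
  set ι := {g : ℕ → ℝ // ∀ i, g i ∈ Ico (x i) (x (i + 1))} with hι
  have : Nonempty ι := ⟨⟨x, fun i => ⟨le_rfl, hx.lt_succ i⟩⟩⟩
  set ψ : ℕ → ι → ℝ≥0∞ := fun i g => J (g.1 i) (x (i + 1)) * G z (g.1 i) ^ θ with hψ
  have hSle : ∀ k, ∀ t ∈ Ioo (x k) (x (k + 1)), ⨆ y ∈ Ico z t, T z y t ≤
      ∑ i ∈ Finset.range (k + 1), (m i)⁻¹ * ⨆ g, ψ i g := by
    intro k t ht
    refine iSup₂_le fun y hy => ?_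
    obtain ⟨j, hj⟩ := hx.exists_mem y ⟨hy.1, hy.2.trans (ht.2.trans (hx.lt _))⟩
    have hjk : j ≤ k :=
      Nat.lt_succ_iff.1 (hx.strictMono.lt_iff_lt.1 (hj.1.trans_lt (hy.2.trans ht.2)))
    set g₀ : ι := ⟨Function.update x j y, fun i => by
      rcases eq_or_ne i j with rfl | hij
      · simpa using hj
      · simpa [hij] using hx.lt_succ i⟩ with hg₀
    have hyg : ∀ i ∈ Finset.Ico j (k + 1), y ≤ g₀.1 i := fun i hi => by
      rcases eq_or_lt_of_le (Finset.mem_Ico.1 hi).1 with rfl | hij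
      · simp [hg₀]
      · simpa [hg₀, hij.ne'] using hj.2.le.trans (hx.strictMono.monotone hij)
    have hJsum : J y (x (k + 1)) = ∑ i ∈ Finset.Ico j (k + 1), J (g₀.1 i) (x (i + 1)) := by
      clear hyg ht
      induction k, hjk using Nat.le_induction with
      | base => simp [hg₀]
      | succ k hk ih =>
        have hkj : k + 1 ≠ j := by omega
        rw [Finset.sum_Ico_succ_top (by omega), ← ih rfl]
        simp only [hg₀, Function.update_of_ne hkj]
        exact lintegral_Ioo_split A (hj.2.le.trans (hx.strictMono.monotone (by omega)))
          (hx.lt_succ _).le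
    calc T z y t ≤ (∫⁻ s in Ioo y b, w s)⁻¹ * (J y (x (k + 1)) * G z y ^ θ) := by
          simp only [hT]
          gcongr
          exact hJmono y ht.2.le
      _ = ∑ i ∈ Finset.Ico j (k + 1),
          (∫⁻ s in Ioo y b, w s)⁻¹ * (J (g₀.1 i) (x (i + 1)) * G z y ^ θ) := by
          rw [hJsum, Finset.sum_mul, Finset.mul_sum]
      _ ≤ ∑ i ∈ Finset.Ico j (k + 1), (m i)⁻¹ * ⨆ g, ψ i g := by
          refine Finset.sum_le_sum fun i hi => ?_
          gcongr ?_⁻¹ * ?_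
          · simp only [hm]
            rw [← hx.mass]
            refine antitone_lintegral_Ioo_left w b ?_
            exact hj.2.le.trans (hx.strictMono.monotone (by
              have := (Finset.mem_Ico.1 hi).1
              omega))
          · refine le_trans ?_ (le_iSup (ψ i) g₀)
            simp only [hψ]
            gcongr
            exact hGmono z (hyg i hi)
      _ ≤ _ := Finset.sum_le_sum_of_subset fun i hi =>
          Finset.mem_range.2 (Finset.mem_Ico.1 hi).2
  have hτ : ∑' i, ⨆ g, ψ i g ≤ 2 * (κ₀ * C ^ (p * q / (p - q))) := by
    refine tsum_iSup_le_two_mul _ _ fun g => ?_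
    exact hblock a b z hz u v w hu hv hw hW C hCt hC x hx
      (fun n => Nat.casesOn n (x 0) fun i => (g i).1 i) rfl fun i => (g i).2 i
  calc ∫⁻ t in Ioo z b, w t * ⨆ y ∈ Ico z t, T z y t
      = ∑' k, ∫⁻ t in Ioo (x k) (x (k + 1)), w t * ⨆ y ∈ Ico z t, T z y t :=
        hx.lintegral_eq_tsum _
    _ ≤ ∑' k, ∑ i ∈ Finset.range (k + 1), 2⁻¹ ^ (k + 1) * M * ((m i)⁻¹ * ⨆ g, ψ i g) := by
        refine ENNReal.tsum_le_tsum fun k => ?_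
        rw [← Finset.mul_sum, ← hx.mass_block hMt, ← lintegral_mul_const _ hw.1]
        refine setLIntegral_mono' measurableSet_Ioo fun t ht => ?_
        gcongr
        exact hSle k t ht
    _ = ∑' i, ∑' n, 2⁻¹ ^ (i + n + 1) * M * ((m i)⁻¹ * ⨆ g, ψ i g) := by
        rw [← tsum_range_succ_sub]
        refine tsum_congr fun k => Finset.sum_congr rfl fun i hi => ?_
        have hik : i + (k - i) = k := by
          have := Finset.mem_range.1 hi
          omega
        rw [hik]
    _ = ∑' i, ∑' n, 2⁻¹ ^ n * ⨆ g, ψ i g := by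
        refine tsum_congr fun i => tsum_congr fun n => ?_
        have hmm := ENNReal.mul_inv_cancel (hm0 i) (hmt i)
        calc _ = 2⁻¹ ^ n * (m i * (m i)⁻¹) * ⨆ g, ψ i g := by
              simp only [hm]
              rw [show i + n + 1 = (i + 1) + n by ring, pow_add]
              ring
          _ = _ := by rw [hmm, mul_one]
    _ = 2 * ∑' i, ⨆ g, ψ i g := by
        simp_rw [ENNReal.tsum_mul_right, ENNReal.tsum_geometric, ENNReal.one_sub_inv_two, inv_inv]
        rw [ENNReal.tsum_mul_left]
    _ ≤ 2 * (2 * (κ₀ * C ^ (p * q / (p - q)))) := by gcongr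
    _ = κ * C ^ (p * q / (p - q)) := by rw [hκ]; ring

/-- case (vi) of the main theorem: for `q < p`, `q < 1`, `r < p`, `r ≤ 1`,
the inequality holds iff `C₁, C₅, C₆ < ∞`, and `C ≈ C₁ + C₅ + C₆`. -/
theorem main_case_vi (p q r : ℝ) (hq0 : 0 < q) (hr0 : 0 < r) (hqp : q < p) (hq1 : q < 1)
    (hrp : r < p) (hr1 : r ≤ 1) :
    ∃ κ₁ κ₂ : ℝ≥0∞, 0 < κ₁ ∧ κ₂ < ∞ ∧
    ∀ (a b : ℝ), a < b → ∀ u v w : ℝ → ℝ≥0∞,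
      IsWeight a b u → IsWeight a b v → IsWeight a b w →
      (∀ x ∈ Set.Ioo a b,
        0 < (∫⁻ t in Set.Ioo x b, w t) ∧ (∫⁻ t in Set.Ioo x b, w t) < ∞) →
      (((∃ C : ℝ≥0∞, C < ∞ ∧ CesCesIneq a b r p q u v w C) ↔
          (C₁ a b r p q u v w < ∞ ∧ C₅ a b r p q u v w < ∞ ∧ C₆ a b r p q u v w < ∞)) ∧
        κ₁ * (C₁ a b r p q u v w + C₅ a b r p q u v w + C₆ a b r p q u v w) ≤
          BestC a b r p q u v w ∧
        BestC a b r p q u v w ≤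
          κ₂ * (C₁ a b r p q u v w + C₅ a b r p q u v w + C₆ a b r p q u v w)) := by
  have hp := hq0.trans hqp
  obtain ⟨κ, hκ, hsuff⟩ := exists_cesCesIneq hq0 hqp hq1 hr0 hr1 hrp
  obtain ⟨κ₅, hκ₅, h₅⟩ := exists_C₅_le hq0 hqp hq1 hr0 hr1
  obtain ⟨κ₆, hκ₆, h₆⟩ := exists_C₆_le hq0 hqp hr0 hr1 hrp
  have hκ0 : 1 + κ₅ + κ₆ ≠ 0 := by simp
  have hκt : 1 + κ₅ + κ₆ ≠ ∞ := by simp [hκ₅.ne, hκ₆.ne]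
  refine ⟨(1 + κ₅ + κ₆)⁻¹, κ + 1, ENNReal.inv_pos.2 hκt, by simp [hκ], ?_⟩
  intro a b hab u v w hu hv hw hW
  have h₁ : ∀ C : ℝ≥0∞, CesCesIneq a b r p q u v w C → C₁ a b r p q u v w ≤ C := fun C hC =>
    C₁_le_of_Vr_mul_le hW fun x t hx hxt ht => hC.Vr_mul_le hr0 hr1 hp hq0 hu.1 hv.1 hx hxt ht
  refine ⟨⟨?_, ?_⟩, le_sInf fun C hC => ?_, ?_⟩
  · rintro ⟨C, hCt, hC⟩
    exact ⟨(h₁ C hC).trans_lt hCt,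
      (h₅ a b hab u v w hu hv hw hW C hCt.ne hC).trans_lt (ENNReal.mul_lt_top hκ₅ hCt),
      (h₆ a b hab u v w hu hv hw hW C hCt.ne hC).trans_lt (ENNReal.mul_lt_top hκ₆ hCt)⟩
  · rintro ⟨hC₁, hC₅, hC₆⟩
    exact ⟨_, ENNReal.mul_lt_top hκ (ENNReal.add_lt_top.2 ⟨ENNReal.add_lt_top.2 ⟨hC₁, hC₅⟩, hC₆⟩),
      hsuff a b hab u v w hu hv hw hW hC₁.ne⟩
  · rcases eq_or_ne C ∞ with rfl | hCt
    · exact le_top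
    calc _ ≤ (1 + κ₅ + κ₆)⁻¹ * (C + κ₅ * C + κ₆ * C) := by
          gcongr
          · exact h₁ C hC
          · exact h₅ a b hab u v w hu hv hw hW C hCt hC
          · exact h₆ a b hab u v w hu hv hw hW C hCt hC
      _ = (1 + κ₅ + κ₆)⁻¹ * (1 + κ₅ + κ₆) * C := by ring
      _ = C := by rw [ENNReal.inv_mul_cancel hκ0 hκt, one_mul]
  · rcases eq_or_ne (C₁ a b r p q u v w) ∞ with hC₁ | hC₁
    · rw [hC₁, top_add, top_add, ENNReal.mul_top (by simp)]
      exact le_top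
    · refine (sInf_le (hsuff a b hab u v w hu hv hw hW hC₁)).trans ?_
      gcongr
      exact le_self_add
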